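/- arXiv:0707.1596 — 9 statements merged into one kernel-verified Lean document; each statement's English description precedes it below -/
import Mathlib

section
/- Let R > 0 and let C_R = {g ∈ ℂ : g ≠ 0 and Re(1/g) > 1/R} be the Nevanlinna disk of radius R. Suppose f and h are complex-analytic on C_R, (a_n) is a sequence of complex numbers, and there exist constants A > 0 and B > 0 such that for every N ∈ ℕ and every g ∈ C_R one has |f(g) − ∑_{n=0}^{N−1} a_n g^n| ≤ A·B^N·N!·|g|^N and |h(g) − ∑_{n=0}^{N−1} a_n g^n| ≤ A·B^N·N!·|g|^N. Then f(g) = h(g) for every g ∈ C_R, and moreover |a_n| ≤ A·B^n·n! for every n ∈ ℕ. -/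
open Filter Topology in
/-- A function on a closed right half-plane with exponential decay in all directions vanishes. -/
lemma carleman_aux (δ c M : ℝ) (hδ : 0 < δ) (hc : 0 < c) (F : ℂ → ℂ)
    (hF : ∀ z : ℂ, δ ≤ z.re → DifferentiableAt ℂ F z)
    (hb : ∀ z : ℂ, δ ≤ z.re → ‖F z‖ ≤ M * Real.exp (-(c * ‖z‖))) :
    ∀ z : ℂ, δ ≤ z.re → F z = 0 := by
  have hM : 0 ≤ M := by
    have := (norm_nonneg _).trans (hb (δ : ℂ) (by simp))
    exact nonneg_of_mul_nonneg_left this (Real.exp_pos _)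
  let G : ℂ → ℂ := fun w => F (w + δ) * Complex.exp (-((c / 2 : ℝ) * ((w + δ) * Complex.log (w + δ))))
  have hre : ∀ w : ℂ, 0 ≤ w.re → δ ≤ (w + δ).re := by
    intro w hw; simpa using hw
  have hGn : ∀ w : ℂ, ‖G w‖ = ‖F (w + δ)‖ * Real.exp (-(c / 2 * ((w + δ).re * Real.log ‖w + δ‖
      - (w + δ).im * (w + δ).arg))) := by
    intro w
    simp only [G, norm_mul, Complex.norm_exp, Complex.neg_re, Complex.re_ofReal_mul]
    rw [Complex.mul_re, Complex.log_re, Complex.log_im]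
  have hGb : ∀ w : ℂ, 0 ≤ w.re → ‖G w‖ ≤ M * Real.exp (c / 2) := by
    intro w hw
    have h1 := hre w hw
    rw [hGn]
    generalize w + (δ : ℂ) = z at *
    have hz : 0 < z.re := hδ.trans_le h1
    have hn : 0 < ‖z‖ := hz.trans_le (Complex.re_le_norm z)
    have h2 : z.im * z.arg ≤ 2 * ‖z‖ := by
      have ha : |z.arg| ≤ 2 :=
        (Complex.abs_arg_le_pi_div_two_iff.2 hz.le).trans (by linarith [Real.pi_le_four])
      calc z.im * z.arg ≤ |z.im * z.arg| := le_abs_self _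
        _ = |z.im| * |z.arg| := abs_mul _ _
        _ ≤ ‖z‖ * 2 := by
          gcongr
          exact Complex.abs_im_le_norm z
        _ = _ := mul_comm _ _
    have h3 : -1 ≤ z.re * Real.log ‖z‖ := by
      have := Real.one_sub_inv_le_log_of_pos hn
      have h4 : z.re * ‖z‖⁻¹ ≤ 1 := by
        rw [← div_eq_mul_inv, div_le_one hn]; exact Complex.re_le_norm z
      nlinarith
    calc _ ≤ M * Real.exp (-(c * ‖z‖)) * Real.exp (-(c / 2 * (z.re * Real.log ‖z‖ - z.im * z.arg))) := by
          gcongr; exact hb z h1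
      _ = M * Real.exp (-(c * ‖z‖) + -(c / 2 * (z.re * Real.log ‖z‖ - z.im * z.arg))) := by
          rw [mul_assoc, ← Real.exp_add]
      _ ≤ _ := by
          gcongr
          nlinarith
  have hGz : Set.EqOn G 0 {z : ℂ | 0 ≤ z.re} := by
    apply PhragmenLindelof.eq_zero_on_right_half_plane_of_superexponential_decay
    · apply DifferentiableOn.diffContOnCl
      rw [Complex.closure_setOfPred_lt_re]
      intro w hw
      apply DifferentiableAt.differentiableWithinAt
      have h1 := hre w hw
      have hs : w + (δ : ℂ) ∈ Complex.slitPlane := Or.inl (hδ.trans_le h1)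
      have h2 : DifferentiableAt ℂ (fun w : ℂ => F (w + δ)) w :=
        DifferentiableAt.comp w (hF _ h1) (by fun_prop)
      have h3 : DifferentiableAt ℂ (fun w : ℂ => w + (δ : ℂ)) w := by fun_prop
      exact h2.mul (((h3.mul (h3.clog hs)).const_mul _).neg.cexp)
    · refine ⟨1, by norm_num, 0, ?_⟩
      refine Asymptotics.IsBigO.of_bound (M * Real.exp (c / 2)) ?_
      refine Filter.Eventually.filter_mono inf_le_right ?_
      rw [Filter.eventually_principal]
      intro w hw
      simpa using hGb w (le_of_lt hw)
    · intro n
      have hlog : ∀ᶠ x : ℝ in atTop, (n + 1 : ℝ) / (c / 2) ≤ Real.log (x + δ) :=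
        (Real.tendsto_log_atTop.comp (tendsto_atTop_add_const_right _ δ tendsto_id)).eventually_ge_atTop _
      have hlim : Tendsto (fun x : ℝ => M * Real.exp (-x)) atTop (𝓝 0) := by
        simpa using Real.tendsto_exp_neg_atTop_nhds_zero.const_mul M
      refine squeeze_zero' (Eventually.of_forall fun x => by positivity) ?_ hlim
      filter_upwards [hlog, eventually_ge_atTop 0] with x hx hx0
      have ht : 0 < x + δ := by linarith
      rw [hGn, ← Complex.ofReal_add, Complex.norm_real, Complex.ofReal_re, Complex.ofReal_im,
        Real.norm_of_nonneg ht.le]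
      have hb' : ‖F ((x + δ : ℝ) : ℂ)‖ ≤ M := by
        refine (hb _ (by simpa using hx0)).trans ?_
        refine mul_le_of_le_one_right hM (Real.exp_le_one_iff.2 ?_)
        have := norm_nonneg ((x + δ : ℝ) : ℂ)
        nlinarith
      rw [div_le_iff₀ (by positivity)] at hx
      calc _ ≤ Real.exp x ^ n * (M * Real.exp (-(c / 2 * ((x + δ) * Real.log (x + δ) - 0 * ((x + δ : ℝ) : ℂ).arg)))) := by
            gcongr
        _ = M * Real.exp (n * x + -(c / 2 * ((x + δ) * Real.log (x + δ)))) := by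
            rw [← Real.exp_nat_mul, Real.exp_add, zero_mul, sub_zero]; ring
        _ ≤ _ := by
            gcongr
            have : (n + 1 : ℝ) * (x + δ) ≤ Real.log (x + δ) * (c / 2) * (x + δ) := by gcongr
            have h5 : (0 : ℝ) ≤ (n + 1 : ℝ) * δ := by positivity
            linarith
    · exact ⟨_, fun x => hGb _ (by simp)⟩
  intro z hz
  have h1 : G (z - δ) = 0 := hGz (by simpa using hz)
  simpa [G, Complex.exp_ne_zero] using h1

/-- Optimising factorial bounds over `N` gives exponential decay. -/
lemma carleman_exp_bound (A B r x : ℝ) (hB : 0 < B) (hr : 0 < r)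
    (h : ∀ N : ℕ, x ≤ A * B ^ N * N.factorial * r⁻¹ ^ N) :
    x ≤ 2 * A * Real.exp (-((2 * B)⁻¹ * r)) := by
  have h1 : HasSum (fun n : ℕ => ((2 * B)⁻¹ * r) ^ n / n.factorial) (Real.exp ((2 * B)⁻¹ * r)) := by
    rw [Real.exp_eq_exp_ℝ]
    exact NormedSpace.expSeries_div_hasSum_exp _
  have h2 : Real.exp ((2 * B)⁻¹ * r) * x ≤ 2 * A := by
    refine hasSum_le (fun n => ?_) (h1.mul_right x) (hasSum_geometric_two.mul_right A)
    calc ((2 * B)⁻¹ * r) ^ n / n.factorial * x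
        ≤ ((2 * B)⁻¹ * r) ^ n / n.factorial * (A * B ^ n * n.factorial * r⁻¹ ^ n) := by
          gcongr; exact h n
      _ = (1 / 2) ^ n * A := by
          have : (n.factorial : ℝ) ≠ 0 := by positivity
          rw [mul_pow, inv_pow, inv_pow, mul_pow, div_pow, one_pow]
          field_simp
  rw [Real.exp_neg, ← div_eq_mul_inv, le_div_iff₀ (Real.exp_pos _), mul_comm]
  exact h2

/-- **Carleman's theorem** on quasi-analyticity: two functions analytic on the
Nevanlinna disk `C_R` admitting the same strong asymptotic series coincide, and the
coefficients of such a series satisfy the factorial bound. -/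
theorem carleman_quasi_analytic
    (R : ℝ) (hR : 0 < R)
    (C_R : Set ℂ) (hC : C_R = {g : ℂ | g ≠ 0 ∧ (1 / g).re > 1 / R})
    (f h : ℂ → ℂ) (a : ℕ → ℂ)
    (hf : AnalyticOnNhd ℂ f C_R) (hh : AnalyticOnNhd ℂ h C_R)
    (A B : ℝ) (hA : 0 < A) (hB : 0 < B)
    (hfa : ∀ N : ℕ, ∀ g ∈ C_R,
      ‖f g - ∑ n ∈ Finset.range N, a n * g ^ n‖ ≤ A * B ^ N * N.factorial * ‖g‖ ^ N)
    (hha : ∀ N : ℕ, ∀ g ∈ C_R,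
      ‖h g - ∑ n ∈ Finset.range N, a n * g ^ n‖ ≤ A * B ^ N * N.factorial * ‖g‖ ^ N) :
    (∀ g ∈ C_R, f g = h g) ∧ ∀ n : ℕ, ‖a n‖ ≤ A * B ^ n * n.factorial := by
  subst hC
  constructor
  · intro g hg
    have hmem : ∀ z : ℂ, 1 / R < z.re → z⁻¹ ∈ {g : ℂ | g ≠ 0 ∧ (1 / g).re > 1 / R} := by
      intro z hz
      refine ⟨inv_ne_zero ?_, by simpa using hz⟩
      rintro rfl
      have : 0 < 1 / R := by positivity
      simp only [Complex.zero_re] at hz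
      linarith
    have h0 : 0 < 1 / R := by positivity
    have hδ : 1 / R < (g⁻¹).re := by simpa using hg.2
    have key := carleman_aux (g⁻¹).re (2 * B)⁻¹ (2 * (2 * A)) (h0.trans hδ) (by positivity)
      (fun z => f z⁻¹ - h z⁻¹) ?_ ?_ g⁻¹ le_rfl
    · simpa [sub_eq_zero] using key
    · intro z hz
      have hm := hmem z (hδ.trans_le hz)
      have hz0 : z ≠ 0 := by
        rintro rfl
        exact hm.1 inv_zero
      exact (DifferentiableAt.comp z (hf _ hm).differentiableAt (differentiableAt_inv hz0)).sub
        (DifferentiableAt.comp z (hh _ hm).differentiableAt (differentiableAt_inv hz0))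
    · intro z hz
      have hm := hmem z (hδ.trans_le hz)
      have hz0 : z ≠ 0 := by
        rintro rfl
        exact hm.1 inv_zero
      apply carleman_exp_bound (2 * A) B _ _ hB (norm_pos_iff.2 hz0)
      intro N
      have e1 := hfa N _ hm
      have e2 := hha N _ hm
      rw [norm_inv] at e1 e2
      calc ‖f z⁻¹ - h z⁻¹‖ = ‖(f z⁻¹ - ∑ n ∈ Finset.range N, a n * z⁻¹ ^ n)
            - (h z⁻¹ - ∑ n ∈ Finset.range N, a n * z⁻¹ ^ n)‖ := by congr 1; ring
        _ ≤ _ := norm_sub_le _ _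
        _ ≤ _ := add_le_add e1 e2
        _ = _ := by ring
  · intro n
    have hlim : Filter.Tendsto (fun t : ℝ => A * B ^ n * n.factorial
        + A * B ^ (n + 1) * (n + 1).factorial * t) (nhdsWithin 0 (Set.Ioi 0))
        (nhds (A * B ^ n * n.factorial)) := by
      have : Continuous (fun t : ℝ => A * B ^ n * n.factorial
        + A * B ^ (n + 1) * (n + 1).factorial * t) := by fun_prop
      simpa using (this.tendsto 0).mono_left nhdsWithin_le_nhds
    refine ge_of_tendsto hlim ?_
    filter_upwards [Ioo_mem_nhdsGT hR] with t ht
    have hm : (t : ℂ) ∈ {g : ℂ | g ≠ 0 ∧ (1 / g).re > 1 / R} := by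
      refine ⟨by exact_mod_cast ht.1.ne', ?_⟩
      rw [← Complex.ofReal_one, ← Complex.ofReal_div, Complex.ofReal_re]
      exact one_div_lt_one_div_of_lt ht.1 ht.2
    have e1 := hfa n _ hm
    have e2 := hfa (n + 1) _ hm
    have hn : ‖(t : ℂ)‖ = t := by rw [Complex.norm_real, Real.norm_of_nonneg ht.1.le]
    rw [hn] at e1 e2
    have e3 : ‖a n‖ * t ^ n ≤ A * B ^ n * n.factorial * t ^ n
        + A * B ^ (n + 1) * (n + 1).factorial * t ^ (n + 1) := by
      calc ‖a n‖ * t ^ n = ‖(f t - ∑ i ∈ Finset.range n, a i * (t : ℂ) ^ i)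
            - (f t - ∑ i ∈ Finset.range (n + 1), a i * (t : ℂ) ^ i)‖ := by
            rw [Finset.sum_range_succ]
            nth_rewrite 1 [← hn]
            rw [← norm_pow, ← norm_mul]
            congr 1; ring
        _ ≤ _ := norm_sub_le _ _
        _ ≤ _ := add_le_add e1 e2
    refine le_of_mul_le_mul_right (e3.trans (le_of_eq ?_)) (pow_pos ht.1 n)
    ring
end

section
/- (Nevanlinna's theorem.) Let R > 0, let C_R = {g ∈ ℂ : g ≠ 0 and Re(1/g) > 1/R}, let f be complex-analytic on C_R, let (a_n) be a sequence of complex numbers, and suppose there exist A > 0 and B > 0 such that |f(g) − ∑_{n=0}^{N−1} a_n g^n| ≤ A·B^N·N!·|g|^N for all N ∈ ℕ and all g ∈ C_R. Then: (i) the Borel-transformed series ∑_{n=0}^∞ (a_n/n!)·u^n converges absolutely for every u ∈ ℂ with |u| < 1/B; (ii) there exist T > 0 and a function W, complex-analytic on the set D = {u ∈ ℂ : |u| < 1/B} ∪ {u ∈ ℂ : Re u > 0 and |Im u| < T}, such that W(u) = ∑_{n=0}^∞ (a_n/n!)·u^n for |u| < 1/B, and such that for every real g with 0 < g < T the function u ↦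 W(u)·exp(−u/g) is integrable on (0, ∞) and f(g) = (1/g)·∫_0^∞ W(u)·exp(−u/g) du. -/
open MeasureTheory

namespace NevB
open Complex Filter Topology Set

/-- point on the vertical line -/
noncomputable def vl (c y : ℝ) : ℂ := (c : ℂ) + ((2 * Real.pi * y : ℝ) : ℂ) * I

lemma vl_re (c y : ℝ) : (vl c y).re = c := by simp [vl]
lemma vl_im (c y : ℝ) : (vl c y).im = 2 * Real.pi * y := by simp [vl]
lemma vl_zero (c : ℝ) : vl c 0 = c := by simp [vl]
lemma vl_ne (c y : ℝ) (hc : 0 < c) : vl c y ≠ 0 := by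
  intro h; have := vl_re c y; rw [h] at this; simp at this; linarith
lemma vl_cont (c : ℝ) : Continuous (vl c) := by unfold vl; fun_prop

lemma vl_normsq (c y : ℝ) : ‖vl c y‖ ^ 2 = c ^ 2 + (2 * Real.pi * y) ^ 2 := by
  rw [← Complex.normSq_eq_norm_sq, Complex.normSq_apply, vl_re, vl_im]; ring

lemma vl_inv (c y : ℝ) (hc : 0 < c) :
    (‖vl c y‖ ^ 2)⁻¹ = (c ^ 2)⁻¹ * (1 + (2 * Real.pi / c * y) ^ 2)⁻¹ := by
  rw [vl_normsq, ← mul_inv]; congr 1; field_simp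

lemma int_vl (c : ℝ) (hc : 0 < c) : Integrable fun y : ℝ => (‖vl c y‖ ^ 2)⁻¹ := by
  simp_rw [vl_inv c _ hc]
  apply Integrable.const_mul
  have := integrable_inv_one_add_sq.comp_mul_left' (R := 2 * Real.pi / c) (by positivity)
  exact this

lemma integral_vl (c : ℝ) (hc : 0 < c) : ∫ y : ℝ, (‖vl c y‖ ^ 2)⁻¹ = 1 / (2 * c) := by
  simp_rw [vl_inv c _ hc]
  rw [integral_const_mul, Measure.integral_comp_mul_left (fun y => (1 + y ^ 2)⁻¹),
    integral_univ_inv_one_add_sq, abs_of_pos (by positivity)]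
  simp only [smul_eq_mul]; field_simp [Real.pi_ne_zero]

/-- Inverse Laplace integral -/
noncomputable def L (G : ℂ → ℂ) (c x : ℝ) : ℂ := ∫ y : ℝ, cexp (vl c y * x) * G (vl c y)

lemma norm_exp_vl (c y x : ℝ) : ‖cexp (vl c y * x)‖ = Real.exp (c * x) := by
  rw [Complex.norm_exp]; simp [vl_re]

variable {a C : ℝ} {G : ℂ → ℂ}

lemma cont_vl (hG : DifferentiableOn ℂ G {z | a < z.re}) {c : ℝ} (hc : a < c) :
    Continuous fun y : ℝ => G (vl c y) := by
  apply hG.continuousOn.comp_continuous (vl_cont c)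
  intro y; simp [vl_re, hc]

lemma int_G (ha : 0 ≤ a) (hG : DifferentiableOn ℂ G {z | a < z.re})
    (hb : ∀ z : ℂ, a < z.re → ‖G z‖ ≤ C * (‖z‖ ^ 2)⁻¹) {c : ℝ} (hc : a < c) :
    Integrable fun y : ℝ => G (vl c y) := by
  refine ((int_vl c (by linarith)).const_mul C).mono' (cont_vl hG hc).aestronglyMeasurable
    (.of_forall fun y => hb _ (by rwa [vl_re]))

lemma int_L (ha : 0 ≤ a) (hG : DifferentiableOn ℂ G {z | a < z.re})
    (hb : ∀ z : ℂ, a < z.re → ‖G z‖ ≤ C * (‖z‖ ^ 2)⁻¹) {c : ℝ} (hc : a < c) (x : ℝ) :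
    Integrable fun y : ℝ => cexp (vl c y * x) * G (vl c y) := by
  refine (int_G ha hG hb hc).bdd_mul (c := Real.exp (c * x)) ?_ (.of_forall fun y => ?_)
  · exact (by have := vl_cont c; fun_prop : Continuous fun y => cexp (vl c y * x)).aestronglyMeasurable
  · rw [norm_exp_vl]

lemma norm_L (ha : 0 ≤ a)
    (hb : ∀ z : ℂ, a < z.re → ‖G z‖ ≤ C * (‖z‖ ^ 2)⁻¹) {c : ℝ} (hc : a < c) (x : ℝ) :
    ‖L G c x‖ ≤ Real.exp (c * x) * C * (1 / (2 * c)) := by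
  rw [← integral_vl c (by linarith), ← integral_const_mul]
  refine norm_integral_le_of_norm_le ((int_vl c (by linarith)).const_mul _) (.of_forall fun y => ?_)
  rw [norm_mul, norm_exp_vl, mul_assoc]
  gcongr
  exact hb _ (by rwa [vl_re])

lemma shift_raw (ha : 0 ≤ a) (H : ℂ → ℂ) (hH : DifferentiableOn ℂ H {z | a < z.re})
    {c d : ℝ} (hc : a < c) (hcd : c ≤ d)
    (hb : ∀ z : ℂ, a < z.re → z.re ≤ d → ‖H z‖ ≤ C * (‖z‖ ^ 2)⁻¹)
    (h1 : Integrable fun y : ℝ => H (vl c y)) (h2 : Integrable fun y : ℝ => H (vl d y)) :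
    ∫ y : ℝ, H (vl c y) = ∫ y : ℝ, H (vl d y) := by
  have hC : 0 ≤ C := by
    have h := (norm_nonneg _).trans (hb (d : ℂ) (by simp; linarith) (by simp))
    have hd : 0 < ‖(d : ℂ)‖ ^ 2 := by
      have : (d : ℂ) ≠ 0 := by simp; linarith
      positivity
    by_contra hn
    push Not at hn
    have := mul_neg_of_neg_of_pos hn (inv_pos.2 hd)
    linarith
  have t1 := intervalIntegral_tendsto_integral h1 tendsto_neg_atTop_atBot tendsto_id
  have t2 := intervalIntegral_tendsto_integral h2 tendsto_neg_atTop_atBot tendsto_id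
  have key : ∀ Y : ℝ, 0 < Y → ‖(∫ y in (-Y)..Y, H (vl d y)) - ∫ y in (-Y)..Y, H (vl c y)‖
      ≤ (C * ((2 * Real.pi * Y) ^ 2)⁻¹ * |d - c| + C * ((2 * Real.pi * Y) ^ 2)⁻¹ * |d - c|)
        / (2 * Real.pi) := by
    intro Y hY
    have hrect := integral_boundary_rect_eq_zero_of_differentiableOn H
      (vl c (-Y)) (vl d Y) (hH.mono (by
        intro z hz
        have := hz.1
        simp only [mem_preimage, vl_re, uIcc_of_le hcd] at this
        exact lt_of_lt_of_le hc this.1))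
    simp only [vl_re, vl_im] at hrect
    have hv : ∀ e : ℝ, (∫ y in (2 * Real.pi * -Y)..(2 * Real.pi * Y), H (e + y * I))
        = (2 * Real.pi : ℝ) • ∫ y in (-Y)..Y, H (vl e y) := by
      intro e
      have := intervalIntegral.smul_integral_comp_mul_left (a := -Y) (b := Y)
        (fun y : ℝ => H (e + y * I)) (2 * Real.pi)
      rw [← this]; rfl
    rw [hv, hv] at hrect
    have hhor : ∀ t : ℝ, |t| = 2 * Real.pi * Y →
        ‖∫ x in c..d, H (x + t * I)‖ ≤ C * ((2 * Real.pi * Y) ^ 2)⁻¹ * |d - c| := by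
      intro t ht
      apply intervalIntegral.norm_integral_le_of_norm_le_const
      intro x hx
      rw [uIoc_of_le hcd] at hx
      refine (hb _ (by simp; linarith [hx.1]) (by simpa using hx.2)).trans ?_
      gcongr
      rw [← ht]
      refine (le_of_eq ?_).trans (Complex.abs_im_le_norm _)
      simp
    have e1 := hhor (2 * Real.pi * -Y) (by rw [abs_of_neg (by have := Real.pi_pos; nlinarith)]; ring)
    have e2 := hhor (2 * Real.pi * Y) (abs_of_pos (by positivity))
    rw [le_div_iff₀ (by positivity)]
    set X1 := ∫ x in c..d, H (x + (2 * Real.pi * -Y : ℝ) * I)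
    set X2 := ∫ x in c..d, H (x + (2 * Real.pi * Y : ℝ) * I)
    have : (((∫ y in (-Y)..Y, H (vl d y)) - ∫ y in (-Y)..Y, H (vl c y)) * (2 * Real.pi : ℝ)) =
        I * (X1 - X2) := by
      simp only [real_smul, smul_eq_mul] at hrect
      linear_combination (-I) * hrect + (((2 * Real.pi : ℝ) : ℂ) * ((∫ y in (-Y)..Y, H (vl d y)) - ∫ y in (-Y)..Y, H (vl c y))) * I_mul_I
    calc _ = ‖(((∫ y in (-Y)..Y, H (vl d y)) - ∫ y in (-Y)..Y, H (vl c y)) * (2 * Real.pi : ℝ))‖ := by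
            rw [norm_mul, norm_real, Real.norm_of_nonneg (by positivity)]
      _ = ‖X1 - X2‖ := by rw [this]; simp
      _ ≤ _ := (norm_sub_le _ _).trans (add_le_add e1 e2)
  have hz : Tendsto (fun Y : ℝ => (C * ((2 * Real.pi * Y) ^ 2)⁻¹ * |d - c| + C * ((2 * Real.pi * Y) ^ 2)⁻¹ * |d - c|)
        / (2 * Real.pi)) atTop (𝓝 0) := by
    have : Tendsto (fun Y : ℝ => ((2 * Real.pi * Y) ^ 2)⁻¹) atTop (𝓝 0) := by
      apply Tendsto.inv_tendsto_atTop
      apply (tendsto_pow_atTop two_ne_zero).comp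
      exact tendsto_id.const_mul_atTop (by positivity)
    have h := ((((this.const_mul C).mul_const |d - c|).add ((this.const_mul C).mul_const |d - c|)).div_const (2 * Real.pi))
    simpa using h
  have t3 : Tendsto (fun Y : ℝ => (∫ y in (-Y)..Y, H (vl d y)) - ∫ y in (-Y)..Y, H (vl c y)) atTop (𝓝 0) := by
    apply squeeze_zero_norm' _ hz
    filter_upwards [eventually_gt_atTop 0] with Y hY using key Y hY
  have := tendsto_nhds_unique t3 (t2.sub t1)
  exact (sub_eq_zero.1 this.symm).symm

lemma L_shift (ha : 0 ≤ a) (hC : 0 ≤ C) (hG : DifferentiableOn ℂ G {z | a < z.re})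
    (hb : ∀ z : ℂ, a < z.re → ‖G z‖ ≤ C * (‖z‖ ^ 2)⁻¹) {c d : ℝ} (hc : a < c) (hcd : c ≤ d) (x : ℝ) :
    L G c x = L G d x := by
  refine shift_raw (C := Real.exp (d * |x|) * C) ha (fun z => cexp (z * x) * G z) ?_ hc hcd ?_
    (int_L ha hG hb hc x) (int_L ha hG hb (hc.trans_le hcd) x)
  · exact DifferentiableOn.mul (by fun_prop) hG
  · intro z hz hzd
    rw [norm_mul, mul_assoc]
    have : ‖cexp (z * x)‖ ≤ Real.exp (d * |x|) := by
      rw [Complex.norm_exp]; simp only [mul_re, ofReal_re, ofReal_im, mul_zero, sub_zero]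
      apply Real.exp_le_exp.2
      calc z.re * x ≤ z.re * |x| := by gcongr; exact ha.trans hz.le; exact le_abs_self x
        _ ≤ d * |x| := by gcongr
    gcongr
    exact hb z hz

lemma L_zero (ha : 0 ≤ a) (hC : 0 ≤ C) (hG : DifferentiableOn ℂ G {z | a < z.re})
    (hb : ∀ z : ℂ, a < z.re → ‖G z‖ ≤ C * (‖z‖ ^ 2)⁻¹) {c : ℝ} (hc : a < c) {x : ℝ} (hx : x ≤ 0) :
    L G c x = 0 := by
  have hz : Tendsto (fun d : ℝ => C * (1 / (2 * d))) atTop (𝓝 0) := by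
    have : Tendsto (fun d : ℝ => (2 * d)⁻¹) atTop (𝓝 0) :=
      (tendsto_id.const_mul_atTop (by positivity)).inv_tendsto_atTop
    simpa using this.const_mul C
  have hc0 : Tendsto (fun d : ℝ => L G c x) atTop (𝓝 0) := by
    apply squeeze_zero_norm' _ hz
    filter_upwards [eventually_ge_atTop c] with d hd
    rw [L_shift ha hC hG hb hc hd x]
    refine (norm_L ha hb (hc.trans_le hd) x).trans ?_
    have hd0 : 0 ≤ d := by linarith
    have : Real.exp (d * x) ≤ 1 := Real.exp_le_one_iff.2 (mul_nonpos_of_nonneg_of_nonpos hd0 hx)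
    calc _ ≤ 1 * C * (1 / (2 * d)) := by gcongr
      _ = _ := by ring
  exact tendsto_nhds_unique tendsto_const_nhds hc0

open FourierTransform

lemma fourierInv_G (c : ℝ) (x : ℝ) :
    𝓕⁻ (fun y : ℝ => G (vl c y)) x = cexp (-(c * x)) * L G c x := by
  rw [Real.fourierInv_eq', L, ← integral_const_mul]
  congr 1; ext y
  rw [smul_eq_mul, ← mul_assoc, ← Complex.exp_add]
  congr 2
  simp [vl]; ring

lemma laplace_L (ha : 0 ≤ a) (hC : 0 ≤ C) (hG : DifferentiableOn ℂ G {z | a < z.re})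
    (hb : ∀ z : ℂ, a < z.re → ‖G z‖ ≤ C * (‖z‖ ^ 2)⁻¹) {c s : ℝ} (hc : a < c) (hs : c < s) :
    IntegrableOn (fun x : ℝ => cexp (-(s * x)) * L G c x) (Ioi 0) ∧
    ∫ x in Ioi (0 : ℝ), cexp (-(s * x)) * L G c x = G s := by
  have hLs : ∀ x, L G c x = L G s x := fun x => L_shift ha hC hG hb hc hs.le x
  have hsa := hc.trans hs
  set φ : ℝ → ℂ := fun y : ℝ => G (vl s y) with hφ
  have hφi : Integrable φ := int_G ha hG hb hsa
  have hφc : Continuous φ := cont_vl hG hsa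
  have hinv : 𝓕⁻ φ = fun x : ℝ => cexp (-(s * x)) * L G c x := by
    ext x; rw [hφ, fourierInv_G, hLs]
  have hcont : Continuous (𝓕⁻ φ) := by
    have : Continuous (𝓕 φ) := VectorFourier.fourierIntegral_continuous Real.continuous_fourierChar (by fun_prop) hφi
    have h2 : 𝓕⁻ φ = fun x => 𝓕 φ (-x) := by ext x; exact Real.fourierInv_eq_fourier_neg φ x
    rw [h2]; fun_prop
  have hi : IntegrableOn (𝓕⁻ φ) (Ioi 0) := by
    have he : IntegrableOn (fun x : ℝ => C * (1 / (2 * c)) * Real.exp (-(s - c) * x)) (Ioi 0) :=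
      (exp_neg_integrableOn_Ioi 0 (by linarith)).const_mul _
    refine Integrable.mono' he hcont.aestronglyMeasurable (.of_forall fun x => ?_)
    rw [hinv]
    simp only [norm_mul]
    have h1 : ‖cexp (-(s * x))‖ = Real.exp (-(s * x)) := by
      rw [Complex.norm_exp]; simp
    rw [h1]
    calc _ ≤ Real.exp (-(s * x)) * (Real.exp (c * x) * C * (1 / (2 * c))) := by
          gcongr; exact norm_L ha hb hc x
      _ = C * (1 / (2 * c)) * (Real.exp (-(s * x)) * Real.exp (c * x)) := by ring
      _ = _ := by rw [← Real.exp_add]; ring_nf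
  have hzero : ∀ x ∉ Ioi (0 : ℝ), 𝓕⁻ φ x = 0 := by
    intro x hx
    rw [hinv]; simp only
    rw [L_zero ha hC hG hb hc (not_lt.1 hx), mul_zero]
  have hint : Integrable (𝓕⁻ φ) := by
    rwa [← integrableOn_iff_integrable_of_support_subset]
    intro x hx; by_contra h; exact hx (hzero x h)
  have hF : Integrable (𝓕 φ) := by
    have h2 : 𝓕 φ = fun x => 𝓕⁻ φ (-x) := by
      ext x; rw [Real.fourierInv_eq_fourier_neg, neg_neg]
    rw [h2]; exact hint.comp_neg
  have hfin := congrFun (hφc.fourier_fourierInv_eq hφi hF) 0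
  rw [Real.fourier_eq'] at hfin
  simp only [inner_zero_right, mul_zero, ofReal_zero, zero_mul, Complex.exp_zero, one_smul] at hfin
  rw [← hinv]
  refine ⟨hi, ?_⟩
  rw [setIntegral_eq_integral_of_forall_compl_eq_zero hzero, hfin, hφ]
  simp [vl_zero]

lemma laplace_id (z : ℂ) (hz : 0 < z.re) :
    IntegrableOn (fun x : ℝ => cexp (-(z * x)) * x) (Ioi 0) ∧
    ∫ x in Ioi (0 : ℝ), cexp (-(z * x)) * x = (z ^ 2)⁻¹ := by
  have hz0 : z ≠ 0 := by intro h; simp [h] at hz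
  have hnorm : ∀ x : ℝ, ‖cexp (-(z * x))‖ = Real.exp (-(z.re * x)) := by
    intro x; rw [Complex.norm_exp]; simp
  have hi : IntegrableOn (fun x : ℝ => cexp (-(z * x)) * x) (Ioi 0) := by
    have := integrableOn_rpow_mul_exp_neg_mul_rpow (s := 1) (p := 1) (by norm_num) (by norm_num) hz
    refine Integrable.mono' this (by fun_prop) ?_
    refine (ae_restrict_mem measurableSet_Ioi).mono fun x hx => ?_
    have hx0 : (0 : ℝ) < x := hx
    rw [norm_mul, hnorm, norm_real, Real.norm_of_nonneg hx0.le, Real.rpow_one, mul_comm]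
    simp
  refine ⟨hi, ?_⟩
  have hd : ∀ x ∈ Ici (0 : ℝ), HasDerivAt (fun x : ℝ => -((x : ℂ) / z + (z ^ 2)⁻¹) * cexp (-(z * x)))
      (cexp (-(z * x)) * x) x := by
    intro x _
    have h1 : HasDerivAt (fun x : ℝ => (x : ℂ)) 1 x := ofRealCLM.hasDerivAt
    have := (((h1.div_const z).add_const ((z ^ 2)⁻¹)).neg).mul (((h1.const_mul z).neg).cexp)
    refine this.congr_deriv ?_
    simp only [Pi.neg_apply]
    field_simp
    ring
  have ht : Tendsto (fun x : ℝ => -((x : ℂ) / z + (z ^ 2)⁻¹) * cexp (-(z * x))) atTop (𝓝 0) := by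
    rw [tendsto_zero_iff_norm_tendsto_zero]
    have h1 : Tendsto (fun x : ℝ => x ^ (1 : ℝ) * Real.exp (-z.re * x)) atTop (𝓝 0) :=
      tendsto_rpow_mul_exp_neg_mul_atTop_nhds_zero 1 z.re hz
    have h2 : Tendsto (fun x : ℝ => x ^ (0 : ℝ) * Real.exp (-z.re * x)) atTop (𝓝 0) :=
      tendsto_rpow_mul_exp_neg_mul_atTop_nhds_zero 0 z.re hz
    have h3 := (h1.const_mul (‖z‖⁻¹)).add (h2.const_mul ‖(z ^ 2)⁻¹‖)
    simp only [mul_zero, add_zero] at h3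
    refine squeeze_zero' (.of_forall fun _ => norm_nonneg _) ?_ h3
    filter_upwards [eventually_ge_atTop 0] with x hx
    rw [norm_mul, norm_neg, hnorm, Real.rpow_one, Real.rpow_zero]
    calc _ ≤ (‖(x : ℂ) / z‖ + ‖(z ^ 2)⁻¹‖) * Real.exp (-(z.re * x)) := by
          gcongr; exact norm_add_le _ _
      _ = _ := by
          rw [norm_div, norm_real, Real.norm_of_nonneg hx, neg_mul]; ring
  rw [integral_Ioi_of_hasDerivAt_of_tendsto' hd hi ht]
  simp

lemma L_inv_sq {c : ℝ} (hc : 0 < c) {x : ℝ} (hx : 0 ≤ x) :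
    L (fun z => (z ^ 2)⁻¹) c x = x := by
  set ψ : ℝ → ℂ := fun x => cexp (-(c * x)) * (max x 0 : ℝ) with hψ
  have hψc : Continuous ψ := by fun_prop
  have hz : ∀ x ∉ Ioi (0 : ℝ), ψ x = 0 := by
    intro x hx; have hx2 : x ≤ 0 := not_lt.1 hx
    simp [hψ, max_eq_right hx2]
  have hψi : Integrable ψ := by
    rw [← integrableOn_iff_integrable_of_support_subset (s := Ioi 0)]
    · refine (laplace_id c (by simpa)).1.congr_fun ?_ measurableSet_Ioi
      intro x hx
      simp [hψ, max_eq_left (le_of_lt (show (0 : ℝ) < x from hx))]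
    · intro x hx; by_contra h; exact hx (hz x h)
  have hF : 𝓕 ψ = fun y : ℝ => ((vl c y) ^ 2)⁻¹ := by
    ext y
    rw [Real.fourier_eq', ← (laplace_id (vl c y) (by rwa [vl_re])).2,
      ← setIntegral_eq_integral_of_forall_compl_eq_zero (s := Ioi 0)]
    · refine setIntegral_congr_fun measurableSet_Ioi fun x hx => ?_
      simp only [hψ, max_eq_left (le_of_lt (show (0 : ℝ) < x from hx))]
      rw [smul_eq_mul, ← mul_assoc, ← Complex.exp_add]
      congr 2
      simp [vl]; ring
    · intro x hx; rw [hz x hx, smul_zero]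
  have hFi : Integrable (𝓕 ψ) := by
    rw [hF]
    refine int_G (a := 0) (C := 1) (G := fun z => (z ^ 2)⁻¹) le_rfl ?_ ?_ hc
    · intro z hz
      have : z ≠ 0 := by rintro rfl; simp at hz
      exact ((differentiableAt_id.pow 2).inv (by simpa)).differentiableWithinAt
    · intro z _; simp
  have := congrFun (hψc.fourierInv_fourier_eq hψi hFi) x
  rw [hF, fourierInv_G (G := fun z => (z ^ 2)⁻¹)] at this
  simp only [hψ, max_eq_left hx] at this
  exact mul_left_cancel₀ (Complex.exp_ne_zero _) this


lemma L_deriv (ha : 0 < a) (hC : 0 ≤ C) (hG : DifferentiableOn ℂ G {z | a < z.re})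
    (hb : ∀ z : ℂ, a < z.re → ‖G z‖ ≤ C * (‖z‖ ^ 2)⁻¹) {c : ℝ} (hc : a < c) (x : ℝ) :
    HasDerivAt (fun x => L (fun z => G z / z) c x) (L G c x) x := by
  have hz0 : ∀ z : ℂ, a < z.re → z ≠ 0 := by rintro z hz rfl; simp at hz; linarith
  have hG' : DifferentiableOn ℂ (fun z => G z / z) {z | a < z.re} :=
    hG.div differentiableOn_id (fun z hz => hz0 z hz)
  have hb' : ∀ z : ℂ, a < z.re → ‖G z / z‖ ≤ (C / a) * (‖z‖ ^ 2)⁻¹ := by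
    intro z hz
    have h1 : a ≤ ‖z‖ := hz.le.trans (Complex.re_le_norm z)
    rw [norm_div]
    calc _ ≤ (C * (‖z‖ ^ 2)⁻¹) / a := by gcongr; exact hb z hz
      _ = _ := by ring
  have hcl : ∀ x : ℝ, Continuous fun y => cexp (vl c y * x) := by
    intro x; have := vl_cont c; fun_prop
  refine (hasDerivAt_integral_of_dominated_loc_of_deriv_le
    (s := Metric.ball x 1) (bound := fun y => Real.exp (c * (x + 1)) * (C * (‖vl c y‖ ^ 2)⁻¹))
    (F' := fun x y => cexp (vl c y * x) * G (vl c y))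
    (Metric.ball_mem_nhds x one_pos) ?_ ?_ ?_ ?_ ?_ ?_).2
  · exact .of_forall fun t => ((hcl t).mul (cont_vl hG' hc)).aestronglyMeasurable
  · exact int_L ha.le hG' hb' hc x
  · exact ((hcl x).mul (cont_vl hG hc)).aestronglyMeasurable
  · refine .of_forall fun y t ht => ?_
    rw [norm_mul, norm_exp_vl]
    rw [Metric.mem_ball, Real.dist_eq, abs_lt] at ht
    have hcp : 0 ≤ c := by linarith
    gcongr
    · linarith
    · exact hb _ (by rwa [vl_re])
  · exact ((int_vl c (by linarith)).const_mul C).const_mul _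
  · refine .of_forall fun y t _ => ?_
    have h1 : HasDerivAt (fun x : ℝ => (x : ℂ)) 1 t := ofRealCLM.hasDerivAt
    refine (((h1.const_mul (vl c y)).cexp).mul_const (G (vl c y) / vl c y)).congr_deriv ?_
    have := vl_ne c y (by linarith)
    field_simp

section taylor
variable {w : ℕ → ℝ → ℂ} {B : ℝ}

/-- Taylor series at `x`. -/
noncomputable def P (w : ℕ → ℝ → ℂ) (x : ℝ) (u : ℂ) : ℂ :=
  ∑' k : ℕ, (w k x / (k.factorial : ℂ)) * (u - x) ^ k

lemma term_bound {v : ℂ} {K : ℝ} {r : ℝ} (hB : 0 < B) {k : ℕ} {b : ℂ} (hK : 0 ≤ K)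
    (hb : ‖b‖ ≤ K * (k + 1).factorial * B ^ k) (hv : ‖v‖ ≤ r) :
    ‖(b / (k.factorial : ℂ)) * v ^ k‖ ≤ K * ((k + 1 : ℝ) * (B * r) ^ k) := by
  have hf : (0 : ℝ) < k.factorial := by exact_mod_cast k.factorial_pos
  rw [norm_mul, norm_div, norm_pow, Complex.norm_natCast]
  calc _ ≤ (K * (k + 1).factorial * B ^ k) / k.factorial * r ^ k := by gcongr
    _ = _ := by rw [Nat.factorial_succ]; push_cast; rw [mul_pow]; field_simp

lemma summ_bound {K r : ℝ} (hr : 0 ≤ r) (hr1 : r < 1) :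
    Summable fun k : ℕ => K * ((k + 1 : ℝ) * r ^ k) := by
  have h1 := summable_pow_mul_geometric_of_norm_lt_one 1 (r := r) (by rwa [Real.norm_of_nonneg hr])
  have h2 := summable_geometric_of_lt_one hr hr1
  refine ((h1.add h2).mul_left K).congr fun k => ?_
  ring

lemma P_summable (hB : 0 < B) {x K : ℝ} (hK : 0 ≤ K)
    (hb : ∀ k, ‖w k x‖ ≤ K * (k + 1).factorial * B ^ k) {u : ℂ} (hu : ‖u - x‖ < 1 / B) :
    Summable fun k : ℕ => ‖(w k x / (k.factorial : ℂ)) * (u - x) ^ k‖ := by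
  refine Summable.of_nonneg_of_le (fun _ => norm_nonneg _)
    (fun k => term_bound hB hK (hb k) le_rfl) (summ_bound (by positivity) ?_)
  rw [lt_div_iff₀ hB] at hu; linarith

lemma P_diff (hB : 0 < B) {x K : ℝ} (hK : 0 ≤ K)
    (hb : ∀ k, ‖w k x‖ ≤ K * (k + 1).factorial * B ^ k) :
    AnalyticOnNhd ℂ (P w x) (Metric.ball (x : ℂ) (1 / B)) := by
  apply DifferentiableOn.analyticOnNhd _ Metric.isOpen_ball
  intro u hu
  rw [Metric.mem_ball, dist_eq_norm] at hu
  obtain ⟨r, hr1, hr2⟩ := exists_between hu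
  have hd : DifferentiableOn ℂ (P w x) (Metric.ball (x : ℂ) r) := by
    refine differentiableOn_tsum_of_summable_norm
      (u := fun k : ℕ => K * ((k + 1 : ℝ) * (B * r) ^ k)) ?_ ?_ Metric.isOpen_ball ?_
    · have hr0 : 0 ≤ r := (norm_nonneg _).trans hr1.le
      refine summ_bound (by positivity) ?_
      rw [lt_div_iff₀ hB] at hr2; linarith
    · intro k; fun_prop
    · intro k v hv
      rw [Metric.mem_ball, dist_eq_norm] at hv
      exact term_bound hB hK (hb k) hv.le
  exact (hd.differentiableAt (Metric.isOpen_ball.mem_nhds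
    (by rwa [Metric.mem_ball, dist_eq_norm]))).differentiableWithinAt

lemma taylor_deriv (hd : ∀ k, ∀ x, 0 ≤ x → HasDerivWithinAt (w k) (w (k + 1) x) (Ici 0) x)
    (t : ℝ) (N : ℕ) (s : ℝ) (hs : 0 ≤ s) :
    HasDerivWithinAt (fun s : ℝ => ∑ k ∈ Finset.range (N + 1), (w k s / (k.factorial : ℂ)) * ((t : ℂ) - s) ^ k)
      (w (N + 1) s / (N.factorial : ℂ) * ((t : ℂ) - s) ^ N) (Ici 0) s := by
  induction N with
  | zero => simpa using hd 0 s hs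
  | succ N ih =>
    have h1 : HasDerivWithinAt (fun x : ℝ => (x : ℂ)) 1 (Ici 0) s :=
      (ofRealCLM.hasDerivAt (x := s)).hasDerivWithinAt
    have h2 := ((hd (N + 1) s hs).div_const ((N + 1).factorial : ℂ)).mul ((h1.const_sub (t : ℂ)).pow (N + 1))
    have h3 := ih.add h2
    simp_rw [Finset.sum_range_succ _ (N + 1)]
    refine h3.congr_deriv ?_
    have hf : (N.factorial : ℂ) ≠ 0 := by exact_mod_cast N.factorial_ne_zero
    have hN : ((N : ℂ) + 1) ≠ 0 := by exact_mod_cast N.succ_ne_zero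
    rw [Nat.factorial_succ]
    push_cast
    simp only [Pi.pow_apply]
    field_simp
    ring

lemma taylor_eq (hB : 0 < B)
    (hd : ∀ k, ∀ x, 0 ≤ x → HasDerivWithinAt (w k) (w (k + 1) x) (Ici 0) x)
    (hb : ∀ X : ℝ, ∃ K, 0 ≤ K ∧ ∀ k x, 0 ≤ x → x ≤ X → ‖w k x‖ ≤ K * (k + 1).factorial * B ^ k)
    {x t : ℝ} (hx : 0 ≤ x) (ht : 0 ≤ t) (hxt : |t - x| < 1 / B) : P w x t = w 0 t := by
  obtain ⟨K, hK, hb⟩ := hb (max x t)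
  have hn : ‖(t : ℂ) - x‖ < 1 / B := by
    rwa [← ofReal_sub, norm_real, Real.norm_eq_abs]
  have hsum := (P_summable (w := w) hB hK (fun k => hb k x hx (le_max_left _ _)) hn).of_norm.hasSum.tendsto_sum_nat
  have hsum' := hsum.comp (tendsto_add_atTop_nat 1)
  set q := B * |t - x| with hq
  have hq0 : 0 ≤ q := by positivity
  have hq1 : q < 1 := by rw [lt_div_iff₀ hB] at hxt; linarith
  have hbound : ∀ N : ℕ, ‖w 0 t - ∑ k ∈ Finset.range (N + 1), (w k x / (k.factorial : ℂ)) * ((t : ℂ) - x) ^ k‖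
      ≤ K * ((N : ℝ) ^ 2 * q ^ N + 3 * ((N : ℝ) ^ 1 * q ^ N) + 2 * q ^ N) * q := by
    intro N
    have hsub : uIcc x t ⊆ Ici 0 := by
      intro s hs; rw [uIcc, mem_Icc] at hs; exact (le_min hx ht).trans hs.1
    have := Convex.norm_image_sub_le_of_norm_hasDerivWithin_le
      (f := fun s : ℝ => ∑ k ∈ Finset.range (N + 1), (w k s / (k.factorial : ℂ)) * ((t : ℂ) - s) ^ k)
      (f' := fun s => w (N + 1) s / (N.factorial : ℂ) * ((t : ℂ) - s) ^ N)
      (s := uIcc x t) (x := x) (y := t)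
      (C := K * (N + 2).factorial * B ^ (N + 1) / N.factorial * |t - x| ^ N)
      (fun s hs => (taylor_deriv hd t N s (hsub hs)).mono hsub) ?_ (convex_uIcc x t) left_mem_uIcc right_mem_uIcc
    · have e : ∑ k ∈ Finset.range (N + 1), (w k t / (k.factorial : ℂ)) * ((t : ℂ) - t) ^ k = w 0 t := by
        rw [Finset.sum_range_succ']; simp
      simp only [e] at this
      refine this.trans (le_of_eq ?_)
      have hf : (N.factorial : ℝ) ≠ 0 := by exact_mod_cast N.factorial_ne_zero
      rw [Nat.factorial_succ, Nat.factorial_succ, Real.norm_eq_abs, hq]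
      push_cast
      field_simp
      ring
    · intro s hs
      have hs0 : 0 ≤ s := hsub hs
      have hs1 : s ≤ max x t := by rw [uIcc, mem_Icc] at hs; exact hs.2
      rw [norm_mul, norm_div, norm_pow, Complex.norm_natCast]
      have h1 := hb (N + 1) s hs0 hs1
      have h2 : ‖(t : ℂ) - s‖ ≤ |t - x| := by
        rw [← ofReal_sub, norm_real, Real.norm_eq_abs]
        exact abs_sub_right_of_mem_uIcc hs
      gcongr
  have hz : Tendsto (fun N : ℕ => K * ((N : ℝ) ^ 2 * q ^ N + 3 * ((N : ℝ) ^ 1 * q ^ N) + 2 * q ^ N) * q)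
      atTop (𝓝 0) := by
    have h2 := tendsto_pow_const_mul_const_pow_of_lt_one 2 hq0 hq1
    have h1 := tendsto_pow_const_mul_const_pow_of_lt_one 1 hq0 hq1
    have h0 := tendsto_pow_atTop_nhds_zero_of_lt_one hq0 hq1
    simpa using ((((h2.add (h1.const_mul 3)).add (h0.const_mul 2)).const_mul K).mul_const q)
  have h3 := squeeze_zero_norm hbound hz
  have h4 := tendsto_nhds_unique h3 (tendsto_const_nhds.sub hsum')
  exact (sub_eq_zero.1 h4.symm).symm

lemma P_agree (hB : 0 < B)
    (hd : ∀ k, ∀ x, 0 ≤ x → HasDerivWithinAt (w k) (w (k + 1) x) (Ici 0) x)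
    (hb : ∀ X : ℝ, ∃ K, 0 ≤ K ∧ ∀ k x, 0 ≤ x → x ≤ X → ‖w k x‖ ≤ K * (k + 1).factorial * B ^ k)
    {x y : ℝ} (hx : 0 ≤ x) (hy : 0 ≤ y) {u : ℂ} (hux : ‖u - x‖ < 1 / B) (huy : ‖u - y‖ < 1 / B) :
    P w x u = P w y u := by
  have han : ∀ x : ℝ, 0 ≤ x → AnalyticOnNhd ℂ (P w x) (Metric.ball (x : ℂ) (1 / B)) := by
    intro x hx
    obtain ⟨K, hK, h⟩ := hb x
    exact P_diff hB hK fun k => h k x hx le_rfl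
  have hxy : |x - y| < 2 * (1 / B) := by
    have : ‖(x : ℂ) - y‖ < 2 * (1 / B) := by
      calc ‖(x : ℂ) - y‖ = ‖(u - y) - (u - x)‖ := by congr 1; ring
        _ ≤ ‖u - y‖ + ‖u - x‖ := norm_sub_le _ _
        _ < _ := by linarith
    rwa [← ofReal_sub, norm_real, Real.norm_eq_abs] at this
  rw [abs_lt] at hxy
  set m : ℝ := (x + y) / 2 with hm
  have hm0 : 0 ≤ m := by positivity
  have hmx : |m - x| < 1 / B := by rw [abs_lt]; constructor <;> linarith [hxy.1, hxy.2]
  have hmy : |m - y| < 1 / B := by rw [abs_lt]; constructor <;> linarith [hxy.1, hxy.2]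
  have hmem : ∀ t z : ℝ, |t - z| < 1 / B → (t : ℂ) ∈ Metric.ball (z : ℂ) (1 / B) := by
    intro t z h
    rwa [Metric.mem_ball, dist_eq_norm, ← ofReal_sub, norm_real, Real.norm_eq_abs]
  have := AnalyticOnNhd.eqOn_of_preconnected_of_frequently_eq (f := P w x) (g := P w y)
    (U := Metric.ball (x : ℂ) (1 / B) ∩ Metric.ball (y : ℂ) (1 / B)) (z₀ := (m : ℂ))
    ((han x hx).mono inter_subset_left) ((han y hy).mono inter_subset_right)
    ((convex_ball _ _).inter (convex_ball _ _)).isPreconnected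
    ⟨hmem _ _ hmx, hmem _ _ hmy⟩ ?_
  · exact this ⟨by rwa [Metric.mem_ball, dist_eq_norm], by rwa [Metric.mem_ball, dist_eq_norm]⟩
  · have hev : ∀ᶠ t : ℝ in 𝓝[>] m, P w x (t : ℂ) = P w y (t : ℂ) := by
      have o1 : ∀ᶠ t : ℝ in 𝓝 m, |t - x| < 1 / B :=
        (by fun_prop : Continuous fun t : ℝ => |t - x|).continuousAt.eventually_lt continuousAt_const hmx
      have o2 : ∀ᶠ t : ℝ in 𝓝 m, |t - y| < 1 / B :=
        (by fun_prop : Continuous fun t : ℝ => |t - y|).continuousAt.eventually_lt continuousAt_const hmy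
      filter_upwards [nhdsWithin_le_nhds o1, nhdsWithin_le_nhds o2, self_mem_nhdsWithin] with t h1 h2 h3
      have h3' : m < t := h3
      rw [taylor_eq hB hd hb hx (by linarith) h1, taylor_eq hB hd hb hy (by linarith) h2]
    have htend : Tendsto (fun t : ℝ => (t : ℂ)) (𝓝[>] m) (𝓝[≠] (m : ℂ)) := by
      apply tendsto_nhdsWithin_of_tendsto_nhds_of_eventually_within
      · exact (continuous_ofReal.tendsto m).mono_left nhdsWithin_le_nhds
      · filter_upwards [self_mem_nhdsWithin] with t ht
        have : m < t := ht
        simpa using this.ne'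
    exact htend.frequently hev.frequently

open Classical in
/-- Glued function. -/
noncomputable def Wf (w : ℕ → ℝ → ℂ) (B : ℝ) (u : ℂ) : ℂ :=
  if ‖u‖ < 1 / B then P w 0 u else P w u.re u

lemma Wf_eq (hB : 0 < B)
    (hd : ∀ k, ∀ x, 0 ≤ x → HasDerivWithinAt (w k) (w (k + 1) x) (Ici 0) x)
    (hb : ∀ X : ℝ, ∃ K, 0 ≤ K ∧ ∀ k x, 0 ≤ x → x ≤ X → ‖w k x‖ ≤ K * (k + 1).factorial * B ^ k)
    {u : ℂ} (hu : ‖u‖ < 1 / B ∨ (0 < u.re ∧ |u.im| < 1 / B)) {x : ℝ} (hx : 0 ≤ x)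
    (hux : ‖u - x‖ < 1 / B) : Wf w B u = P w x u := by
  unfold Wf
  split_ifs with h
  · exact P_agree hB hd hb le_rfl hx (by simpa using h) hux
  · obtain ⟨h1, h2⟩ := hu.resolve_left h
    refine P_agree hB hd hb h1.le hx ?_ hux
    have : u - (u.re : ℂ) = u.im * I := by
      apply Complex.ext <;> simp
    rw [this]; simpa using h2

lemma Wf_an (hB : 0 < B)
    (hd : ∀ k, ∀ x, 0 ≤ x → HasDerivWithinAt (w k) (w (k + 1) x) (Ici 0) x)
    (hb : ∀ X : ℝ, ∃ K, 0 ≤ K ∧ ∀ k x, 0 ≤ x → x ≤ X → ‖w k x‖ ≤ K * (k + 1).factorial * B ^ k) :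
    AnalyticOnNhd ℂ (Wf w B) ({u : ℂ | ‖u‖ < 1 / B} ∪ {u : ℂ | 0 < u.re ∧ |u.im| < 1 / B}) := by
  intro u hu
  have hopen : IsOpen ({u : ℂ | ‖u‖ < 1 / B} ∪ {u : ℂ | 0 < u.re ∧ |u.im| < 1 / B}) := by
    refine (isOpen_lt continuous_norm continuous_const).union ?_
    exact (isOpen_lt continuous_const continuous_re).inter
      (isOpen_lt (continuous_abs.comp continuous_im) continuous_const)
  obtain ⟨x, hx, hux⟩ : ∃ x : ℝ, 0 ≤ x ∧ ‖u - x‖ < 1 / B := by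
    rcases hu with h | h
    · exact ⟨0, le_rfl, by simpa using h⟩
    · refine ⟨u.re, h.1.le, ?_⟩
      have : u - (u.re : ℂ) = u.im * I := by
        apply Complex.ext <;> simp
      rw [this]; simpa using h.2
  have hub : u ∈ Metric.ball (x : ℂ) (1 / B) := by rwa [Metric.mem_ball, dist_eq_norm]
  obtain ⟨K, hK, h⟩ := hb x
  have hP := P_diff (w := w) hB hK (fun k => h k x hx le_rfl) u hub
  refine hP.congr ?_
  filter_upwards [hopen.mem_nhds hu, Metric.isOpen_ball.mem_nhds hub] with v hv hvb
  rw [Metric.mem_ball, dist_eq_norm] at hvb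
  exact (Wf_eq hB hd hb hv hx hvb).symm

end taylor


/-- Remainder kernels. -/
noncomputable def Gk (f : ℂ → ℂ) (a : ℕ → ℂ) (k : ℕ) (z : ℂ) : ℂ :=
  (f (1 / z) - ∑ n ∈ Finset.range (k + 1), a n * (1 / z) ^ n) * z ^ k / z

lemma Gk_succ (f : ℂ → ℂ) (a : ℕ → ℂ) (k : ℕ) {z : ℂ} (hz : z ≠ 0) :
    Gk f a k z = Gk f a (k + 1) z / z + a (k + 1) * (z ^ 2)⁻¹ := by
  unfold Gk
  rw [Finset.sum_range_succ _ (k + 1)]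
  generalize f (1 / z) = F
  generalize ∑ n ∈ Finset.range (k + 1), a n * (1 / z) ^ n = S
  rw [one_div, inv_pow]
  field_simp
  ring

lemma mem_disk {R : ℝ} (hR : 0 < R) {z : ℂ} (hz : 1 / R < z.re) :
    z ≠ 0 ∧ (1 / z) ∈ {g : ℂ | g ≠ 0 ∧ (1 / g).re > 1 / R} := by
  have hR' : 0 < 1 / R := by positivity
  have hz0 : z ≠ 0 := by rintro rfl; simp at hz; linarith
  refine ⟨hz0, one_div_ne_zero hz0, ?_⟩
  rw [one_div_one_div]; exact hz

lemma Gk_diff {R : ℝ} (hR : 0 < R) (f : ℂ → ℂ) (a : ℕ → ℂ)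
    (hf : AnalyticOnNhd ℂ f {g : ℂ | g ≠ 0 ∧ (1 / g).re > 1 / R}) (k : ℕ) :
    DifferentiableOn ℂ (Gk f a k) {z | 1 / R < z.re} := by
  intro z hz
  obtain ⟨hz0, hm⟩ := mem_disk hR hz
  have h1 : DifferentiableAt ℂ (fun z : ℂ => 1 / z) z := by
    simp only [one_div]; exact differentiableAt_inv hz0
  have h2 : DifferentiableAt ℂ (fun z : ℂ => f (1 / z)) z :=
    DifferentiableAt.comp z (hf _ hm).differentiableAt h1
  apply DifferentiableAt.differentiableWithinAt
  unfold Gk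
  refine DifferentiableAt.div (DifferentiableAt.mul (h2.sub ?_) (by fun_prop)) differentiableAt_id hz0
  exact DifferentiableAt.fun_sum fun n _ => (h1.pow n).const_mul (a n)

lemma Gk_bound {R : ℝ} (hR : 0 < R) (f : ℂ → ℂ) (a : ℕ → ℂ) (A B : ℝ)
    (hfa : ∀ N : ℕ, ∀ g ∈ {g : ℂ | g ≠ 0 ∧ (1 / g).re > 1 / R},
      ‖f g - ∑ n ∈ Finset.range N, a n * g ^ n‖ ≤ A * B ^ N * N.factorial * ‖g‖ ^ N) (k : ℕ)
    (z : ℂ) (hz : 1 / R < z.re) :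
    ‖Gk f a k z‖ ≤ (A * B ^ (k + 1) * (k + 1).factorial) * (‖z‖ ^ 2)⁻¹ := by
  obtain ⟨hz0, hm⟩ := mem_disk hR hz
  have hn : 0 < ‖z‖ := norm_pos_iff.2 hz0
  unfold Gk
  rw [norm_div, norm_mul, norm_pow]
  calc _ ≤ (A * B ^ (k + 1) * (k + 1).factorial * ‖1 / z‖ ^ (k + 1)) * ‖z‖ ^ k / ‖z‖ := by
        gcongr; exact hfa (k + 1) _ hm
    _ = _ := by
        rw [norm_div, norm_one, one_div, inv_pow]; field_simp; ring

lemma a_bound {R : ℝ} (hR : 0 < R) (f : ℂ → ℂ) (a : ℕ → ℂ) (A B : ℝ) (hA : 0 < A) (hB : 0 < B)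
    (hfa : ∀ N : ℕ, ∀ g ∈ {g : ℂ | g ≠ 0 ∧ (1 / g).re > 1 / R},
      ‖f g - ∑ n ∈ Finset.range N, a n * g ^ n‖ ≤ A * B ^ N * N.factorial * ‖g‖ ^ N) (k : ℕ) :
    ‖a k‖ ≤ (A * (1 + B * (R / 2))) * (k + 1).factorial * B ^ k := by
  set g : ℂ := ((R / 2 : ℝ) : ℂ) with hg
  have hgm : g ∈ {g : ℂ | g ≠ 0 ∧ (1 / g).re > 1 / R} := by
    refine ⟨by rw [hg]; exact_mod_cast (by positivity : R / 2 ≠ 0), ?_⟩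
    rw [hg, ← ofReal_one, ← ofReal_div, ofReal_re]
    apply one_div_lt_one_div_of_lt <;> linarith
  have hgn : ‖g‖ = R / 2 := by rw [hg, norm_real, Real.norm_of_nonneg (by positivity)]
  have h1 := hfa k g hgm
  have h2 := hfa (k + 1) g hgm
  rw [Finset.sum_range_succ] at h2
  have h3 : ‖a k * g ^ k‖ ≤ A * B ^ k * k.factorial * ‖g‖ ^ k +
      A * B ^ (k + 1) * (k + 1).factorial * ‖g‖ ^ (k + 1) := by
    refine le_trans (le_of_eq ?_) ((norm_sub_le _ _).trans (add_le_add h1 h2))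
    congr 1; ring
  rw [norm_mul, norm_pow, hgn] at h3
  have hp : 0 < (R / 2) ^ k := by positivity
  have hfac : (k.factorial : ℝ) ≤ (k + 1).factorial := by
    exact_mod_cast Nat.factorial_le (Nat.le_succ k)
  refine le_of_mul_le_mul_right (h3.trans ?_) hp
  calc _ ≤ A * B ^ k * (k + 1).factorial * (R / 2) ^ k +
      A * B ^ (k + 1) * (k + 1).factorial * (R / 2) ^ (k + 1) := by gcongr
    _ = _ := by ring

end NevB

open NevB in
theorem nevanlinna_borel_summability
    (R : ℝ) (hR : 0 < R)
    (f : ℂ → ℂ) (a : ℕ → ℂ)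
    (hf : AnalyticOnNhd ℂ f {g : ℂ | g ≠ 0 ∧ (1 / g).re > 1 / R})
    (A B : ℝ) (hA : 0 < A) (hB : 0 < B)
    (hfa : ∀ N : ℕ, ∀ g ∈ {g : ℂ | g ≠ 0 ∧ (1 / g).re > 1 / R},
      ‖f g - ∑ n ∈ Finset.range N, a n * g ^ n‖ ≤ A * B ^ N * N.factorial * ‖g‖ ^ N) :
    (∀ u : ℂ, ‖u‖ < 1 / B →
      Summable fun n : ℕ => ‖(a n / (n.factorial : ℂ)) * u ^ n‖) ∧
    ∃ T : ℝ, 0 < T ∧ ∃ W : ℂ → ℂ,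
      AnalyticOnNhd ℂ W
        ({u : ℂ | ‖u‖ < 1 / B} ∪ {u : ℂ | 0 < u.re ∧ |u.im| < T}) ∧
      (∀ u : ℂ, ‖u‖ < 1 / B → W u = ∑' n : ℕ, (a n / (n.factorial : ℂ)) * u ^ n) ∧
      ∀ g : ℝ, 0 < g → g < T →
        IntegrableOn (fun u : ℝ => W u * Complex.exp (-((u / g : ℝ) : ℂ))) (Set.Ioi 0) ∧
        f g = (1 / (g : ℂ)) *
          ∫ u in Set.Ioi (0 : ℝ), W u * Complex.exp (-((u / g : ℝ) : ℂ)) := by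
  have hak := a_bound hR f a A B hA hB hfa
  have hGd := Gk_diff hR f a hf
  have hGb := Gk_bound hR f a A B hfa
  have hCk : ∀ k : ℕ, 0 ≤ A * B ^ (k + 1) * ((k + 1).factorial : ℝ) := fun k => by positivity
  have hR' : 0 < 1 / R := by positivity
  set c : ℝ := 2 / R with hcdef
  have hc0 : 0 < c := by positivity
  have hc : 1 / R < c := by rw [hcdef]; gcongr; norm_num
  set w : ℕ → ℝ → ℂ := fun k x => a k + L (Gk f a k) c x with hw
  have hw0 : ∀ k, w k 0 = a k := by
    intro k
    simp only [hw]
    rw [L_zero hR'.le (hCk k) (hGd k) (hGb k) hc le_rfl, add_zero]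
  have hd : ∀ k, ∀ x, 0 ≤ x → HasDerivWithinAt (w k) (w (k + 1) x) (Set.Ici 0) x := by
    intro k x hx
    have hI1 : ∀ x : ℝ, Integrable fun y : ℝ => Complex.exp (vl c y * x) * (Gk f a k (vl c y)) :=
      fun x => int_L hR'.le (hGd k) (hGb k) hc x
    have hI2 : ∀ x : ℝ, Integrable fun y : ℝ => Complex.exp (vl c y * x) * ((vl c y ^ 2)⁻¹) := by
      intro x
      refine int_L (a := 0) (C := 1) (G := fun z => (z ^ 2)⁻¹) le_rfl ?_ ?_ hc0 x
      · intro z hz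
        have : z ≠ 0 := by rintro rfl; simp at hz
        exact ((differentiableAt_id.pow 2).inv (by simpa)).differentiableWithinAt
      · intro z _; simp
    have hsplit : ∀ x : ℝ, 0 ≤ x → w k x = a k + (L (fun z => Gk f a (k + 1) z / z) c x + a (k + 1) * x) := by
      intro x hx
      simp only [hw]
      congr 1
      rw [← L_inv_sq hc0 hx, ← sub_eq_iff_eq_add]
      unfold L
      rw [← integral_const_mul, ← integral_sub (hI1 x) ((hI2 x).const_mul _)]
      congr 1; ext y
      rw [Gk_succ f a k (vl_ne c y hc0)]
      ring
    have h1 : HasDerivAt (fun x : ℝ => (x : ℂ)) 1 x := Complex.ofRealCLM.hasDerivAt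
    have h2 := ((L_deriv hR' (hCk (k + 1)) (hGd (k + 1)) (hGb (k + 1)) hc x).add
      (h1.const_mul (a (k + 1)))).const_add (a k)
    refine ((h2.hasDerivWithinAt (s := Set.Ici 0)).congr (fun t ht => hsplit t ht) (hsplit x hx)).congr_deriv ?_
    simp only [hw]; ring
  have hb : ∀ X : ℝ, ∃ K, 0 ≤ K ∧ ∀ k x, 0 ≤ x → x ≤ X →
      ‖w k x‖ ≤ K * (k + 1).factorial * B ^ k := by
    intro X
    refine ⟨A * (1 + B * (R / 2)) + Real.exp (c * X) * A * B * (1 / (2 * c)), by positivity, ?_⟩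
    intro k x _ hx
    calc _ ≤ ‖a k‖ + ‖L (Gk f a k) c x‖ := norm_add_le _ _
      _ ≤ (A * (1 + B * (R / 2))) * (k + 1).factorial * B ^ k +
          Real.exp (c * x) * (A * B ^ (k + 1) * ((k + 1).factorial : ℝ)) * (1 / (2 * c)) :=
        add_le_add (hak k) (norm_L hR'.le (hGb k) hc x)
      _ ≤ (A * (1 + B * (R / 2))) * (k + 1).factorial * B ^ k +
          Real.exp (c * X) * (A * B ^ (k + 1) * ((k + 1).factorial : ℝ)) * (1 / (2 * c)) := by
        gcongr
      _ = _ := by ring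
  have hP0 : ∀ u, P w 0 u = ∑' n : ℕ, (a n / (n.factorial : ℂ)) * u ^ n := by
    intro u; simp [P, hw0]
  refine ⟨?_, min (R / 2) (1 / B), by positivity, Wf w B, ?_, ?_, ?_⟩
  · intro u hu
    obtain ⟨K, hK, h⟩ := hb 0
    have := P_summable (w := w) hB hK (fun k => h k 0 le_rfl le_rfl) (u := u) (by simpa using hu)
    simpa [hw0] using this
  · refine (Wf_an hB hd hb).mono (Set.union_subset_union_right _ ?_)
    intro u hu
    exact ⟨hu.1, hu.2.trans_le (min_le_right _ _)⟩
  · intro u hu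
    rw [← hP0]
    exact if_pos hu
  · intro g hg hgT
    have hgR : g < R / 2 := hgT.trans_le (min_le_left _ _)
    have hsc : c < g⁻¹ := by
      rw [hcdef, lt_inv_comm₀ (by positivity) hg, inv_div]; exact hgR
    have hgC : (g : ℂ) ≠ 0 := by exact_mod_cast hg.ne'
    have hW : ∀ x ∈ Set.Ioi (0 : ℝ), a 0 * Complex.exp (-((g⁻¹ : ℝ) : ℂ) * x) +
        Complex.exp (-((g⁻¹ : ℝ) * x)) * L (Gk f a 0) c x =
        Wf w B x * Complex.exp (-((x / g : ℝ) : ℂ)) := by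
      intro x hx
      have hx0 : 0 < x := hx
      rw [Wf_eq hB hd hb (x := x) (Or.inr ⟨by simpa using hx0, by simpa using hB⟩) hx0.le (by simpa using hB),
        taylor_eq hB hd hb hx0.le hx0.le (by simpa using hB)]
      simp only [hw]
      have : -((x / g : ℝ) : ℂ) = -((g⁻¹ : ℝ) * x) := by push_cast; ring
      rw [this, neg_mul]; ring
    obtain ⟨hi, he⟩ := laplace_L hR'.le (hCk 0) (hGd 0) (hGb 0) hc hsc
    have hre : (-((g⁻¹ : ℝ) : ℂ)).re < 0 := by
      rw [Complex.neg_re, Complex.ofReal_re]; have := inv_pos.2 hg; linarith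
    have hi2 := (integrableOn_exp_mul_complex_Ioi hre 0).const_mul (a 0)
    refine ⟨IntegrableOn.congr_fun (hi2.add hi) hW measurableSet_Ioi, ?_⟩
    rw [← setIntegral_congr_fun measurableSet_Ioi hW, integral_add hi2 hi, he, integral_const_mul,
      integral_exp_mul_complex_Ioi hre]
    simp [Gk]
    field_simp
    ring
end

section
/- (Watson–Nevanlinna theorem.) Let 0 < ε < π/2, let S = {g ∈ ℂ : g ≠ 0 and |arg g| < π/2 + ε}, let f be complex-analytic on S, let (a_n) be a sequence of complex numbers, and suppose there exist A > 0 and B > 0 such that |f(g) − ∑_{n=0}^{N−1} a_n g^n| ≤ A·B^N·N!·|g|^N for all N ∈ ℕ and all g ∈ S. Then there exists a function W, complex-analytic on {u ∈ ℂ : |u| < 1/B} ∪ {u ∈ ℂ : u ≠ 0 and |arg u| < ε}, with W(u) = ∑_{n=0}^∞ (a_n/n!)·u^n for |u| < 1/B, such that for every g ∈ ℂ with 0 < |g| < 1/B and |arg g| < ε the function u ↦ W(u)·exp(−u/g) is integrable on (0, ∞) and f(g) = (1/g)·∫_0^∞ W(u)·exp(−u/g) du. -/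
open MeasureTheory

noncomputable section WN

open Set Filter Topology

/-- direction of a ray -/
def wdir (s σ : ℝ) : ℂ := ⟨-s, σ⟩

/-- integral along a ray -/
def wray (s σ c : ℝ) (H : ℂ → ℂ) : ℂ :=
  ∫ r in Ioi (0:ℝ), H ((c:ℂ) + r * wdir s σ) * wdir s σ

/-- sector -/
def wU (t : ℝ) : Set ℂ := {z | -t * |z.im| < z.re}

/-- half plane -/
def wP (t σ : ℝ) : Set ℂ := {z | 0 < z.re + t * (σ * z.im)}

/-- contour Laplace integral -/
def wT (s c : ℝ) (φ : ℂ → ℂ) (u : ℂ) : ℂ :=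
  wray s 1 c (fun z => Complex.exp (u * z) * φ z)
    - wray s (-1) c (fun z => Complex.exp (u * z) * φ z)

lemma wpt_re (s σ c r : ℝ) : ((c:ℂ) + r * wdir s σ).re = c - r * s := by
  simp [wdir]; ring

lemma wpt_im (s σ c r : ℝ) : ((c:ℂ) + r * wdir s σ).im = r * σ := by
  simp [wdir]

lemma wP_sub {t σ : ℝ} (ht : 0 < t) (hσ : |σ| = 1) : wP t σ ⊆ wU t := by
  intro z hz
  simp only [wP, wU, mem_ofPred_eq] at *
  have h : σ * z.im ≤ |z.im| := by
    calc σ * z.im ≤ |σ * z.im| := le_abs_self _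
      _ = |z.im| := by rw [abs_mul, hσ, one_mul]
  nlinarith

lemma wP_mem {t s σ c r : ℝ} (hst : s < t) (hσ : |σ| = 1) (hc : 0 < c) (hr : 0 ≤ r) :
    (c:ℂ) + r * wdir s σ ∈ wP t σ := by
  simp only [wP, mem_ofPred_eq, wpt_re, wpt_im]
  have : σ * (r * σ) = r := by
    have : σ * σ = 1 := by rw [← abs_mul_abs_self, hσ]; norm_num
    linear_combination r * this
  rw [this]
  nlinarith

lemma wP_open (t σ : ℝ) : IsOpen (wP t σ) := by
  apply isOpen_lt <;> fun_prop

lemma wU_open (t : ℝ) : IsOpen (wU t) := by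
  apply isOpen_lt <;> fun_prop

lemma wP_convex (t σ : ℝ) : Convex ℝ (wP t σ) := by
  intro x hx y hy a b ha hb hab
  simp only [wP, mem_ofPred_eq] at *
  simp only [Complex.add_re, Complex.add_im, Complex.smul_re, Complex.smul_im, smul_eq_mul]
  have : a * x.re + b * y.re + t * (σ * (a * x.im + b * y.im))
    = a * (x.re + t * (σ * x.im)) + b * (y.re + t * (σ * y.im)) := by ring
  rw [this]
  rcases eq_or_lt_of_le ha with h | h
  · have : b = 1 := by linarith
    subst this; rw [← h]; simpa using hy
  · have := mul_pos h hx
    have := mul_nonneg hb hy.le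
    linarith

lemma wU_mem {t s σ c r : ℝ} (hs : 0 < s) (hst : s < t) (hσ : |σ| = 1) (hc : 0 < c) (hr : 0 ≤ r) :
    (c:ℂ) + r * wdir s σ ∈ wU t := wP_sub (hs.trans hst) hσ (wP_mem hst hσ hc hr)

lemma wpt_norm {s σ c r : ℝ} (hs : 0 < s) (hσ : |σ| = 1) (hr : 0 ≤ r) :
    r + c ≤ (2 + s) * ‖(c:ℂ) + r * wdir s σ‖ := by
  have h1 := Complex.re_le_norm ((c:ℂ) + r * wdir s σ)
  have h2 := Complex.abs_im_le_norm ((c:ℂ) + r * wdir s σ)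
  rw [wpt_re] at h1
  rw [wpt_im, abs_mul, hσ, mul_one, abs_of_nonneg hr] at h2
  nlinarith

lemma wdir_norm {s σ : ℝ} (hs : 0 < s) (hσ : |σ| = 1) : ‖wdir s σ‖ ≤ 1 + s := by
  have := Complex.norm_le_abs_re_add_abs_im (wdir s σ)
  simp only [wdir, abs_neg, hσ, abs_of_pos hs] at this
  simp only [wdir]; linarith

lemma wray_cont {t s σ c : ℝ} {H : ℂ → ℂ} (hs : 0 < s) (hst : s < t) (hσ : |σ| = 1) (hc : 0 < c)
    (hH : ContinuousOn H (wU t)) :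
    ContinuousOn (fun r : ℝ => H ((c:ℂ) + r * wdir s σ)) (Ici 0) := by
  apply hH.comp (by fun_prop)
  intro r hr
  exact wU_mem hs hst hσ hc hr

lemma wray_shift {t s σ c c' : ℝ} {H : ℂ → ℂ} (hs : 0 < s) (hst : s < t) (hσ : |σ| = 1)
    (hc : 0 < c) (hc' : 0 < c') (hH : DifferentiableOn ℂ H (wU t))
    (hi : IntegrableOn (fun r : ℝ => H ((c:ℂ) + r * wdir s σ) * wdir s σ) (Ioi 0))
    (hi' : IntegrableOn (fun r : ℝ => H ((c':ℂ) + r * wdir s σ) * wdir s σ) (Ioi 0))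
    (b : ℝ → ℝ) (hb : Tendsto b atTop (𝓝 0))
    (hbd : ∀ R : ℝ, 0 ≤ R → ∀ x ∈ uIcc c c', ‖H ((x:ℂ) + R * wdir s σ)‖ ≤ b R) :
    wray s σ c H - wray s σ c' H = ∫ x in c..c', H x := by
  have ht : 0 < t := hs.trans hst
  obtain ⟨G, hG⟩ := (wP_convex t σ).exists_forall_hasDerivWithinAt (hH.mono (wP_sub ht hσ))
  have hG' : ∀ a ∈ wP t σ, HasDerivAt G (H a) a := fun a ha =>
    (hG a ha).hasDerivAt ((wP_open t σ).mem_nhds ha)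
  have hxpos : ∀ x ∈ uIcc c c', 0 < x := fun x hx => lt_of_lt_of_le (lt_min hc hc') hx.1
  have ray : ∀ x : ℝ, 0 < x → ∀ R : ℝ, 0 ≤ R →
      ∫ r in (0:ℝ)..R, H ((x:ℂ) + r * wdir s σ) * wdir s σ
        = G ((x:ℂ) + R * wdir s σ) - G x := by
    intro x hx R hR
    have := intervalIntegral.integral_eq_sub_of_hasDerivAt (a := 0) (b := R)
      (f := fun r : ℝ => G ((x:ℂ) + r * wdir s σ))
      (f' := fun r : ℝ => H ((x:ℂ) + r * wdir s σ) * wdir s σ) ?_ ?_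
    · simpa using this
    · intro r hr
      rw [uIcc_of_le hR] at hr
      have h1 := hG' _ (wP_mem (r := r) hst hσ hx hr.1)
      have h2 : HasDerivAt (fun z : ℂ => (x:ℂ) + z * wdir s σ) (wdir s σ) (r:ℂ) := by
        simpa using ((hasDerivAt_id (r:ℂ)).mul_const (wdir s σ)).const_add (x:ℂ)
      exact (HasDerivAt.comp (r:ℂ) h1 h2).comp_ofReal
    · apply ContinuousOn.intervalIntegrable
      rw [uIcc_of_le hR]
      exact ((wray_cont hs hst hσ hx hH.continuousOn).mono Icc_subset_Ici_self).mul
        continuousOn_const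
  have hor : ∀ R : ℝ, 0 ≤ R →
      ∫ x in c..c', H ((x:ℂ) + R * wdir s σ) = G ((c':ℂ) + R * wdir s σ) - G (c + R * wdir s σ) := by
    intro R hR
    apply intervalIntegral.integral_eq_sub_of_hasDerivAt
      (f := fun x : ℝ => G ((x:ℂ) + R * wdir s σ))
    · intro x hx
      have h1 := hG' _ (wP_mem (r := R) hst hσ (hxpos x hx) hR)
      have h2 : HasDerivAt (fun z : ℂ => z + R * wdir s σ) 1 (x:ℂ) := by
        simpa using ((hasDerivAt_id (x:ℂ)).add_const (R * wdir s σ))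
      simpa using (HasDerivAt.comp (x:ℂ) h1 h2).comp_ofReal
    · apply ContinuousOn.intervalIntegrable
      apply hH.continuousOn.comp (by fun_prop)
      intro x hx
      exact wU_mem hs hst hσ (hxpos x hx) hR
  have l1 := (intervalIntegral_tendsto_integral_Ioi 0 hi tendsto_id).sub
    (intervalIntegral_tendsto_integral_Ioi 0 hi' tendsto_id)
  refine tendsto_nhds_unique l1 ?_
  rw [tendsto_iff_norm_sub_tendsto_zero]
  have hb2 : Tendsto (fun R => b R * |c' - c|) atTop (𝓝 0) := by simpa using hb.mul_const |c' - c|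
  refine squeeze_zero' (Eventually.of_forall fun _ => norm_nonneg _) ?_ hb2
  filter_upwards [eventually_ge_atTop 0] with R hR
  simp only [id]
  rw [ray c hc R hR, ray c' hc' R hR]
  have h0 := hor 0 le_rfl
  simp only [Complex.ofReal_zero, zero_mul, add_zero] at h0
  rw [h0]
  have : G (c + R * wdir s σ) - G c - (G (c' + R * wdir s σ) - G c') - (G c' - G c)
      = - ∫ x in c..c', H ((x:ℂ) + R * wdir s σ) := by rw [hor R hR]; ring
  rw [this, norm_neg]
  apply intervalIntegral.norm_integral_le_of_norm_le_const
  intro x hx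
  exact hbd R hR x (uIoc_subset_uIcc hx)

lemma wpow_int {x : ℝ} (hx : 0 < x) {N : ℕ} (hN : 1 ≤ N) :
    IntegrableOn (fun r : ℝ => 1 / (r + x) ^ (N + 1)) (Ioi 0) ∧
      ∫ r in Ioi (0:ℝ), 1 / (r + x) ^ (N + 1) ≤ 1 / x ^ N := by
  have hN' : (1:ℝ) ≤ N := by exact_mod_cast hN
  have hd : ∀ r ∈ Ici (0:ℝ), HasDerivAt (fun r : ℝ => -(1 / (N:ℝ)) * ((r + x) ^ N)⁻¹)
      (1 / (r + x) ^ (N + 1)) r := by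
    intro r hr
    have hr' : 0 < r + x := by have : 0 ≤ r := hr; linarith
    have h1 : HasDerivAt (fun r : ℝ => (r + x) ^ N) (N * (r + x) ^ (N - 1)) r := by
      have := ((hasDerivAt_id r).add_const x).fun_pow N
      simpa using this
    have h2 := (h1.inv (pow_pos hr' N).ne').const_mul (-(1 / (N:ℝ)))
    refine h2.congr_deriv ?_
    obtain ⟨k, rfl⟩ : ∃ k, N = k + 1 := ⟨N - 1, by omega⟩
    simp only [Nat.add_sub_cancel]
    field_simp
    ring
  have hlim : Tendsto (fun r : ℝ => -(1 / (N:ℝ)) * ((r + x) ^ N)⁻¹) atTop (𝓝 0) := by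
    have : Tendsto (fun r : ℝ => (r + x) ^ N) atTop atTop :=
      (tendsto_pow_atTop (by omega)).comp (tendsto_atTop_add_const_right _ x tendsto_id)
    simpa using this.inv_tendsto_atTop.const_mul (-(1 / (N:ℝ)))
  have hpos : ∀ r ∈ Ioi (0:ℝ), 0 ≤ 1 / (r + x) ^ (N + 1) := by
    intro r hr
    have hr' : 0 < r + x := by have : 0 < r := hr; linarith
    positivity
  refine ⟨integrableOn_Ioi_deriv_of_nonneg' hd hpos hlim, ?_⟩
  rw [integral_Ioi_of_hasDerivAt_of_nonneg' hd hpos hlim]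
  have hxN : 0 < x ^ N := by positivity
  simp only [zero_add, zero_sub, neg_mul, neg_neg]
  rw [one_div, one_div]
  exact mul_le_of_le_one_left (by positivity) (inv_le_one_of_one_le₀ hN')

lemma wray_bound {t s σ c M u : ℝ} {φ : ℂ → ℂ} {N : ℕ} (hs : 0 < s) (hst : s < t) (hσ : |σ| = 1)
    (hc : 0 < c) (hu : 0 ≤ u) (hM : 0 ≤ M)
    (hbd : ∀ z ∈ wU t, ‖φ z‖ ≤ M / ‖z‖ ^ (N + 1)) (r : ℝ) (hr : 0 ≤ r) :
    ‖Complex.exp (u * ((c:ℂ) + r * wdir s σ)) * φ ((c:ℂ) + r * wdir s σ)‖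
      ≤ Real.exp (u * c) * M * (2 + s) ^ (N + 1) * (1 / (r + c) ^ (N + 1)) := by
  have h1 := hbd _ (wU_mem (r := r) hs hst hσ hc hr)
  have h2 := wpt_norm (c := c) (r := r) hs hσ hr
  have hrc : 0 < r + c := by linarith
  set z := (c:ℂ) + r * wdir s σ with hz
  have hzn : 0 < ‖z‖ := by
    by_contra h
    have : ‖z‖ = 0 := le_antisymm (not_lt.1 h) (norm_nonneg _)
    rw [this] at h2; linarith
  have h3 : (r + c) ^ (N + 1) ≤ (2 + s) ^ (N + 1) * ‖z‖ ^ (N + 1) := by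
    rw [← mul_pow]; gcongr
  have h4 : M / ‖z‖ ^ (N + 1) ≤ M * (2 + s) ^ (N + 1) * (1 / (r + c) ^ (N + 1)) := by
    rw [div_le_iff₀ (by positivity), mul_one_div, div_mul_eq_mul_div, le_div_iff₀ (by positivity)]
    nlinarith
  have h5 : ‖Complex.exp (u * z)‖ ≤ Real.exp (u * c) := by
    rw [Complex.norm_exp, Real.exp_le_exp, Complex.re_ofReal_mul, hz, wpt_re]
    have : 0 ≤ r * s := by positivity
    nlinarith
  rw [norm_mul]
  calc _ ≤ Real.exp (u * c) * (M * (2 + s) ^ (N + 1) * (1 / (r + c) ^ (N + 1))) := by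
        gcongr; exact h1.trans h4
    _ = _ := by ring

lemma wray_int {t s σ c M u : ℝ} {φ : ℂ → ℂ} {N : ℕ} (hs : 0 < s) (hst : s < t) (hσ : |σ| = 1)
    (hc : 0 < c) (hu : 0 ≤ u) (hM : 0 ≤ M) (hN : 1 ≤ N) (hφ : DifferentiableOn ℂ φ (wU t))
    (hbd : ∀ z ∈ wU t, ‖φ z‖ ≤ M / ‖z‖ ^ (N + 1)) :
    IntegrableOn (fun r : ℝ => (Complex.exp (u * ((c:ℂ) + r * wdir s σ))
      * φ ((c:ℂ) + r * wdir s σ)) * wdir s σ) (Ioi 0) := by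
  apply Integrable.mul_const
  refine Integrable.mono' ((wpow_int hc hN).1.const_mul
    (Real.exp (u * c) * M * (2 + s) ^ (N + 1))) ?_ ?_
  · apply ContinuousOn.aestronglyMeasurable _ measurableSet_Ioi
    apply ContinuousOn.mul (by fun_prop)
    exact (wray_cont hs hst hσ hc hφ.continuousOn).mono Ioi_subset_Ici_self
  · filter_upwards [ae_restrict_mem measurableSet_Ioi] with r hr
    exact wray_bound hs hst hσ hc hu hM hbd r (le_of_lt hr)

lemma wray_norm {t s σ c M u : ℝ} {φ : ℂ → ℂ} {N : ℕ} (hs : 0 < s) (hst : s < t) (hσ : |σ| = 1)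
    (hc : 0 < c) (hu : 0 ≤ u) (hM : 0 ≤ M) (hN : 1 ≤ N)
    (hbd : ∀ z ∈ wU t, ‖φ z‖ ≤ M / ‖z‖ ^ (N + 1)) :
    ‖wray s σ c (fun z => Complex.exp (u * z) * φ z)‖
      ≤ (1 + s) * (Real.exp (u * c) * M * (2 + s) ^ (N + 1) * (1 / c ^ N)) := by
  rw [wray, integral_mul_const, norm_mul, mul_comm]
  have h := wdir_norm hs hσ
  have h2 : ‖∫ r in Ioi (0:ℝ), Complex.exp (u * ((c:ℂ) + r * wdir s σ))
      * φ ((c:ℂ) + r * wdir s σ)‖ ≤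
      ∫ r in Ioi (0:ℝ), Real.exp (u * c) * M * (2 + s) ^ (N + 1) * (1 / (r + c) ^ (N + 1)) := by
    apply norm_integral_le_of_norm_le ((wpow_int hc hN).1.const_mul _)
    filter_upwards [ae_restrict_mem measurableSet_Ioi] with r hr
    exact wray_bound hs hst hσ hc hu hM hbd r (le_of_lt hr)
  rw [integral_const_mul] at h2
  have h3 := (wpow_int hc hN).2
  gcongr
  exact h2.trans (by gcongr)

lemma wT_bound {t s c c' M u : ℝ} {φ : ℂ → ℂ} {N : ℕ} (hs : 0 < s) (hst : s < t)
    (hc : 0 < c) (hc' : 0 < c') (hu : 0 ≤ u) (hM : 0 ≤ M) (hN : 1 ≤ N)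
    (hφ : DifferentiableOn ℂ φ (wU t))
    (hbd : ∀ z ∈ wU t, ‖φ z‖ ≤ M / ‖z‖ ^ (N + 1)) :
    ‖wT s c φ u‖ ≤ 2 * ((1 + s) * (Real.exp (u * c') * M * (2 + s) ^ (N + 1) * (1 / c' ^ N))) := by
  have key : ∀ σ : ℝ, |σ| = 1 → wray s σ c (fun z => Complex.exp (u * z) * φ z)
      - wray s σ c' (fun z => Complex.exp (u * z) * φ z)
      = ∫ x in c..c', Complex.exp (u * x) * φ x := by
    intro σ hσ
    apply wray_shift (H := fun z => Complex.exp (u * z) * φ z) hs hst hσ hc hc'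
      (DifferentiableOn.mul (by fun_prop) hφ)
      (wray_int hs hst hσ hc hu hM hN hφ hbd) (wray_int hs hst hσ hc' hu hM hN hφ hbd)
      (fun R => Real.exp (u * max c c') * M * (2 + s) ^ (N + 1) * (1 / (R + min c c') ^ (N + 1)))
    · have : Tendsto (fun R : ℝ => (R + min c c') ^ (N + 1)) atTop atTop :=
        (tendsto_pow_atTop (by omega)).comp (tendsto_atTop_add_const_right _ _ tendsto_id)
      simpa using this.inv_tendsto_atTop.const_mul
        (Real.exp (u * max c c') * M * (2 + s) ^ (N + 1))
    · intro R hR x hx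
      have hm : 0 < min c c' := lt_min hc hc'
      have hx1 : min c c' ≤ x := hx.1
      have hx2 : x ≤ max c c' := hx.2
      refine (wray_bound hs hst hσ (lt_of_lt_of_le hm hx1) hu hM hbd R hR).trans ?_
      have : 0 ≤ 1 / (R + x) ^ (N + 1) := by
        have : 0 < R + x := by linarith
        positivity
      gcongr
  have k1 := key 1 (by norm_num)
  have k2 := key (-1) (by norm_num)
  have : wT s c φ u = wray s 1 c' (fun z => Complex.exp (u * z) * φ z)
    - wray s (-1) c' (fun z => Complex.exp (u * z) * φ z) := by
    rw [wT]; linear_combination k1 - k2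
  rw [this]
  have b1 := wray_norm (σ := 1) hs hst (by norm_num) hc' hu hM hN hbd
  have b2 := wray_norm (σ := -1) hs hst (by norm_num) hc' hu hM hN hbd
  exact (norm_sub_le _ _).trans (by linarith)

/-- dual sector -/
def wV (s : ℝ) : Set ℂ := {u | |u.im| < s * u.re}

lemma wV_open (s : ℝ) : IsOpen (wV s) := by
  apply isOpen_lt <;> fun_prop

lemma wV_dir {s σ : ℝ} {u : ℂ} (hσ : |σ| = 1) (hu : u ∈ wV s) : (u * wdir s σ).re < 0 := by
  simp only [wV, mem_ofPred_eq] at hu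
  simp only [wdir, Complex.mul_re]
  have : -(u.im * σ) ≤ |u.im| := by
    calc -(u.im * σ) ≤ |u.im * σ| := neg_le_abs _
      _ = _ := by rw [abs_mul, hσ, mul_one]
  nlinarith

lemma wexp_norm (s σ c r : ℝ) (u : ℂ) :
    ‖Complex.exp (u * ((c:ℂ) + r * wdir s σ))‖
      = Real.exp (u.re * c + r * (u * wdir s σ).re) := by
  rw [Complex.norm_exp]
  congr 1
  have : u * ((c:ℂ) + r * wdir s σ) = u * (c:ℂ) + (r:ℂ) * (u * wdir s σ) := by ring
  rw [this, Complex.add_re, Complex.re_ofReal_mul, Complex.re_mul_ofReal]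

lemma wlin_exp {η r : ℝ} (hη : 0 < η) (hr : 0 ≤ r) :
    (1 + r) * Real.exp (-(2 * η) * r) ≤ (1 + 1 / η) * Real.exp (-η * r) := by
  have h1 : 1 + r ≤ (1 + 1 / η) * Real.exp (η * r) := by
    have := Real.add_one_le_exp (η * r)
    have h2 : 0 ≤ η * r := by positivity
    have h3 : (1 / η) * (η * r) = r := by field_simp
    have h4 : 0 < 1 / η := by positivity
    nlinarith
  calc (1 + r) * Real.exp (-(2 * η) * r)
      ≤ ((1 + 1 / η) * Real.exp (η * r)) * Real.exp (-(2 * η) * r) := by gcongr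
    _ = (1 + 1 / η) * Real.exp (-η * r) := by
        rw [mul_assoc, ← Real.exp_add]; ring_nf

lemma wray_exp_int {t s σ c M : ℝ} {φ : ℂ → ℂ} {u : ℂ} (hs : 0 < s) (hst : s < t) (hσ : |σ| = 1)
    (hc : 0 < c) (hφ : ContinuousOn φ (wU t))
    (hbd : ∀ r : ℝ, 0 ≤ r → ‖φ ((c:ℂ) + r * wdir s σ)‖ ≤ M)
    (hu : (u * wdir s σ).re < 0) :
    IntegrableOn (fun r : ℝ => (Complex.exp (u * ((c:ℂ) + r * wdir s σ))
      * φ ((c:ℂ) + r * wdir s σ)) * wdir s σ) (Ioi 0) := by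
  apply Integrable.mul_const
  refine Integrable.mono' ((integrableOn_exp_mul_Ioi hu 0).const_mul
    (Real.exp (u.re * c) * M)) ?_ ?_
  · apply ContinuousOn.aestronglyMeasurable _ measurableSet_Ioi
    apply ContinuousOn.mul (by fun_prop)
    exact (wray_cont hs hst hσ hc hφ).mono Ioi_subset_Ici_self
  · filter_upwards [ae_restrict_mem measurableSet_Ioi] with r hr
    rw [norm_mul, wexp_norm, Real.exp_add]
    have h1 := hbd r (le_of_lt hr)
    calc _ ≤ Real.exp (u.re * c) * Real.exp (r * (u * wdir s σ).re) * M := by gcongr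
      _ = _ := by rw [mul_comm r]; ring

lemma wray_deriv {t s σ c M : ℝ} {φ : ℂ → ℂ} {u : ℂ} (hs : 0 < s) (hst : s < t) (hσ : |σ| = 1)
    (hc : 0 < c) (hφ : ContinuousOn φ (wU t))
    (hbd : ∀ r : ℝ, 0 ≤ r → ‖φ ((c:ℂ) + r * wdir s σ)‖ ≤ M)
    (hu : (u * wdir s σ).re < 0) :
    HasDerivAt (fun u => wray s σ c (fun z => Complex.exp (u * z) * φ z))
      (wray s σ c (fun z => Complex.exp (u * z) * (z * φ z))) u := by
  have hM : 0 ≤ M := (norm_nonneg _).trans (hbd 0 le_rfl)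
  obtain ⟨η, hη, hη2⟩ : ∃ η : ℝ, 0 < η ∧ (u * wdir s σ).re < -(2 * η) :=
    ⟨-(u * wdir s σ).re / 4, by linarith, by linarith⟩
  have hopen : IsOpen {v : ℂ | (v * wdir s σ).re < -(2 * η) ∧ v.re < u.re + 1} := by
    exact (isOpen_lt (f := fun v : ℂ => (v * wdir s σ).re) (g := fun _ => -(2 * η))
      (by fun_prop) (by fun_prop)).inter
      (isOpen_lt (f := fun v : ℂ => v.re) (g := fun _ => u.re + 1) (by fun_prop) (by fun_prop))
  unfold wray
  refine (hasDerivAt_integral_of_dominated_loc_of_deriv_le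
    (F := fun u (r:ℝ) => Complex.exp (u * ((c:ℂ) + r * wdir s σ))
      * φ ((c:ℂ) + r * wdir s σ) * wdir s σ)
    (F' := fun u (r:ℝ) => Complex.exp (u * ((c:ℂ) + r * wdir s σ))
      * (((c:ℂ) + r * wdir s σ) * φ ((c:ℂ) + r * wdir s σ)) * wdir s σ)
    (bound := fun r => (Real.exp ((u.re + 1) * c) * (c + 1 + s) * M * (1 + s) * (1 + 1 / η)) *
      Real.exp (-η * r))
    (hopen.mem_nhds ⟨hη2, by linarith⟩) ?_ ?_ ?_ ?_ ?_ ?_).2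
  · filter_upwards with v
    apply ContinuousOn.aestronglyMeasurable _ measurableSet_Ioi
    apply ContinuousOn.mul _ continuousOn_const
    apply ContinuousOn.mul (by fun_prop)
    exact (wray_cont hs hst hσ hc hφ).mono Ioi_subset_Ici_self
  · exact wray_exp_int hs hst hσ hc hφ hbd hu
  · apply ContinuousOn.aestronglyMeasurable _ measurableSet_Ioi
    apply ContinuousOn.mul _ continuousOn_const
    apply ContinuousOn.mul (by fun_prop)
    apply ContinuousOn.mul (by fun_prop)
    exact (wray_cont hs hst hσ hc hφ).mono Ioi_subset_Ici_self
  · filter_upwards [ae_restrict_mem measurableSet_Ioi] with r hr v hv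
    have hr0 : 0 ≤ r := le_of_lt hr
    obtain ⟨hv1, hv2⟩ := hv
    rw [norm_mul, norm_mul, norm_mul, wexp_norm, Real.exp_add]
    have h1 := hbd r hr0
    have h2 := wdir_norm hs hσ
    have h3 : ‖(c:ℂ) + r * wdir s σ‖ ≤ (c + 1 + s) * (1 + r) := by
      calc _ ≤ ‖(c:ℂ)‖ + ‖(r:ℂ) * wdir s σ‖ := norm_add_le _ _
        _ ≤ c + r * (1 + s) := by
          rw [norm_mul, Complex.norm_of_nonneg hc.le, Complex.norm_of_nonneg hr0]
          gcongr
        _ ≤ _ := by nlinarith [mul_nonneg hc.le hr0]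
    have h4 : Real.exp (v.re * c) ≤ Real.exp ((u.re + 1) * c) := by gcongr
    have h5 : Real.exp (r * (v * wdir s σ).re) ≤ Real.exp (-(2 * η) * r) := by
      rw [Real.exp_le_exp]; nlinarith
    have h6 := wlin_exp hη hr0
    calc _ ≤ Real.exp ((u.re + 1) * c) * Real.exp (-(2 * η) * r)
            * ((c + 1 + s) * (1 + r) * M) * (1 + s) := by gcongr
      _ = (Real.exp ((u.re + 1) * c) * (c + 1 + s) * M * (1 + s)) *
            ((1 + r) * Real.exp (-(2 * η) * r)) := by ring
      _ ≤ (Real.exp ((u.re + 1) * c) * (c + 1 + s) * M * (1 + s)) *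
            ((1 + 1 / η) * Real.exp (-η * r)) := by gcongr
      _ = _ := by ring
  · exact (integrableOn_exp_mul_Ioi (by linarith) 0).const_mul _
  · filter_upwards with r v hv
    have h := (((hasDerivAt_id v).mul_const ((c:ℂ) + r * wdir s σ)).cexp.mul_const
      (φ ((c:ℂ) + r * wdir s σ))).mul_const (wdir s σ)
    simp only [id, one_mul] at h
    refine h.congr_deriv ?_
    ring

lemma wbd_ray {t s σ c M : ℝ} {φ : ℂ → ℂ} (hs : 0 < s) (hst : s < t) (hσ : |σ| = 1)
    (hc : 0 < c) (hM : 0 ≤ M) (hbd : ∀ z ∈ wU t, ‖φ z‖ ≤ M / ‖z‖) (r : ℝ) (hr : 0 ≤ r) :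
    ‖φ ((c:ℂ) + r * wdir s σ)‖ ≤ M * (2 + s) / (r + c) := by
  have h := wray_bound (u := 0) (N := 0) hs hst hσ hc le_rfl hM (by simpa using hbd) r hr
  simpa [div_eq_mul_inv] using h

lemma wbd_ray' {t s σ c M : ℝ} {φ : ℂ → ℂ} (hs : 0 < s) (hst : s < t) (hσ : |σ| = 1)
    (hc : 0 < c) (hM : 0 ≤ M) (hbd : ∀ z ∈ wU t, ‖φ z‖ ≤ M / ‖z‖) (r : ℝ) (hr : 0 ≤ r) :
    ‖φ ((c:ℂ) + r * wdir s σ)‖ ≤ M * (2 + s) / c := by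
  refine (wbd_ray hs hst hσ hc hM hbd r hr).trans ?_
  gcongr
  linarith

lemma wT_deriv {t s c M : ℝ} {φ : ℂ → ℂ} {u : ℂ} (hs : 0 < s) (hst : s < t)
    (hc : 0 < c) (hM : 0 ≤ M) (hφ : ContinuousOn φ (wU t))
    (hbd : ∀ z ∈ wU t, ‖φ z‖ ≤ M / ‖z‖) (hu : u ∈ wV s) :
    HasDerivAt (wT s c φ) (wT s c (fun z => z * φ z) u) u := by
  have e1 : |(1:ℝ)| = 1 := by norm_num
  have e2 : |(-1:ℝ)| = 1 := by norm_num
  exact (wray_deriv hs hst e1 hc hφ (wbd_ray' hs hst e1 hc hM hbd) (wV_dir e1 hu)).sub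
    (wray_deriv hs hst e2 hc hφ (wbd_ray' hs hst e2 hc hM hbd) (wV_dir e2 hu))

lemma wT_analytic {t s c M : ℝ} {φ : ℂ → ℂ} (hs : 0 < s) (hst : s < t)
    (hc : 0 < c) (hM : 0 ≤ M) (hφ : ContinuousOn φ (wU t))
    (hbd : ∀ z ∈ wU t, ‖φ z‖ ≤ M / ‖z‖) :
    AnalyticOnNhd ℂ (wT s c φ) (wV s) := by
  apply DifferentiableOn.analyticOnNhd _ (wV_open s)
  intro u hu
  exact (wT_deriv hs hst hc hM hφ hbd hu).differentiableAt.differentiableWithinAt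

lemma wlow {s σ c : ℝ} {w : ℂ} (hs : 0 < s) (hc : 0 < c) (hw : c < w.re) :
    ∃ k : ℝ, 0 < k ∧ ∀ r : ℝ, 0 ≤ r → k * (r + c) ≤ (w - ((c:ℂ) + r * wdir s σ)).re := by
  refine ⟨min s ((w.re - c) / c), lt_min hs (div_pos (by linarith) hc), fun r hr => ?_⟩
  rw [Complex.sub_re, wpt_re]
  have h1 : min s ((w.re - c) / c) * r ≤ s * r := by gcongr; exact min_le_left _ _
  have h2 : min s ((w.re - c) / c) * c ≤ (w.re - c) / c * c := by gcongr; exact min_le_right _ _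
  rw [div_mul_cancel₀ _ hc.ne'] at h2
  linarith

lemma wcauchy_int {t s σ c M : ℝ} {φ : ℂ → ℂ} {w : ℂ} (hs : 0 < s) (hst : s < t) (hσ : |σ| = 1)
    (hc : 0 < c) (hM : 0 ≤ M) (hφ : ContinuousOn φ (wU t))
    (hbd : ∀ z ∈ wU t, ‖φ z‖ ≤ M / ‖z‖) (hw : c < w.re) :
    IntegrableOn (fun r : ℝ => ‖φ ((c:ℂ) + r * wdir s σ) * wdir s σ‖ *
      (1 / (w - ((c:ℂ) + r * wdir s σ)).re)) (Ioi 0) := by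
  obtain ⟨k, hk, hk2⟩ := wlow (σ := σ) hs hc hw
  refine Integrable.mono' ((wpow_int hc (le_refl 1)).1.const_mul
    (M * (2 + s) * (1 + s) * (1 / k))) ?_ ?_
  · apply ContinuousOn.aestronglyMeasurable _ measurableSet_Ioi
    apply ContinuousOn.mul
    · apply ContinuousOn.norm
      exact ((wray_cont hs hst hσ hc hφ).mono Ioi_subset_Ici_self).mul continuousOn_const
    · apply ContinuousOn.div continuousOn_const (by fun_prop)
      intro r hr
      have hr' : 0 < r := hr
      exact (lt_of_lt_of_le (by positivity) (hk2 r hr'.le)).ne'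
  · filter_upwards [ae_restrict_mem measurableSet_Ioi] with r hr
    have hr' : 0 < r := hr
    have h1 := hk2 r hr'.le
    have h2 := wbd_ray hs hst hσ hc hM hbd r hr'.le
    have h3 := wdir_norm hs hσ
    have h4 : 0 < k * (r + c) := by positivity
    rw [norm_mul, norm_norm, norm_mul, Real.norm_of_nonneg
      (one_div_nonneg.2 (h4.le.trans h1))]
    have h6 := one_div_nonneg.2 (h4.le.trans h1)
    calc _ ≤ (M * (2 + s) / (r + c)) * (1 + s) * (1 / (k * (r + c))) := by gcongr
      _ = _ := by field_simp

lemma wfubini {t s σ c M : ℝ} {φ : ℂ → ℂ} {w : ℂ} (hs : 0 < s) (hst : s < t) (hσ : |σ| = 1)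
    (hc : 0 < c) (hM : 0 ≤ M) (hφ : ContinuousOn φ (wU t))
    (hbd : ∀ z ∈ wU t, ‖φ z‖ ≤ M / ‖z‖) (hw : c < w.re) :
    IntegrableOn (fun u : ℝ => wray s σ c (fun z => Complex.exp (u * z) * φ z)
      * Complex.exp (-(u * w))) (Ioi 0) ∧
    ∫ u in Ioi (0:ℝ), wray s σ c (fun z => Complex.exp (u * z) * φ z) * Complex.exp (-(u * w))
      = wray s σ c (fun z => φ z / (w - z)) := by
  obtain ⟨k, hk, hk2⟩ := wlow (σ := σ) hs hc hw
  have hneg : ∀ r : ℝ, 0 < r → (-(w - ((c:ℂ) + r * wdir s σ))).re < 0 := by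
    intro r hr
    have h1 := hk2 r hr.le
    have h4 : 0 < k * (r + c) := by positivity
    rw [Complex.neg_re]; linarith
  set F : ℝ → ℝ → ℂ := fun u r => φ ((c:ℂ) + r * wdir s σ) * wdir s σ *
    Complex.exp (-(w - ((c:ℂ) + r * wdir s σ)) * u) with hF
  have hint : Integrable (Function.uncurry F)
      ((volume.restrict (Ioi (0:ℝ))).prod (volume.restrict (Ioi (0:ℝ)))) := by
    rw [integrable_prod_iff']
    · constructor
      · filter_upwards [ae_restrict_mem measurableSet_Ioi] with r hr
        have := (integrableOn_exp_mul_complex_Ioi (hneg r hr) 0).const_mul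
          (φ ((c:ℂ) + r * wdir s σ) * wdir s σ)
        exact this
      · refine (wcauchy_int hs hst hσ hc hM hφ hbd hw).congr_fun ?_ measurableSet_Ioi
        intro r hr
        simp only [Function.uncurry, hF]
        simp_rw [norm_mul _ (Complex.exp _)]
        rw [integral_const_mul]
        congr 1
        have := integral_exp_mul_Ioi (hneg r hr) 0
        simp only [Complex.norm_exp, Complex.re_mul_ofReal]
        rw [this, Complex.neg_re, mul_zero, Real.exp_zero, neg_div_neg_eq]
    · rw [Measure.prod_restrict]
      apply ContinuousOn.aestronglyMeasurable _ (measurableSet_Ioi.prod measurableSet_Ioi)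
      simp only [hF]
      apply ContinuousOn.mul
      · apply ContinuousOn.mul _ continuousOn_const
        apply (wray_cont hs hst hσ hc hφ).comp (by fun_prop)
        intro p hp
        exact mem_Ici.2 (le_of_lt (mem_Ioi.1 hp.2))
      · fun_prop
  have hinner : ∀ u : ℝ, ∫ r in Ioi (0:ℝ), F u r =
      wray s σ c (fun z => Complex.exp (u * z) * φ z) * Complex.exp (-(u * w)) := by
    intro u
    rw [wray, ← integral_mul_const]
    congr 1
    ext r
    simp only [hF]
    rw [show -(w - ((c:ℂ) + r * wdir s σ)) * u = u * ((c:ℂ) + r * wdir s σ) + -(u * w) by ring,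
      Complex.exp_add]
    ring
  constructor
  · have := hint.integral_prod_left
    simp only [Function.uncurry] at this
    simp_rw [hinner] at this
    exact this
  · simp_rw [← hinner]
    rw [integral_integral_swap hint, wray]
    apply setIntegral_congr_fun measurableSet_Ioi
    intro r hr
    simp only [hF]
    rw [integral_const_mul, integral_exp_mul_complex_Ioi (hneg r hr)]
    have hne : w - ((c:ℂ) + r * wdir s σ) ≠ 0 := by
      intro h
      have := hneg r hr
      rw [h] at this; simp at this
    simp only [Complex.ofReal_zero, mul_zero, Complex.exp_zero]
    field_simp

lemma wlog {t s σ c : ℝ} {w : ℂ} (hs : 0 < s) (hst : s < t) (hσ : |σ| = 1)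
    (hc : 0 < c) (hw : c < w.re) :
    wray s σ c (fun z => (1 / z) / (w - z)) =
      ((Complex.log (wdir s σ) - Complex.log (-wdir s σ))
        - (Complex.log c - Complex.log (w - c))) / w := by
  obtain ⟨k, hk, hk2⟩ := wlow (σ := σ) hs hc hw
  have hw0 : w ≠ 0 := by rintro rfl; simp at hw; linarith
  have hσ0 : σ ≠ 0 := by rintro rfl; simp at hσ
  have m1 : ∀ r : ℝ, 0 ≤ r → (c:ℂ) + r * wdir s σ ∈ Complex.slitPlane := by
    intro r hr
    rw [Complex.mem_slitPlane_iff, wpt_re, wpt_im]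
    rcases eq_or_lt_of_le hr with h | h
    · left; rw [← h]; simpa using hc
    · right; exact mul_ne_zero h.ne' hσ0
  have m2 : ∀ r : ℝ, 0 ≤ r → w - ((c:ℂ) + r * wdir s σ) ∈ Complex.slitPlane := by
    intro r hr
    left
    exact lt_of_lt_of_le (by positivity) (hk2 r hr)
  have hd : ∀ r ∈ Ici (0:ℝ), HasDerivAt (fun r : ℝ => (Complex.log ((c:ℂ) + r * wdir s σ)
      - Complex.log (w - ((c:ℂ) + r * wdir s σ))) / w)
      ((1 / ((c:ℂ) + r * wdir s σ)) / (w - ((c:ℂ) + r * wdir s σ)) * wdir s σ) r := by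
    intro r hr
    have h2 : HasDerivAt (fun z : ℂ => (c:ℂ) + z * wdir s σ) (wdir s σ) (r:ℂ) := by
      simpa using ((hasDerivAt_id (r:ℂ)).mul_const (wdir s σ)).const_add (c:ℂ)
    have h3 := ((h2.clog (m1 r hr)).sub ((h2.const_sub w).clog (m2 r hr))).div_const w
    have h4 := h3.comp_ofReal
    refine h4.congr_deriv ?_
    have q1 := Complex.slitPlane_ne_zero (m1 r hr)
    have q2 := Complex.slitPlane_ne_zero (m2 r hr)
    generalize (c:ℂ) + r * wdir s σ = z at q1 q2
    field_simp
    ring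
  have hcont : ContinuousOn (fun z : ℂ => 1 / z) (wU t) := by
    apply ContinuousOn.div continuousOn_const continuousOn_id
    rintro z hz rfl
    simp [wU] at hz
  have hint : IntegrableOn (fun r : ℝ => (1 / ((c:ℂ) + r * wdir s σ)) /
      (w - ((c:ℂ) + r * wdir s σ)) * wdir s σ) (Ioi 0) := by
    refine Integrable.mono' (wcauchy_int (φ := fun z => 1 / z) (M := 1) hs hst hσ hc zero_le_one
      hcont (by intro z _; simp) hw) ?_ ?_
    · apply ContinuousOn.aestronglyMeasurable _ measurableSet_Ioi
      apply ContinuousOn.mul _ continuousOn_const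
      apply ContinuousOn.div
      · exact (wray_cont hs hst hσ hc hcont).mono Ioi_subset_Ici_self
      · fun_prop
      · intro r hr
        exact Complex.slitPlane_ne_zero (m2 r (le_of_lt hr))
    · filter_upwards [ae_restrict_mem measurableSet_Ioi] with r hr
      have hr' : 0 < r := hr
      have h1 := hk2 r hr'.le
      have h4 : 0 < k * (r + c) := by positivity
      have h5 := Complex.re_le_norm (w - ((c:ℂ) + r * wdir s σ))
      rw [div_mul_eq_mul_div, norm_div, div_eq_mul_one_div]
      gcongr
      linarith
  have hlim : Tendsto (fun r : ℝ => (Complex.log ((c:ℂ) + r * wdir s σ)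
      - Complex.log (w - ((c:ℂ) + r * wdir s σ))) / w) atTop
      (𝓝 ((Complex.log (wdir s σ) - Complex.log (-wdir s σ)) / w)) := by
    have hinv : Tendsto (fun r : ℝ => (((r⁻¹ : ℝ)) : ℂ)) atTop (𝓝 0) := by
      have := (Complex.continuous_ofReal.tendsto 0).comp tendsto_inv_atTop_zero
      simpa [Function.comp_def] using this
    have t1 : Tendsto (fun r : ℝ => (((r⁻¹ : ℝ)) : ℂ) * c + wdir s σ) atTop (𝓝 (wdir s σ)) := by
      simpa using (hinv.mul_const (c:ℂ)).add_const (wdir s σ)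
    have t2 : Tendsto (fun r : ℝ => (((r⁻¹ : ℝ)) : ℂ) * (w - c) + -wdir s σ) atTop
        (𝓝 (-wdir s σ)) := by
      simpa using (hinv.mul_const (w - c:ℂ)).add_const (-wdir s σ)
    have s1 : wdir s σ ∈ Complex.slitPlane := by
      right; simpa [wdir] using hσ0
    have s2 : -wdir s σ ∈ Complex.slitPlane := by
      right; simpa [wdir] using hσ0
    refine (((t1.clog s1).sub (t2.clog s2)).div_const w).congr' ?_
    filter_upwards [eventually_gt_atTop 0] with r hr
    have hr0 : (r:ℂ) ≠ 0 := by exact_mod_cast hr.ne'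
    have e1 : (c:ℂ) + r * wdir s σ = r * ((((r⁻¹ : ℝ)) : ℂ) * c + wdir s σ) := by
      push_cast; field_simp
    have e2 : w - ((c:ℂ) + r * wdir s σ) = r * ((((r⁻¹ : ℝ)) : ℂ) * (w - c) + -wdir s σ) := by
      push_cast; field_simp; ring
    have n1 := Complex.slitPlane_ne_zero (m1 r hr.le)
    have n2 := Complex.slitPlane_ne_zero (m2 r hr.le)
    rw [e1] at n1
    rw [e2] at n2
    rw [e2, e1, Complex.log_ofReal_mul hr (right_ne_zero_of_mul n1),
      Complex.log_ofReal_mul hr (right_ne_zero_of_mul n2)]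
    ring
  rw [wray, integral_Ioi_of_hasDerivAt_of_tendsto' hd hint hlim]
  simp only [Complex.ofReal_zero, zero_mul, add_zero]
  ring

lemma wlog_total {t s c : ℝ} {w : ℂ} (hs : 0 < s) (hst : s < t)
    (hc : 0 < c) (hw : c < w.re) :
    wray s 1 c (fun z => (1 / z) / (w - z)) - wray s (-1) c (fun z => (1 / z) / (w - z))
      = 2 * Real.pi * Complex.I / w := by
  rw [wlog hs hst (by norm_num) hc hw, wlog hs hst (by norm_num) hc hw]
  have h1 : Complex.log (wdir s 1) - Complex.log (-wdir s 1) = Real.pi * Complex.I := by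
    simp only [Complex.log, norm_neg]
    rw [Complex.arg_neg_eq_arg_sub_pi_of_im_pos (by simp [wdir])]
    push_cast; ring
  have h2 : Complex.log (wdir s (-1)) - Complex.log (-wdir s (-1)) = -(Real.pi * Complex.I) := by
    simp only [Complex.log, norm_neg]
    rw [Complex.arg_neg_eq_arg_add_pi_of_im_neg (by simp [wdir])]
    push_cast; ring
  rw [h1, h2]
  ring

lemma wU_ne {t : ℝ} {z : ℂ} (hz : z ∈ wU t) : z ≠ 0 := by
  rintro rfl
  simp [wU] at hz

lemma wray_congr {t s σ c : ℝ} {H K : ℂ → ℂ} (hs : 0 < s) (hst : s < t) (hσ : |σ| = 1)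
    (hc : 0 < c) (h : ∀ z ∈ wU t, H z = K z) : wray s σ c H = wray s σ c K := by
  unfold wray
  apply setIntegral_congr_fun measurableSet_Ioi
  intro r hr
  simp only
  rw [h _ (wU_mem hs hst hσ hc (le_of_lt hr))]

lemma wT_congr {t s c : ℝ} {H K : ℂ → ℂ} (hs : 0 < s) (hst : s < t)
    (hc : 0 < c) (h : ∀ z ∈ wU t, H z = K z) (u : ℂ) : wT s c H u = wT s c K u := by
  unfold wT
  rw [wray_congr (σ := 1) hs hst (by norm_num) hc (fun z hz => by rw [h z hz] :
      ∀ z ∈ wU t, Complex.exp (u * z) * H z = Complex.exp (u * z) * K z),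
    wray_congr (σ := -1) hs hst (by norm_num) hc (fun z hz => by rw [h z hz] :
      ∀ z ∈ wU t, Complex.exp (u * z) * H z = Complex.exp (u * z) * K z)]

lemma wcauchy_int' {t s σ c M : ℝ} {φ : ℂ → ℂ} {w : ℂ} (hs : 0 < s) (hst : s < t) (hσ : |σ| = 1)
    (hc : 0 < c) (hM : 0 ≤ M) (hφ : ContinuousOn φ (wU t))
    (hbd : ∀ z ∈ wU t, ‖φ z‖ ≤ M / ‖z‖) (hw : c < w.re) :
    IntegrableOn (fun r : ℝ => φ ((c:ℂ) + r * wdir s σ) /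
      (w - ((c:ℂ) + r * wdir s σ)) * wdir s σ) (Ioi 0) := by
  obtain ⟨k, hk, hk2⟩ := wlow (σ := σ) hs hc hw
  refine Integrable.mono' (wcauchy_int (φ := φ) hs hst hσ hc hM hφ hbd hw) ?_ ?_
  · apply ContinuousOn.aestronglyMeasurable _ measurableSet_Ioi
    apply ContinuousOn.mul _ continuousOn_const
    apply ContinuousOn.div
    · exact (wray_cont hs hst hσ hc hφ).mono Ioi_subset_Ici_self
    · fun_prop
    · intro r hr h0
      have hr' : 0 < r := hr
      have h1 := hk2 r hr'.le
      have h4 : 0 < k * (r + c) := by positivity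
      rw [h0] at h1
      simp only [Complex.zero_re] at h1
      linarith
  · filter_upwards [ae_restrict_mem measurableSet_Ioi] with r hr
    have hr' : 0 < r := hr
    have h1 := hk2 r hr'.le
    have h4 : 0 < k * (r + c) := by positivity
    have h5 := Complex.re_le_norm (w - ((c:ℂ) + r * wdir s σ))
    rw [div_mul_eq_mul_div, norm_div, div_eq_mul_one_div]
    gcongr
    linarith

lemma wdslope_bound {t A : ℝ} {F : ℂ → ℂ} {w : ℂ} (hA : 0 ≤ A) (hw : w ∈ wU t)
    (hF : DifferentiableOn ℂ F (wU t)) (hFA : ∀ z ∈ wU t, ‖F z‖ ≤ A) :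
    ∃ D : ℝ, 0 ≤ D ∧ ∀ z ∈ wU t, ‖-(dslope F w z) / z‖ ≤ D / ‖z‖ ^ (1 + 1) := by
  have hnw := (wU_open t).mem_nhds hw
  have hd : DifferentiableOn ℂ (dslope F w) (wU t) := (Complex.differentiableOn_dslope hnw).2 hF
  have hca : ContinuousAt (dslope F w) w := (hd.differentiableAt hnw).continuousAt
  have hev : ∀ᶠ z in 𝓝 w, ‖dslope F w z‖ < ‖dslope F w w‖ + 1 :=
    hca.norm.eventually_lt continuousAt_const (by linarith)
  obtain ⟨δ, hδ, hδ2⟩ := Metric.eventually_nhds_iff.1 hev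
  set K := ‖dslope F w w‖ + 1 with hK
  have hK0 : 0 ≤ K := by positivity
  refine ⟨K * (‖w‖ + δ) + 2 * A * (‖w‖ / δ + 1), by positivity, fun z hz => ?_⟩
  have hz0 : 0 < ‖z‖ := norm_pos_iff.2 (wU_ne hz)
  have key : ‖dslope F w z‖ * ‖z‖ ≤ K * (‖w‖ + δ) + 2 * A * (‖w‖ / δ + 1) := by
    have hzw : ‖z‖ ≤ ‖w‖ + ‖z - w‖ := by
      calc ‖z‖ = ‖w + (z - w)‖ := by ring_nf
        _ ≤ _ := norm_add_le _ _
    by_cases h : ‖z - w‖ < δ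
    · have h1 := (hδ2 (by rwa [dist_eq_norm])).le
      have h2 : ‖dslope F w z‖ * ‖z‖ ≤ K * (‖w‖ + δ) := by
        gcongr; linarith
      have : 0 ≤ 2 * A * (‖w‖ / δ + 1) := by positivity
      linarith
    · push Not at h
      have hne : z ≠ w := by rintro rfl; simp at h; linarith
      have hpos : 0 < ‖z - w‖ := lt_of_lt_of_le hδ h
      rw [dslope_of_ne _ hne, slope_def_field, norm_div, div_mul_eq_mul_div,
        div_le_iff₀ hpos]
      have h1 : ‖F z - F w‖ ≤ 2 * A :=
        (norm_sub_le _ _).trans (by linarith [hFA z hz, hFA w hw])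
      have h2 : ‖z‖ ≤ (‖w‖ / δ + 1) * ‖z - w‖ := by
        have : ‖w‖ ≤ ‖w‖ / δ * ‖z - w‖ := by
          rw [div_mul_eq_mul_div, le_div_iff₀ hδ]; gcongr
        linarith
      calc ‖F z - F w‖ * ‖z‖ ≤ 2 * A * ((‖w‖ / δ + 1) * ‖z - w‖) := by gcongr
        _ = 2 * A * (‖w‖ / δ + 1) * ‖z - w‖ := by ring
        _ ≤ _ := by
          have : 0 ≤ K * (‖w‖ + δ) := by positivity
          gcongr; linarith
  rw [norm_div, norm_neg, le_div_iff₀ (by positivity)]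
  calc ‖dslope F w z‖ / ‖z‖ * ‖z‖ ^ (1 + 1) = ‖dslope F w z‖ * ‖z‖ := by field_simp
    _ ≤ _ := key

lemma wT_zero {t s c M : ℝ} {φ : ℂ → ℂ} (hs : 0 < s) (hst : s < t)
    (hc : 0 < c) (hM : 0 ≤ M) (hφ : DifferentiableOn ℂ φ (wU t))
    (hbd : ∀ z ∈ wU t, ‖φ z‖ ≤ M / ‖z‖ ^ (1 + 1)) : wT s c φ 0 = 0 := by
  have h : ∀ᶠ c' in atTop, ‖wT s c φ 0‖ ≤ (2 * ((1 + s) * (M * (2 + s) ^ (1 + 1)))) * c'⁻¹ := by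
    filter_upwards [eventually_gt_atTop 0] with c' hc'
    have := wT_bound (u := 0) hs hst hc hc' le_rfl hM le_rfl hφ hbd
    simp only [Complex.ofReal_zero, zero_mul, Real.exp_zero, one_mul, pow_one, one_div] at this
    refine this.trans (le_of_eq ?_)
    ring
  have l : Tendsto (fun c' : ℝ => (2 * ((1 + s) * (M * (2 + s) ^ (1 + 1)))) * c'⁻¹) atTop (𝓝 0) := by
    have := (tendsto_inv_atTop_zero (𝕜 := ℝ)).const_mul (2 * ((1 + s) * (M * (2 + s) ^ (1 + 1))))
    rwa [mul_zero] at this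
  have := ge_of_tendsto l h
  exact norm_le_zero_iff.1 this

lemma wrepro {t s c A : ℝ} {F : ℂ → ℂ} {w : ℂ} (hs : 0 < s) (hst : s < t)
    (hc : 0 < c) (hA : 0 ≤ A) (hF : DifferentiableOn ℂ F (wU t)) (hFA : ∀ z ∈ wU t, ‖F z‖ ≤ A)
    (hw : c < w.re) :
    IntegrableOn (fun u : ℝ => wT s c (fun z => F z / z) u * Complex.exp (-(u * w))) (Ioi 0) ∧
    ∫ u in Ioi (0:ℝ), wT s c (fun z => F z / z) u * Complex.exp (-(u * w))
      = 2 * Real.pi * Complex.I * F w / w := by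
  have e1 : |(1:ℝ)| = 1 := by norm_num
  have e2 : |(-1:ℝ)| = 1 := by norm_num
  have hwU : w ∈ wU t := by
    have ht : 0 < t := hs.trans hst
    have := abs_nonneg w.im
    change -t * |w.im| < w.re
    nlinarith
  have hφ : ContinuousOn (fun z => F z / z) (wU t) :=
    hF.continuousOn.div continuousOn_id (fun z hz => wU_ne hz)
  have hbd : ∀ z ∈ wU t, ‖F z / z‖ ≤ A / ‖z‖ := fun z hz => by
    rw [norm_div]; gcongr; exact hFA z hz
  have hφ1 : ContinuousOn (fun z : ℂ => 1 / z) (wU t) :=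
    continuousOn_const.div continuousOn_id (fun z hz => wU_ne hz)
  have hbd1 : ∀ z ∈ wU t, ‖1 / z‖ ≤ 1 / ‖z‖ := fun z hz => by simp
  have f1 := wfubini hs hst e1 hc hA hφ hbd hw
  have f2 := wfubini hs hst e2 hc hA hφ hbd hw
  refine ⟨?_, ?_⟩
  · have := f1.1.sub f2.1
    refine this.congr (Eventually.of_forall fun u => ?_)
    simp only [wT, Pi.sub_apply]
    ring
  have h1 : ∫ u in Ioi (0:ℝ), wT s c (fun z => F z / z) u * Complex.exp (-(u * w))
      = wray s 1 c (fun z => F z / z / (w - z)) - wray s (-1) c (fun z => F z / z / (w - z)) := by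
    rw [← f1.2, ← f2.2, ← integral_sub f1.1 f2.1]
    congr 1
    ext u
    simp only [wT]
    ring
  rw [h1]
  obtain ⟨D, hD, hDb⟩ := wdslope_bound hA hwU hF hFA
  have hH : DifferentiableOn ℂ (fun z => -(dslope F w z) / z) (wU t) :=
    (((Complex.differentiableOn_dslope ((wU_open t).mem_nhds hwU)).2 hF).neg).div
      differentiableOn_id (fun z hz => wU_ne hz)
  have split : ∀ σ : ℝ, |σ| = 1 → wray s σ c (fun z => F z / z / (w - z))
      = F w * wray s σ c (fun z => 1 / z / (w - z))
        + wray s σ c (fun z => Complex.exp (0 * z) * (-(dslope F w z) / z)) := by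
    intro σ hσ
    obtain ⟨k, hk, hk2⟩ := wlow (σ := σ) hs hc hw
    have i1 := (wcauchy_int' hs hst hσ hc zero_le_one hφ1 hbd1 hw).const_mul (F w)
    have i2 := wray_int (u := 0) hs hst hσ hc le_rfl hD le_rfl hH hDb
    simp only [Complex.ofReal_zero] at i2
    unfold wray
    rw [← integral_const_mul, ← integral_add i1 i2]
    apply setIntegral_congr_fun measurableSet_Ioi
    intro r hr
    have hr' : 0 < r := hr
    have hz0 := wU_ne (wU_mem (c := c) (r := r) hs hst hσ hc hr'.le)
    have hzw : w - ((c:ℂ) + r * wdir s σ) ≠ 0 := by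
      intro h0
      have h1 := hk2 r hr'.le
      have h4 : 0 < k * (r + c) := by positivity
      rw [h0] at h1
      simp only [Complex.zero_re] at h1
      linarith
    simp only [zero_mul, Complex.exp_zero, one_mul]
    generalize (c:ℂ) + r * wdir s σ = z at hz0 hzw
    have hne : z ≠ w := by rintro rfl; simp at hzw
    have hzw' : z - w ≠ 0 := sub_ne_zero.2 hne
    rw [dslope_of_ne _ hne, slope_def_field]
    rw [← neg_sub z w]
    field_simp
    ring
  rw [split 1 e1, split (-1) e2]
  have hz : wT s c (fun z => -(dslope F w z) / z) 0 = 0 := wT_zero hs hst hc hD hH hDb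
  have hl := wlog_total hs hst hc hw
  unfold wT at hz
  linear_combination hz + F w * hl

lemma wV_convex (s : ℝ) : Convex ℝ (wV s) := by
  intro x hx y hy a b ha hb hab
  simp only [wV, mem_ofPred_eq] at *
  simp only [Complex.add_re, Complex.add_im, Complex.smul_re, Complex.smul_im, smul_eq_mul]
  have h : |a * x.im + b * y.im| ≤ a * |x.im| + b * |y.im| := by
    refine (abs_add_le _ _).trans ?_
    rw [abs_mul, abs_mul, abs_of_nonneg ha, abs_of_nonneg hb]
  rcases eq_or_lt_of_le ha with h' | h'
  · have : b = 1 := by linarith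
    subst this; rw [← h']; simpa using hy
  · have := mul_lt_mul_of_pos_left hx h'
    have := mul_le_mul_of_nonneg_left hy.le hb
    linarith

lemma wV_real {s u : ℝ} (hs : 0 < s) (hu : 0 < u) : (u:ℂ) ∈ wV s := by
  simp only [wV, mem_ofPred_eq, Complex.ofReal_im, Complex.ofReal_re, abs_zero]
  positivity

lemma wK0 {t s c u : ℝ} (hs : 0 < s) (hst : s < t) (hc : 0 < c) (hu : 0 < u) :
    wT s c (fun z => 1 / z) u = 2 * Real.pi * Complex.I := by
  have e1 : |(1:ℝ)| = 1 := by norm_num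
  have e2 : |(-1:ℝ)| = 1 := by norm_num
  have hφ1 : ContinuousOn (fun z : ℂ => 1 / z) (wU t) :=
    continuousOn_const.div continuousOn_id (fun z hz => wU_ne hz)
  have hbd1 : ∀ z ∈ wU t, ‖1 / z‖ ≤ 1 / ‖z‖ := fun z hz => by simp
  have hder : ∀ v ∈ wV s, HasDerivAt (wT s c (fun z => 1 / z)) 0 v := by
    intro v hv
    refine (wT_deriv hs hst hc zero_le_one hφ1 hbd1 hv).congr_deriv ?_
    rw [wT_congr (K := fun _ => 1) hs hst hc
      (fun z hz => by have := wU_ne hz; field_simp)]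
    have hr : ∀ σ : ℝ, |σ| = 1 → wray s σ c (fun z => Complex.exp (v * z) * 1)
        = - Complex.exp (v * c) / v := by
      intro σ hσ
      have hneg := wV_dir hσ hv
      have hne : v * wdir s σ ≠ 0 := by intro h; rw [h] at hneg; simp at hneg
      have h := integral_exp_mul_complex_Ioi hneg 0
      have hv0 := left_ne_zero_of_mul hne
      have hd0 := right_ne_zero_of_mul hne
      unfold wray
      rw [integral_mul_const]
      have : ∀ r : ℝ, Complex.exp (v * ((c:ℂ) + r * wdir s σ)) * 1
          = Complex.exp (v * c) * Complex.exp (v * wdir s σ * r) := by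
        intro r
        rw [← Complex.exp_add]; ring_nf
      simp_rw [this]
      rw [integral_const_mul, h]
      simp only [Complex.ofReal_zero, mul_zero, Complex.exp_zero]
      field_simp
    rw [wT, hr 1 e1, hr (-1) e2, sub_self]
  have hconst : ∀ v : ℝ, 0 < v → wT s c (fun z => 1 / z) v = wT s c (fun z => 1 / z) u := by
    intro v hv
    apply (wV_open s).is_const_of_deriv_eq_zero (wV_convex s).isPreconnected
      (f := wT s c (fun z => 1 / z))
    · intro x hx; exact (hder x hx).differentiableAt.differentiableWithinAt
    · intro x hx; exact (hder x hx).deriv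
    · exact wV_real hs hv
    · exact wV_real hs hu
  have hrep := (wrepro (F := fun _ => 1) (w := ((c + 1 : ℝ) : ℂ)) hs hst hc zero_le_one
    (differentiableOn_const _) (fun z _ => by simp) (by simp)).2
  rw [setIntegral_congr_fun (g := fun v : ℝ => wT s c (fun z => 1 / z) u *
    Complex.exp (-((c + 1 : ℝ) : ℂ) * v)) measurableSet_Ioi
    (fun v hv => by
      simp only [hconst v hv]; congr 2; ring), integral_const_mul,
      integral_exp_mul_complex_Ioi (by simp; linarith)] at hrep
  have hne : ((c + 1 : ℝ) : ℂ) ≠ 0 := by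
    have : c + 1 ≠ 0 := by linarith
    exact_mod_cast this
  simp only [Complex.ofReal_zero, mul_zero, Complex.exp_zero] at hrep
  field_simp at hrep
  linear_combination hrep

lemma wbd_rayN {t s σ c M : ℝ} {φ : ℂ → ℂ} {N : ℕ} (hs : 0 < s) (hst : s < t) (hσ : |σ| = 1)
    (hc : 0 < c) (hM : 0 ≤ M) (hbd : ∀ z ∈ wU t, ‖φ z‖ ≤ M / ‖z‖ ^ (N + 1)) (r : ℝ) (hr : 0 ≤ r) :
    ‖φ ((c:ℂ) + r * wdir s σ)‖ ≤ M * (2 + s) ^ (N + 1) * (1 / c ^ (N + 1)) := by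
  have h := wray_bound (u := 0) hs hst hσ hc le_rfl hM hbd r hr
  simp only [Complex.ofReal_zero, zero_mul, Complex.exp_zero, one_mul, Real.exp_zero] at h
  refine h.trans ?_
  gcongr
  linarith

lemma wKn {t s c : ℝ} (hs : 0 < s) (hst : s < t) (hc : 0 < c) (n : ℕ) :
    ∀ u : ℝ, 0 < u →
    wT s c (fun z => 1 / z ^ (n + 1)) u = 2 * Real.pi * Complex.I * u ^ n / n.factorial := by
  induction n with
  | zero =>
    intro u hu
    simpa using wK0 hs hst hc hu
  | succ n ih =>
    intro u hu
    have e1 : |(1:ℝ)| = 1 := by norm_num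
    have e2 : |(-1:ℝ)| = 1 := by norm_num
    have hφd : DifferentiableOn ℂ (fun z : ℂ => 1 / z ^ (n + 1 + 1)) (wU t) :=
      (differentiableOn_const _).div (differentiableOn_pow _)
        (fun z hz => pow_ne_zero _ (wU_ne hz))
    have hφ := hφd.continuousOn
    have hbd : ∀ z ∈ wU t, ‖1 / z ^ (n + 1 + 1)‖ ≤ 1 / ‖z‖ ^ (n + 1 + 1) := fun z hz => by simp
    have hder : ∀ v : ℝ, 0 < v → HasDerivAt (fun v : ℝ => wT s c (fun z => 1 / z ^ (n + 1 + 1)) v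
        - 2 * Real.pi * Complex.I * v ^ (n + 1) / (n + 1).factorial) 0 v := by
      intro v hv
      have hvV := wV_real hs hv
      have d1 : HasDerivAt (wT s c (fun z => 1 / z ^ (n + 1 + 1)))
          (wT s c (fun z => z * (1 / z ^ (n + 1 + 1))) v) v :=
        (wray_deriv hs hst e1 hc hφ (wbd_rayN hs hst e1 hc zero_le_one hbd) (wV_dir e1 hvV)).sub
          (wray_deriv hs hst e2 hc hφ (wbd_rayN hs hst e2 hc zero_le_one hbd) (wV_dir e2 hvV))
      rw [wT_congr (K := fun z => 1 / z ^ (n + 1)) hs hst hc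
        (fun z hz => by have := wU_ne hz; field_simp; try ring), ih v hv] at d1
      have d2 : HasDerivAt (fun v : ℂ => 2 * Real.pi * Complex.I * v ^ (n + 1) / (n + 1).factorial)
          (2 * Real.pi * Complex.I * (((n + 1 : ℕ) : ℂ) * (v:ℂ) ^ n) / (n + 1).factorial) (v:ℂ) := by
        have := ((hasDerivAt_pow (n + 1) (v:ℂ)).const_mul
          (2 * Real.pi * Complex.I : ℂ)).div_const ((n + 1).factorial : ℂ)
        simpa using this
      refine ((d1.fun_sub d2).comp_ofReal).congr_deriv ?_
      rw [Nat.factorial_succ]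
      have : ((n + 1 : ℕ) : ℂ) ≠ 0 := by exact_mod_cast Nat.succ_ne_zero n
      have : (n.factorial : ℂ) ≠ 0 := by exact_mod_cast n.factorial_ne_zero
      push_cast at *
      field_simp
      ring
    set h : ℝ → ℂ := fun v : ℝ => wT s c (fun z => 1 / z ^ (n + 1 + 1)) v
        - 2 * Real.pi * Complex.I * v ^ (n + 1) / (n + 1).factorial with hh
    have hconst : ∀ v : ℝ, 0 < v → h v = h u := by
      intro v hv
      apply isOpen_Ioi.is_const_of_deriv_eq_zero (isPreconnected_Ioi (a := (0:ℝ))) (f := h)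
      · intro x hx; exact (hder x hx).differentiableAt.differentiableWithinAt
      · intro x hx; exact (hder x hx).deriv
      · exact hv
      · exact hu
    have hlim : Tendsto h (𝓝[>] 0) (𝓝 0) := by
      have l2 : Tendsto (fun v : ℝ => 2 * Real.pi * Complex.I * (v:ℂ) ^ (n + 1) /
          (n + 1).factorial) (𝓝[>] 0) (𝓝 0) := by
        have : Continuous (fun v : ℝ => 2 * Real.pi * Complex.I * (v:ℂ) ^ (n + 1) /
          (n + 1).factorial) := by fun_prop
        have := this.tendsto 0
        simp only [Complex.ofReal_zero, ne_eq, Nat.succ_ne_zero, not_false_eq_true, zero_pow,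
          mul_zero, zero_div] at this
        exact this.mono_left nhdsWithin_le_nhds
      have l1 : Tendsto (fun v : ℝ => wT s c (fun z => 1 / z ^ (n + 1 + 1)) v) (𝓝[>] 0) (𝓝 0) := by
        have l3 : Tendsto (fun v : ℝ => 2 * ((1 + s) * (Real.exp 1 * 1 * (2 + s) ^ (n + 1 + 1)
            * v ^ (n + 1)))) (𝓝[>] 0) (𝓝 0) := by
          have : Continuous (fun v : ℝ => 2 * ((1 + s) * (Real.exp 1 * 1 * (2 + s) ^ (n + 1 + 1)
            * v ^ (n + 1)))) := by fun_prop
          have := this.tendsto 0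
          simp only [ne_eq, Nat.succ_ne_zero, not_false_eq_true, zero_pow, mul_zero] at this
          exact this.mono_left nhdsWithin_le_nhds
        refine squeeze_zero_norm' ?_ l3
        filter_upwards [self_mem_nhdsWithin] with v hv
        have hv' : 0 < v := hv
        have := wT_bound (c' := 1 / v) hs hst hc (by positivity) hv'.le zero_le_one
          (by omega) hφd hbd
        rw [mul_one_div_cancel hv'.ne'] at this
        simpa using this
      have := l1.sub l2
      rw [sub_zero] at this
      exact this
    have hlim2 : Tendsto h (𝓝[>] 0) (𝓝 (h u)) := by
      apply tendsto_const_nhds.congr'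
      filter_upwards [self_mem_nhdsWithin] with v hv
      exact (hconst v hv).symm
    have := tendsto_nhds_unique hlim2 hlim
    exact sub_eq_zero.1 this

lemma wT_add {t s c M M' : ℝ} {φ ψ : ℂ → ℂ} {u : ℂ} {m n : ℕ} (k : ℂ) (hs : 0 < s) (hst : s < t)
    (hc : 0 < c) (hM : 0 ≤ M) (hM' : 0 ≤ M') (hφ : ContinuousOn φ (wU t))
    (hψ : ContinuousOn ψ (wU t)) (hbd : ∀ z ∈ wU t, ‖φ z‖ ≤ M / ‖z‖ ^ (m + 1))
    (hbd' : ∀ z ∈ wU t, ‖ψ z‖ ≤ M' / ‖z‖ ^ (n + 1)) (hu : u ∈ wV s) :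
    wT s c (fun z => φ z + k * ψ z) u = wT s c φ u + k * wT s c ψ u := by
  have h : ∀ σ : ℝ, |σ| = 1 →
      wray s σ c (fun z => Complex.exp (u * z) * (φ z + k * ψ z)) =
      wray s σ c (fun z => Complex.exp (u * z) * φ z)
      + k * wray s σ c (fun z => Complex.exp (u * z) * ψ z) := by
    intro σ hσ
    have i1 := wray_exp_int hs hst hσ hc hφ (wbd_rayN hs hst hσ hc hM hbd) (wV_dir hσ hu)
    have i2 := (wray_exp_int hs hst hσ hc hψ (wbd_rayN hs hst hσ hc hM' hbd')
      (wV_dir hσ hu)).const_mul k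
    unfold wray
    rw [← integral_const_mul, ← integral_add i1 i2]
    congr 1
    ext r
    ring
  unfold wT
  rw [h 1 (by norm_num), h (-1) (by norm_num)]
  ring

/-- remainder -/
def wR (F : ℂ → ℂ) (a : ℕ → ℂ) (N : ℕ) (z : ℂ) : ℂ :=
  F z - ∑ n ∈ Finset.range N, a n * (z⁻¹) ^ n

lemma wR_diff {t : ℝ} {F : ℂ → ℂ} {a : ℕ → ℂ} (hF : DifferentiableOn ℂ F (wU t)) (N : ℕ) :
    DifferentiableOn ℂ (fun z => wR F a N z / z) (wU t) := by
  apply DifferentiableOn.div _ differentiableOn_id (fun z hz => wU_ne hz)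
  unfold wR
  apply hF.sub
  apply DifferentiableOn.fun_sum
  intro i _
  apply DifferentiableOn.const_mul
  exact (differentiableOn_id.inv (fun z hz => wU_ne hz)).pow i

lemma wR_bd {t A B : ℝ} {F : ℂ → ℂ} {a : ℕ → ℂ}
    (hFa : ∀ N, ∀ z ∈ wU t, ‖wR F a N z‖ ≤ A * B ^ N * N.factorial / ‖z‖ ^ N) (N : ℕ) :
    ∀ z ∈ wU t, ‖wR F a N z / z‖ ≤ (A * B ^ N * N.factorial) / ‖z‖ ^ (N + 1) := by
  intro z hz
  have hz0 : 0 < ‖z‖ := norm_pos_iff.2 (wU_ne hz)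
  rw [norm_div, pow_succ, ← div_div]
  gcongr
  exact hFa N z hz

lemma wstep {t s c A B u : ℝ} {F : ℂ → ℂ} {a : ℕ → ℂ} (hs : 0 < s) (hst : s < t)
    (hc : 0 < c) (hA : 0 < A) (hB : 0 < B) (hF : DifferentiableOn ℂ F (wU t))
    (hFa : ∀ N, ∀ z ∈ wU t, ‖wR F a N z‖ ≤ A * B ^ N * N.factorial / ‖z‖ ^ N)
    (hu : 0 < u) (N : ℕ) :
    wT s c (fun z => F z / z) u = wT s c (fun z => wR F a N z / z) u
      + 2 * Real.pi * Complex.I * ∑ n ∈ Finset.range N, a n / (n.factorial : ℂ) * (u:ℂ) ^ n := by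
  induction N with
  | zero => simp [wR]
  | succ N ih =>
    rw [ih, Finset.sum_range_succ]
    have h1 : wT s c (fun z => wR F a N z / z) u
      = wT s c (fun z => wR F a (N + 1) z / z + a N * (1 / z ^ (N + 1))) u := by
      apply wT_congr hs hst hc
      intro z hz
      have hz0 := wU_ne hz
      unfold wR
      rw [Finset.sum_range_succ]
      have e : 1 / z ^ (N + 1) = z⁻¹ ^ N / z := by rw [inv_pow]; field_simp; try ring
      rw [e]
      ring
    rw [h1, wT_add (a N) hs hst hc (by positivity) zero_le_one (wR_diff hF (N+1)).continuousOn ?_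
      (wR_bd hFa (N + 1)) (n := N) (fun z hz => by simp) (wV_real hs hu), wKn hs hst hc N u hu]
    · ring
    · exact continuousOn_const.div (continuousOn_pow _) (fun z hz => pow_ne_zero _ (wU_ne hz))

lemma wtail {t s c A B u : ℝ} {F : ℂ → ℂ} {a : ℕ → ℂ} (hs : 0 < s) (hst : s < t)
    (hc : 0 < c) (hA : 0 < A) (hB : 0 < B) (hF : DifferentiableOn ℂ F (wU t))
    (hFa : ∀ N, ∀ z ∈ wU t, ‖wR F a N z‖ ≤ A * B ^ N * N.factorial / ‖z‖ ^ N)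
    (hu : 0 < u) (hu2 : Real.exp 1 * B * (2 + s) * u < 1) :
    Tendsto (fun N => wT s c (fun z => wR F a N z / z) u) atTop (𝓝 0) := by
  have l : Tendsto (fun N : ℕ => 2 * ((1 + s) * (A * (2 + s))) *
      (Real.exp 1 * B * (2 + s) * u) ^ N) atTop (𝓝 0) := by
    have := (tendsto_pow_atTop_nhds_zero_of_lt_one (by positivity) hu2).const_mul
      (2 * ((1 + s) * (A * (2 + s))))
    rwa [mul_zero] at this
  refine squeeze_zero_norm' ?_ l
  filter_upwards [eventually_ge_atTop 1] with N hN
  have hN0 : (0:ℝ) < N := by exact_mod_cast hN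
  refine (wT_bound (c' := N / u) hs hst hc (by positivity) hu.le (by positivity) hN
    (wR_diff hF N) (wR_bd hFa N)).trans ?_
  have h1 : u * (N / u) = N * 1 := by field_simp
  rw [h1, Real.exp_nat_mul]
  have h2 : (N.factorial : ℝ) ≤ (N:ℝ) ^ N := by exact_mod_cast Nat.factorial_le_pow N
  have h3 : (N.factorial : ℝ) * (1 / (N / u) ^ N) ≤ u ^ N := by
    rw [div_pow, one_div_div, ← mul_div_assoc, div_le_iff₀ (by positivity), mul_comm]
    gcongr
  calc 2 * ((1 + s) * (Real.exp 1 ^ N * (A * B ^ N * N.factorial) * (2 + s) ^ (N + 1)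
        * (1 / (N / u) ^ N)))
      = 2 * ((1 + s) * (A * (2 + s))) * (Real.exp 1 ^ N * B ^ N * (2 + s) ^ N) *
        (N.factorial * (1 / (N / u) ^ N)) := by ring
    _ ≤ 2 * ((1 + s) * (A * (2 + s))) * (Real.exp 1 ^ N * B ^ N * (2 + s) ^ N) * u ^ N := by
        gcongr
    _ = _ := by rw [mul_pow, mul_pow, mul_pow]; ring

lemma wU_real {t x : ℝ} (hx : 0 < x) : (x:ℂ) ∈ wU t := by
  simp [wU, hx]

lemma wcoef {t A B : ℝ} {F : ℂ → ℂ} {a : ℕ → ℂ}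
    (hFa : ∀ N, ∀ z ∈ wU t, ‖wR F a N z‖ ≤ A * B ^ N * N.factorial / ‖z‖ ^ N) (N : ℕ) :
    ‖a N‖ ≤ A * B ^ N * N.factorial := by
  have l : Tendsto (fun x : ℝ => A * B ^ N * N.factorial +
      A * B ^ (N + 1) * (N + 1).factorial * x⁻¹) atTop (𝓝 (A * B ^ N * N.factorial)) := by
    have := ((tendsto_inv_atTop_zero (𝕜 := ℝ)).const_mul
      (A * B ^ (N + 1) * (N + 1).factorial)).const_add (A * B ^ N * N.factorial)
    rwa [mul_zero, add_zero] at this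
  refine ge_of_tendsto l ?_
  filter_upwards [eventually_gt_atTop 0] with x hx
  have h1 := hFa N x (wU_real hx)
  have h2 := hFa (N + 1) x (wU_real hx)
  have h3 : wR F a N x - wR F a (N + 1) x = a N * (x:ℂ)⁻¹ ^ N := by
    unfold wR; rw [Finset.sum_range_succ]; ring
  have h4 := norm_sub_le (wR F a N x) (wR F a (N + 1) x)
  rw [h3, norm_mul, norm_pow, norm_inv] at h4
  have hnx : ‖(x:ℂ)‖ = x := by simp [hx.le]
  rw [hnx] at h1 h2 h4
  have h5 : ‖a N‖ = ‖a N‖ * x⁻¹ ^ N * x ^ N := by rw [inv_pow]; field_simp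
  rw [h5]
  calc ‖a N‖ * x⁻¹ ^ N * x ^ N ≤ (A * B ^ N * N.factorial / x ^ N +
        A * B ^ (N + 1) * (N + 1).factorial / x ^ (N + 1)) * x ^ N := by gcongr; linarith
    _ = _ := by field_simp; ring

lemma wsummable {A B : ℝ} {a : ℕ → ℂ} (hA : 0 < A) (hB : 0 < B)
    (ha : ∀ N : ℕ, ‖a N‖ ≤ A * B ^ N * N.factorial) {r : ℝ} (hr0 : 0 ≤ r) (hr : r < 1 / B) :
    Summable (fun n => A * (B * r) ^ n) ∧
    ∀ u : ℂ, ‖u‖ ≤ r → ∀ n, ‖a n / (n.factorial : ℂ) * u ^ n‖ ≤ A * (B * r) ^ n := by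
  refine ⟨(summable_geometric_of_lt_one (by positivity) ?_).mul_left A, fun u hu n => ?_⟩
  · rw [lt_div_iff₀ hB] at hr; linarith
  · have hn : (0:ℝ) < n.factorial := by exact_mod_cast n.factorial_pos
    rw [norm_mul, norm_div, norm_pow, Complex.norm_natCast, mul_pow, ← mul_assoc]
    gcongr
    rw [div_le_iff₀ hn]
    exact ha n

/-- Borel series -/
def wS (a : ℕ → ℂ) (u : ℂ) : ℂ := ∑' n : ℕ, (a n / (n.factorial : ℂ)) * u ^ n

lemma wS_analytic {A B : ℝ} {a : ℕ → ℂ} (hA : 0 < A) (hB : 0 < B)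
    (ha : ∀ N : ℕ, ‖a N‖ ≤ A * B ^ N * N.factorial) :
    AnalyticOnNhd ℂ (wS a) (Metric.ball 0 (1 / B)) := by
  apply DifferentiableOn.analyticOnNhd _ Metric.isOpen_ball
  intro u hu
  rw [mem_ball_zero_iff] at hu
  obtain ⟨r, hr1, hr2⟩ := exists_between hu
  obtain ⟨h1, h2⟩ := wsummable hA hB ha ((norm_nonneg u).trans hr1.le) hr2
  have h := Complex.differentiableOn_tsum_of_summable_norm (U := Metric.ball (0:ℂ) r)
    (F := fun n u => a n / (n.factorial : ℂ) * u ^ n) h1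
    (fun n => by fun_prop) Metric.isOpen_ball
    (fun n w hw => h2 w (mem_ball_zero_iff.1 hw).le n)
  exact (h.differentiableAt (Metric.isOpen_ball.mem_nhds
    (mem_ball_zero_iff.2 hr1))).differentiableWithinAt

lemma wsmall {t s c A B u : ℝ} {F : ℂ → ℂ} {a : ℕ → ℂ} (hs : 0 < s) (hst : s < t)
    (hc : 0 < c) (hA : 0 < A) (hB : 0 < B) (hF : DifferentiableOn ℂ F (wU t))
    (hFa : ∀ N, ∀ z ∈ wU t, ‖wR F a N z‖ ≤ A * B ^ N * N.factorial / ‖z‖ ^ N)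
    (hu : 0 < u) (hu2 : Real.exp 1 * B * (2 + s) * u < 1) (hu3 : u < 1 / B) :
    wT s c (fun z => F z / z) u = 2 * Real.pi * Complex.I * wS a u := by
  obtain ⟨h1, h2⟩ := wsummable hA hB (wcoef hFa) hu.le hu3
  have hsum : Summable (fun n => a n / (n.factorial : ℂ) * (u:ℂ) ^ n) :=
    Summable.of_norm_bounded h1 (h2 u (by simp [abs_of_pos hu]))
  have l1 := (wtail hs hst hc hA hB hF hFa hu hu2).add
    (hsum.hasSum.tendsto_sum_nat.const_mul (2 * Real.pi * Complex.I))
  rw [zero_add] at l1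
  refine tendsto_nhds_unique (tendsto_const_nhds.congr fun N => ?_) l1
  exact wstep hs hst hc hA hB hF hFa hu N

lemma wident {V : Set ℂ} {p q : ℂ → ℂ} {η : ℝ} (hV : Convex ℝ V)
    (hη : 0 < η) (hVη : ((η / 2 : ℝ) : ℂ) ∈ V) (hp : AnalyticOnNhd ℂ p V)
    (hq : AnalyticOnNhd ℂ q V) (h : ∀ u : ℝ, 0 < u → u < η → p u = q u) : EqOn p q V := by
  apply hp.eqOn_of_preconnected_of_frequently_eq hq hV.isPreconnected hVη
  have hl : Tendsto (fun x : ℝ => (x:ℂ)) (𝓝[≠] (η / 2)) (𝓝[≠] ((η / 2 : ℝ) : ℂ)) := by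
    apply tendsto_nhdsWithin_of_tendsto_nhds_of_eventually_within
    · exact (Complex.continuous_ofReal.tendsto _).mono_left nhdsWithin_le_nhds
    · filter_upwards [self_mem_nhdsWithin] with x hx
      exact fun h => hx (Complex.ofReal_injective h)
  apply hl.frequently
  apply Eventually.frequently
  have : Ioo 0 η ∈ 𝓝 (η / 2) := Ioo_mem_nhds (by linarith) (by linarith)
  filter_upwards [mem_nhdsWithin_of_mem_nhds this] with x hx
  exact h x hx.1 hx.2
lemma wsector_inv {ε : ℝ} (hε : 0 < ε) (hε' : ε < Real.pi / 2) {z : ℂ}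
    (hz : z ∈ wU (Real.tan ε)) : z⁻¹ ≠ 0 ∧ |Complex.arg z⁻¹| < Real.pi / 2 + ε := by
  have hz0 := wU_ne hz
  refine ⟨inv_ne_zero hz0, ?_⟩
  have habs : |Complex.arg z⁻¹| = |Complex.arg z| := Complex.abs_arg_inv z
  rw [habs]
  by_contra! hcon
  have hpi := Complex.abs_arg_le_pi z
  have hn : 0 < ‖z‖ := norm_pos_iff.2 hz0
  change -Real.tan ε * |z.im| < z.re at hz
  have h1 : z.re = ‖z‖ * Real.cos |Complex.arg z| := by
    rw [Real.cos_abs, Complex.norm_mul_cos_arg]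
  have h2 : |z.im| = ‖z‖ * Real.sin |Complex.arg z| := by
    rw [← Real.abs_sin_eq_sin_abs_of_abs_le_pi hpi, ← Complex.norm_mul_sin_arg z, abs_mul,
      abs_of_pos hn]
  set θ := |Complex.arg z| with hθ
  have hcos : 0 < Real.cos ε := Real.cos_pos_of_mem_Ioo ⟨by linarith, hε'⟩
  have h3 : 0 ≤ Real.sin (θ - (Real.pi / 2 + ε)) :=
    Real.sin_nonneg_of_nonneg_of_le_pi (by linarith) (by linarith)
  have h4 : Real.sin (θ - (Real.pi / 2 + ε)) =
      -(Real.cos θ * Real.cos ε + Real.sin θ * Real.sin ε) := by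
    rw [Real.sin_sub, Real.sin_add, Real.cos_add]
    simp
    ring
  rw [h1, h2, Real.tan_eq_sin_div_cos] at hz
  have h5 : -(Real.sin ε / Real.cos ε) * (‖z‖ * Real.sin θ) =
    ‖z‖ * (-(Real.sin ε * Real.sin θ) / Real.cos ε) := by ring
  rw [h5] at hz
  have h6 := lt_of_mul_lt_mul_left hz hn.le
  rw [div_lt_iff₀ hcos] at h6
  linarith

lemma wsector_V {ε : ℝ} (hε' : ε < Real.pi / 2) {u : ℂ} (hu0 : u ≠ 0)
    (hu : |Complex.arg u| < ε) : u ∈ wV (Real.tan ε) := by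
  have hn : 0 < ‖u‖ := norm_pos_iff.2 hu0
  have h1 : u.re = ‖u‖ * Real.cos |Complex.arg u| := by
    rw [Real.cos_abs, Complex.norm_mul_cos_arg]
  have h2 : |u.im| = ‖u‖ * Real.sin |Complex.arg u| := by
    rw [← Real.abs_sin_eq_sin_abs_of_abs_le_pi (Complex.abs_arg_le_pi u),
      ← Complex.norm_mul_sin_arg u, abs_mul, abs_of_pos hn]
  have h0 := abs_nonneg (Complex.arg u)
  set θ := |Complex.arg u| with hθ
  have hcos : 0 < Real.cos θ := Real.cos_pos_of_mem_Ioo ⟨by linarith, by linarith⟩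
  change |u.im| < Real.tan ε * u.re
  have h3 : Real.tan θ < Real.tan ε := Real.tan_lt_tan_of_nonneg_of_lt_pi_div_two h0 hε' hu
  rw [h1, h2]
  rw [Real.tan_eq_sin_div_cos, div_lt_iff₀ hcos] at h3
  nlinarith

/-- slope used at `u` -/
def wslope (t : ℝ) (u : ℂ) : ℝ := (|u.im| / u.re + t) / 2

lemma wslope_prop {t : ℝ} (ht : 0 < t) {u : ℂ} (hu : u ∈ wV t) :
    0 < wslope t u ∧ wslope t u < t ∧ u ∈ wV (wslope t u) := by
  change |u.im| < t * u.re at hu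
  have h0 := abs_nonneg u.im
  have hre : 0 < u.re := by
    by_contra! h
    nlinarith
  have h1 : |u.im| / u.re < t := by rwa [div_lt_iff₀ hre]
  have h2 : 0 ≤ |u.im| / u.re := by positivity
  refine ⟨by unfold wslope; linarith, by unfold wslope; linarith, ?_⟩
  change |u.im| < wslope t u * u.re
  rw [← div_lt_iff₀ hre]
  unfold wslope; linarith

open Classical in
/-- the continued Borel transform -/
def wW (t c B : ℝ) (F : ℂ → ℂ) (a : ℕ → ℂ) (u : ℂ) : ℂ :=
  if ‖u‖ < 1 / B then wS a u
  else (2 * Real.pi * Complex.I)⁻¹ * wT (wslope t u) c (fun z => F z / z) u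

lemma wconst_ne : (2 * Real.pi * Complex.I : ℂ) ≠ 0 := by
  simp [Real.pi_ne_zero]

lemma wetaex {B s s' : ℝ} (hB : 0 < B) (hs : 0 < s) (hs' : 0 < s') :
    ∃ η : ℝ, 0 < η ∧ ∀ u : ℝ, 0 < u → u < η → Real.exp 1 * B * (2 + s) * u < 1 ∧
      Real.exp 1 * B * (2 + s') * u < 1 ∧ u < 1 / B := by
  refine ⟨1 / (Real.exp 1 * B * (2 + s + s')), by positivity, fun u hu hu2 => ?_⟩
  rw [lt_div_iff₀ (by positivity)] at hu2
  have he : 1 ≤ Real.exp 1 := Real.one_le_exp zero_le_one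
  have h0 : 0 < Real.exp 1 * B * u := by positivity
  refine ⟨by nlinarith, by nlinarith, ?_⟩
  rw [lt_div_iff₀ hB]
  have : 0 < B * u := by positivity
  have h1 : B * u ≤ Real.exp 1 * (B * u) := by nlinarith
  nlinarith

section
variable {t c A B : ℝ} {F : ℂ → ℂ} {a : ℕ → ℂ}

lemma wT_an {s : ℝ} (hs : 0 < s) (hst : s < t)
    (hc : 0 < c) (hA : 0 < A) (hF : DifferentiableOn ℂ F (wU t))
    (hFa : ∀ N, ∀ z ∈ wU t, ‖wR F a N z‖ ≤ A * B ^ N * N.factorial / ‖z‖ ^ N) :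
    AnalyticOnNhd ℂ (wT s c (fun z => F z / z)) (wV s) := by
  refine wT_analytic (M := A) hs hst hc hA.le
    (hF.continuousOn.div continuousOn_id (fun z hz => wU_ne hz)) (fun z hz => ?_)
  have := hFa 0 z hz
  rw [norm_div]
  gcongr
  simpa [wR] using this

lemma wTT {s s' : ℝ} {u : ℂ} (hs : 0 < s) (hst : s < t) (hs' : 0 < s') (hst' : s' < t)
    (hc : 0 < c) (hA : 0 < A) (hB : 0 < B) (hF : DifferentiableOn ℂ F (wU t))
    (hFa : ∀ N, ∀ z ∈ wU t, ‖wR F a N z‖ ≤ A * B ^ N * N.factorial / ‖z‖ ^ N)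
    (hu : u ∈ wV s) (hu' : u ∈ wV s') :
    wT s c (fun z => F z / z) u = wT s' c (fun z => F z / z) u := by
  obtain ⟨η, hη, hη2⟩ := wetaex hB hs hs'
  have hη3 : 0 < η / 2 := by linarith
  refine wident (V := wV s ∩ wV s') (η := η) ((wV_convex s).inter (wV_convex s')) hη
    ⟨wV_real hs hη3, wV_real hs' hη3⟩
    ((wT_an hs hst hc hA hF hFa).mono inter_subset_left)
    ((wT_an hs' hst' hc hA hF hFa).mono inter_subset_right) (fun v hv hv2 => ?_) ⟨hu, hu'⟩
  obtain ⟨e1, e2, e3⟩ := hη2 v hv hv2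
  rw [wsmall hs hst hc hA hB hF hFa hv e1 e3, wsmall hs' hst' hc hA hB hF hFa hv e2 e3]

lemma wTS {s : ℝ} {u : ℂ} (hs : 0 < s) (hst : s < t)
    (hc : 0 < c) (hA : 0 < A) (hB : 0 < B) (hF : DifferentiableOn ℂ F (wU t))
    (hFa : ∀ N, ∀ z ∈ wU t, ‖wR F a N z‖ ≤ A * B ^ N * N.factorial / ‖z‖ ^ N)
    (hu : u ∈ wV s) (hu' : ‖u‖ < 1 / B) :
    wT s c (fun z => F z / z) u = 2 * Real.pi * Complex.I * wS a u := by
  obtain ⟨η, hη, hη2⟩ := wetaex hB hs hs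
  have hη3 : 0 < η / 2 := by linarith
  refine wident (V := wV s ∩ Metric.ball 0 (1 / B)) (η := η)
    (q := fun u => 2 * Real.pi * Complex.I * wS a u)
    ((wV_convex s).inter (convex_ball _ _)) hη
    ⟨wV_real hs hη3, ?_⟩
    ((wT_an hs hst hc hA hF hFa).mono inter_subset_left)
    ((analyticOnNhd_const.mul (wS_analytic hA hB (wcoef hFa))).mono inter_subset_right)
    (fun v hv hv2 => ?_) ⟨hu, mem_ball_zero_iff.2 hu'⟩
  · rw [mem_ball_zero_iff, Complex.norm_real, Real.norm_of_nonneg hη3.le]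
    exact (hη2 (η / 2) hη3 (by linarith)).2.2
  · obtain ⟨e1, e2, e3⟩ := hη2 v hv hv2
    exact wsmall hs hst hc hA hB hF hFa hv e1 e3

lemma wW_eq {s : ℝ} {u : ℂ} (hs : 0 < s) (hst : s < t)
    (hc : 0 < c) (hA : 0 < A) (hB : 0 < B) (hF : DifferentiableOn ℂ F (wU t))
    (hFa : ∀ N, ∀ z ∈ wU t, ‖wR F a N z‖ ≤ A * B ^ N * N.factorial / ‖z‖ ^ N)
    (hu : u ∈ wV s) :
    wW t c B F a u = (2 * Real.pi * Complex.I)⁻¹ * wT s c (fun z => F z / z) u := by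
  unfold wW
  split_ifs with h
  · rw [wTS hs hst hc hA hB hF hFa hu h, inv_mul_cancel_left₀ wconst_ne]
  · have ht := hs.trans hst
    have hut : u ∈ wV t := by
      change |u.im| < s * u.re at hu
      change |u.im| < t * u.re
      have h0 := abs_nonneg u.im
      have hre : 0 < u.re := by
        by_contra! h
        nlinarith
      nlinarith
    obtain ⟨p1, p2, p3⟩ := wslope_prop ht hut
    rw [wTT hs hst p1 p2 hc hA hB hF hFa hu p3]

lemma wW_an (ht : 0 < t) (hc : 0 < c) (hA : 0 < A) (hB : 0 < B)
    (hF : DifferentiableOn ℂ F (wU t))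
    (hFa : ∀ N, ∀ z ∈ wU t, ‖wR F a N z‖ ≤ A * B ^ N * N.factorial / ‖z‖ ^ N) :
    (∀ u : ℂ, ‖u‖ < 1 / B → AnalyticAt ℂ (wW t c B F a) u) ∧
    (∀ u ∈ wV t, AnalyticAt ℂ (wW t c B F a) u) := by
  constructor
  · intro u hu
    have hm := mem_ball_zero_iff.2 hu
    refine (wS_analytic hA hB (wcoef hFa) u hm).congr ?_
    filter_upwards [Metric.isOpen_ball.mem_nhds hm] with v hv
    rw [wW, if_pos (mem_ball_zero_iff.1 hv)]
  · intro u hu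
    obtain ⟨p1, p2, p3⟩ := wslope_prop ht hu
    have h : AnalyticAt ℂ (fun v => (2 * Real.pi * Complex.I : ℂ)⁻¹ *
        wT (wslope t u) c (fun z => F z / z) v) u :=
      analyticAt_const.mul (wT_an p1 p2 hc hA hF hFa u p3)
    refine h.congr ?_
    filter_upwards [(wV_open _).mem_nhds p3] with v hv
    exact (wW_eq p1 p2 hc hA hB hF hFa hv).symm

end

end WN

/-- **Watson–Nevanlinna theorem**: a function analytic in a sector of opening
`π + 2ε` with a strong asymptotic series has a Borel transform that continues
analytically to the sector `|arg u| < ε`, and the Laplace–Borel integral recovers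
`f(g)` for all complex `g` with `0 < |g| < 1/B` and `|arg g| < ε`. -/
theorem watson_nevanlinna
    (ε : ℝ) (hε : 0 < ε) (hε' : ε < Real.pi / 2)
    (f : ℂ → ℂ) (a : ℕ → ℂ)
    (hf : AnalyticOnNhd ℂ f {g : ℂ | g ≠ 0 ∧ |Complex.arg g| < Real.pi / 2 + ε})
    (A B : ℝ) (hA : 0 < A) (hB : 0 < B)
    (hfa : ∀ N : ℕ, ∀ g ∈ {g : ℂ | g ≠ 0 ∧ |Complex.arg g| < Real.pi / 2 + ε},
      ‖f g - ∑ n ∈ Finset.range N, a n * g ^ n‖ ≤ A * B ^ N * N.factorial * ‖g‖ ^ N) :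
    ∃ W : ℂ → ℂ,
      AnalyticOnNhd ℂ W
        ({u : ℂ | ‖u‖ < 1 / B} ∪ {u : ℂ | u ≠ 0 ∧ |Complex.arg u| < ε}) ∧
      (∀ u : ℂ, ‖u‖ < 1 / B → W u = ∑' n : ℕ, (a n / (n.factorial : ℂ)) * u ^ n) ∧
      ∀ g : ℂ, 0 < ‖g‖ → ‖g‖ < 1 / B → |Complex.arg g| < ε →
        IntegrableOn (fun u : ℝ => W u * Complex.exp (-((u : ℂ) / g))) (Set.Ioi 0) ∧
        f g = (1 / g) * ∫ u in Set.Ioi (0 : ℝ), W u * Complex.exp (-((u : ℂ) / g)) := by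
  have ht : 0 < Real.tan ε := Real.tan_pos_of_pos_of_lt_pi_div_two hε hε'
  set t := Real.tan ε with htdef
  have hc : 0 < B / (1 + t) := by positivity
  set c := B / (1 + t) with hcdef
  have hSo : ∀ z ∈ wU t, z⁻¹ ∈ {g : ℂ | g ≠ 0 ∧ |Complex.arg g| < Real.pi / 2 + ε} :=
    fun z hz => wsector_inv hε hε' hz
  have hF : DifferentiableOn ℂ (fun z => f z⁻¹) (wU t) := by
    intro z hz
    have h1 := (hf z⁻¹ (hSo z hz)).differentiableAt
    exact (h1.comp z (differentiableAt_inv (wU_ne hz))).differentiableWithinAt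
  have hFa : ∀ N, ∀ z ∈ wU t, ‖wR (fun z => f z⁻¹) a N z‖
      ≤ A * B ^ N * N.factorial / ‖z‖ ^ N := by
    intro N z hz
    have h := hfa N z⁻¹ (hSo z hz)
    rw [norm_inv, inv_pow, ← div_eq_mul_inv] at h
    exact h
  have hFA : ∀ z ∈ wU t, ‖f z⁻¹‖ ≤ A := by
    intro z hz
    simpa [wR] using hFa 0 z hz
  obtain ⟨an1, an2⟩ := wW_an ht hc hA hB hF hFa
  refine ⟨wW t c B (fun z => f z⁻¹) a, ?_, ?_, ?_⟩
  · rintro u (hu | hu)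
    · exact an1 u hu
    · exact an2 u (wsector_V hε' hu.1 hu.2)
  · intro u hu
    rw [wW, if_pos hu, wS]
  · intro g hg0 hgB hg
    have hgne : g ≠ 0 := norm_pos_iff.1 hg0
    have hwV : g⁻¹ ∈ wV t := by
      apply wsector_V hε' (inv_ne_zero hgne)
      rwa [Complex.abs_arg_inv]
    have hcw : c < (g⁻¹).re := by
      change |(g⁻¹).im| < t * (g⁻¹).re at hwV
      have h1 := Complex.norm_le_abs_re_add_abs_im g⁻¹
      have h0 := abs_nonneg (g⁻¹).im
      have hre : 0 < (g⁻¹).re := by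
        by_contra! h
        nlinarith
      rw [abs_of_pos hre, norm_inv] at h1
      have h2 : B < ‖g‖⁻¹ := by
        rw [lt_inv_comm₀ hB hg0]; simpa using hgB
      rw [hcdef, div_lt_iff₀ (by positivity)]
      linarith
    have h2 : 0 < t / 2 := by linarith
    have h3 : t / 2 < t := by linarith
    obtain ⟨r1, r2⟩ := wrepro h2 h3 hc hA.le hF hFA hcw
    have e : Set.EqOn (fun u : ℝ => (2 * Real.pi * Complex.I : ℂ)⁻¹ *
        (wT (t / 2) c (fun z => f z⁻¹ / z) u * Complex.exp (-(u * g⁻¹))))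
        (fun u : ℝ => wW t c B (fun z => f z⁻¹) a u * Complex.exp (-((u : ℂ) / g)))
        (Set.Ioi 0) := by
      intro u hu
      simp only
      rw [wW_eq h2 h3 hc hA hB hF hFa (wV_real h2 hu), div_eq_mul_inv (u:ℂ) g]
      ring
    refine ⟨(integrableOn_congr_fun e measurableSet_Ioi).1 (r1.const_mul _), ?_⟩
    rw [← setIntegral_congr_fun measurableSet_Ioi e, integral_const_mul, r2, inv_inv]
    have := wconst_ne
    have hpi : (Real.pi : ℂ) ≠ 0 := by exact_mod_cast Real.pi_ne_zero
    field_simp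
end

section
/- (Regularity of the Borel summation method on convergent series.) Let (a_n) be a sequence of complex numbers and r > 0 such that for every ρ with 0 < ρ < r the series ∑_{n=0}^∞ |a_n|·ρ^n converges. Then: (i) for every u ∈ ℂ the series ∑_{n=0}^∞ (a_n/n!)·u^n converges absolutely, defining an entire function B(u); (ii) for every real g with 0 < g < r, the function u ↦ B(u)·exp(−u/g) is integrable on (0, ∞) and (1/g)·∫_0^∞ B(u)·exp(−u/g) du = ∑_{n=0}^∞ a_n·g^n. -/
open MeasureTheory

lemma borel_aux_integral (n : ℕ) (g : ℝ) (hg : 0 < g) :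
    ∫ u in Set.Ioi (0 : ℝ), u ^ n * Real.exp (-(u / g)) = n.factorial * g ^ (n + 1) := by
  have h := Real.integral_rpow_mul_exp_neg_mul_Ioi (a := (n : ℝ) + 1) (r := 1 / g)
    (by positivity) (by positivity)
  rw [Real.Gamma_nat_eq_factorial] at h
  have h2 : (1 / (1 / g)) ^ ((n : ℝ) + 1) = g ^ (n + 1) := by
    rw [one_div_one_div]
    exact_mod_cast Real.rpow_natCast g (n + 1)
  rw [h2, mul_comm] at h
  rw [← h]
  refine setIntegral_congr_fun measurableSet_Ioi fun u hu => ?_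
  simp only [add_sub_cancel_right, Real.rpow_natCast]
  congr 2
  ring

lemma borel_aux_integrable (n : ℕ) (g : ℝ) (hg : 0 < g) :
    IntegrableOn (fun u : ℝ => u ^ n * Real.exp (-(u / g))) (Set.Ioi 0) := by
  by_contra h
  have h1 := borel_aux_integral n g hg
  rw [integral_undef h] at h1
  have : (0 : ℝ) < n.factorial * g ^ (n + 1) := by positivity
  linarith

lemma borel_aux_bound (a : ℕ → ℂ) (ρ : ℝ) (hρ : 0 < ρ)
    (h : Summable fun n : ℕ => ‖a n‖ * ρ ^ n) :
    ∃ C : ℝ, 0 ≤ C ∧ ∀ (n : ℕ) (u : ℂ),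
      ‖(a n / (n.factorial : ℂ)) * u ^ n‖ ≤ C * ((‖u‖ / ρ) ^ n / n.factorial) := by
  refine ⟨∑' n, ‖a n‖ * ρ ^ n, tsum_nonneg fun n => by positivity, fun n u => ?_⟩
  have h1 : ‖a n‖ * ρ ^ n ≤ ∑' n, ‖a n‖ * ρ ^ n := h.le_tsum n fun m _ => by positivity
  calc ‖(a n / (n.factorial : ℂ)) * u ^ n‖
      = (‖a n‖ * ρ ^ n) * ((‖u‖ / ρ) ^ n / n.factorial) := by
        rw [norm_mul, norm_div, norm_pow, Complex.norm_natCast, div_pow]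
        field_simp
    _ ≤ _ := by gcongr

/-- **Regularity of the Borel summation method**: if `∑ a_n g^n` has radius of
convergence at least `r > 0`, then the Borel transform `B(u) = ∑ (a_n/n!) uⁿ`
converges absolutely everywhere (defining an entire function), and for every
`0 < g < r` the Laplace–Borel integral reproduces the ordinary sum of the series. -/
theorem borel_method_regular
    (a : ℕ → ℂ) (r : ℝ) (hr : 0 < r)
    (hconv : ∀ ρ : ℝ, 0 < ρ → ρ < r → Summable fun n : ℕ => ‖a n‖ * ρ ^ n) :
    (∀ u : ℂ, Summable fun n : ℕ => ‖(a n / (n.factorial : ℂ)) * u ^ n‖) ∧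
    AnalyticOnNhd ℂ (fun u : ℂ => ∑' n : ℕ, (a n / (n.factorial : ℂ)) * u ^ n)
      Set.univ ∧
    ∀ g : ℝ, 0 < g → g < r →
      IntegrableOn
        (fun u : ℝ => (∑' n : ℕ, (a n / (n.factorial : ℂ)) * (u : ℂ) ^ n) *
          Complex.exp (-((u / g : ℝ) : ℂ)))
        (Set.Ioi 0) ∧
      (1 / (g : ℂ)) *
        ∫ u in Set.Ioi (0 : ℝ),
          (∑' n : ℕ, (a n / (n.factorial : ℂ)) * (u : ℂ) ^ n) *
            Complex.exp (-((u / g : ℝ) : ℂ))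
        = ∑' n : ℕ, a n * (g : ℂ) ^ n := by
  have hsum : ∀ u : ℂ, Summable fun n : ℕ => ‖(a n / (n.factorial : ℂ)) * u ^ n‖ := by
    intro u
    obtain ⟨C, hC, hb⟩ := borel_aux_bound a (r / 2) (by positivity)
      (hconv _ (by positivity) (by linarith))
    exact Summable.of_nonneg_of_le (fun _ => norm_nonneg _) (fun n => hb n u)
      ((Real.summable_pow_div_factorial _).mul_left C)
  have hdiff : Differentiable ℂ
      (fun u : ℂ => ∑' n : ℕ, (a n / (n.factorial : ℂ)) * u ^ n) := by
    intro z
    have hd : DifferentiableOn ℂ (fun u : ℂ => ∑' n : ℕ, (a n / (n.factorial : ℂ)) * u ^ n)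
        (Metric.ball 0 (‖z‖ + 1)) := by
      refine Complex.differentiableOn_tsum_of_summable_norm
        (hsum ((‖z‖ + 1 : ℝ) : ℂ)) (fun n => by fun_prop) Metric.isOpen_ball ?_
      intro n w hw
      rw [mem_ball_zero_iff] at hw
      rw [norm_mul, norm_mul, norm_pow, norm_pow, Complex.norm_real, Real.norm_eq_abs,
        abs_of_nonneg (by positivity)]
      gcongr
    exact hd.differentiableAt (Metric.isOpen_ball.mem_nhds (by simp))
  refine ⟨hsum, fun z _ => hdiff.analyticAt z, fun g hg hgr => ?_⟩
  have hnexp : ∀ u : ℝ, ‖Complex.exp (-((u / g : ℝ) : ℂ))‖ = Real.exp (-(u / g)) := by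
    intro u
    rw [Complex.norm_exp]
    simp only [Complex.neg_re, Complex.ofReal_re]
  constructor
  · obtain ⟨ρ, hgρ, hρr⟩ := exists_between hgr
    have hρ : 0 < ρ := hg.trans hgρ
    obtain ⟨C, hC, hb⟩ := borel_aux_bound a ρ hρ (hconv _ hρ hρr)
    have hpos : 0 < 1 / g - 1 / ρ := sub_pos.2 (one_div_lt_one_div_of_lt hg hgρ)
    have hdom : IntegrableOn (fun u : ℝ => C * Real.exp (-(1 / g - 1 / ρ) * u)) (Set.Ioi 0) :=
      (exp_neg_integrableOn_Ioi 0 hpos).const_mul C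
    refine Integrable.mono' hdom ?_ ?_
    · have hc : Continuous (fun u : ℝ => ∑' n : ℕ, (a n / (n.factorial : ℂ)) * (u : ℂ) ^ n) :=
        hdiff.continuous.comp Complex.continuous_ofReal
      have hc2 : Continuous (fun u : ℝ => Complex.exp (-((u / g : ℝ) : ℂ))) := by fun_prop
      exact (hc.mul hc2).aestronglyMeasurable
    · refine (ae_restrict_iff' measurableSet_Ioi).2 (Filter.Eventually.of_forall fun u hu => ?_)
      have hu0 : (0 : ℝ) < u := hu
      rw [norm_mul, hnexp]
      have hB : ‖∑' n : ℕ, (a n / (n.factorial : ℂ)) * (u : ℂ) ^ n‖ ≤ C * Real.exp (u / ρ) := by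
        refine tsum_of_norm_bounded ?_ (fun n => hb n u)
        have := (NormedSpace.expSeries_div_hasSum_exp (𝔸 := ℝ) (u / ρ)).mul_left C
        rw [← Real.exp_eq_exp_ℝ] at this
        rwa [Complex.norm_real, Real.norm_eq_abs, abs_of_pos hu0]
      calc _ ≤ C * Real.exp (u / ρ) * Real.exp (-(u / g)) := by gcongr
        _ = _ := by
          rw [mul_assoc, ← Real.exp_add]
          congr 2
          ring
  · have hfun : ∀ (n : ℕ) (u : ℝ), (a n / (n.factorial : ℂ)) * (u : ℂ) ^ n *
        Complex.exp (-((u / g : ℝ) : ℂ)) =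
        (a n / (n.factorial : ℂ)) * ((u ^ n * Real.exp (-(u / g)) : ℝ) : ℂ) := by
      intro n u
      push_cast
      ring
    have hFint : ∀ n : ℕ, Integrable (fun u : ℝ => (a n / (n.factorial : ℂ)) * (u : ℂ) ^ n *
        Complex.exp (-((u / g : ℝ) : ℂ))) (volume.restrict (Set.Ioi 0)) := by
      intro n
      simp_rw [hfun]
      exact (Integrable.ofReal (borel_aux_integrable n g hg)).const_mul _
    have hFval : ∀ n : ℕ, ∫ u in Set.Ioi (0 : ℝ), (a n / (n.factorial : ℂ)) * (u : ℂ) ^ n *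
        Complex.exp (-((u / g : ℝ) : ℂ)) = g * (a n * (g : ℂ) ^ n) := by
      intro n
      simp_rw [hfun]
      rw [integral_const_mul, integral_complex_ofReal, borel_aux_integral n g hg]
      have : (n.factorial : ℂ) ≠ 0 := by exact_mod_cast n.factorial_ne_zero
      push_cast
      field_simp
      ring
    have hFnorm : ∀ n : ℕ, ∫ u in Set.Ioi (0 : ℝ), ‖(a n / (n.factorial : ℂ)) * (u : ℂ) ^ n *
        Complex.exp (-((u / g : ℝ) : ℂ))‖ = g * (‖a n‖ * g ^ n) := by
      intro n
      have : ∫ u in Set.Ioi (0 : ℝ), ‖(a n / (n.factorial : ℂ)) * (u : ℂ) ^ n *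
          Complex.exp (-((u / g : ℝ) : ℂ))‖ =
          ∫ u in Set.Ioi (0 : ℝ), (‖a n‖ / n.factorial) * (u ^ n * Real.exp (-(u / g))) := by
        refine setIntegral_congr_fun measurableSet_Ioi fun u hu => ?_
        have hu0 : (0 : ℝ) < u := hu
        simp only [norm_mul, hnexp, norm_div, norm_pow, Complex.norm_natCast, Complex.norm_real,
          Real.norm_eq_abs, abs_of_pos hu0]
        ring
      rw [this, integral_const_mul, borel_aux_integral n g hg]
      have : (n.factorial : ℝ) ≠ 0 := by exact_mod_cast n.factorial_ne_zero
      field_simp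
      ring
    have key := integral_tsum_of_summable_integral_norm hFint (by
      simp_rw [hFnorm]
      exact (hconv g hg hgr).mul_left g)
    simp_rw [hFval, tsum_mul_right, tsum_mul_left] at key
    rw [← key]
    have : (g : ℂ) ≠ 0 := by exact_mod_cast hg.ne'
    field_simp
end

section
/- (Exactness of the E algorithm in determinant form.) Let k ≥ 1, let σ ∈ ℝ, let a : Fin k → ℝ, let g : Fin k → ℕ → ℝ be auxiliary sequences, and let s : ℕ → ℝ satisfy s(n) = σ + ∑_{i=0}^{k−1} a_i · g_i(n) for every n ∈ ℕ. For each n ∈ ℕ define the (k+1)×(k+1) real matrices N_n and D_n by: the first row of N_n is (s(n), s(n+1), …, s(n+k)) while the first row of D_n is (1, 1, …, 1), and for 1 ≤ i ≤ k the (i+1)-st row of both N_n and D_n is (g_{i−1}(n), g_{i−1}(n+1), …, g_{i−1}(n+k)). Then det N_n = σ · det D_n for every n; in particular, whenever det D_n ≠ 0, the E-algorithm transform E_k^{(n)} = det N_n / det D_n equals σ. -/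
/-- **Exactness of the `E` algorithm in determinant form**: for a model sequence
`s n = σ + ∑ i, a i * g i n`, the numerator determinant (first row the `s`
values, remaining rows the auxiliary sequences) equals `σ` times the denominator
determinant (first row all ones); in particular the `E`-algorithm transform
`det N / det D` equals `σ` whenever `det D ≠ 0`. -/
theorem E_algorithm_exact
    (k : ℕ) (hk : 1 ≤ k) (σ : ℝ) (a : Fin k → ℝ) (g : Fin k → ℕ → ℝ)
    (s : ℕ → ℝ)
    (hs : ∀ n : ℕ, s n = σ + ∑ i : Fin k, a i * g i n)
    (N D : ℕ → Matrix (Fin (k + 1)) (Fin (k + 1)) ℝ)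
    (hN : ∀ n : ℕ, ∀ i j : Fin (k + 1),
      N n i j = if h : (i : ℕ) = 0 then s (n + (j : ℕ))
        else g ⟨(i : ℕ) - 1, by have := i.isLt; omega⟩ (n + (j : ℕ)))
    (hD : ∀ n : ℕ, ∀ i j : Fin (k + 1),
      D n i j = if h : (i : ℕ) = 0 then 1
        else g ⟨(i : ℕ) - 1, by have := i.isLt; omega⟩ (n + (j : ℕ))) :
    ∀ n : ℕ, (N n).det = σ * (D n).det ∧
      ((D n).det ≠ 0 → (N n).det / (D n).det = σ) := by
  intro n
  have key : N n = (D n).updateRow 0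
      (∑ i, (Fin.cons σ a : Fin (k + 1) → ℝ) i • (D n) i) := by
    ext i j
    refine Fin.cases ?_ (fun i => ?_) i
    · rw [Matrix.updateRow_self, Finset.sum_apply, Fin.sum_univ_succ]
      simp [hN, hD, hs]
    · rw [Matrix.updateRow_ne (Fin.succ_ne_zero i)]
      simp [hN, hD]
  have hdet : (N n).det = σ * (D n).det := by
    rw [key, Matrix.det_updateRow_sum]
    simp
  exact ⟨hdet, fun h => by rw [hdet, mul_div_cancel_right₀ _ h]⟩
end

section
/- (Integral-representation characterization of totally monotonic sequences.) Let s : ℕ → ℝ. Then the following are equivalent: (i) s is totally monotonic, i.e. for all k, n ∈ ℕ one has 0 ≤ ∑_{j=0}^{k} (−1)^j · binom(k, j) · s(n+j); (ii) there exists a finite Borel measure μ on ℝ with μ(ℝ \ [0,1]) = 0 such that s(n) = ∫ x^n dμ(x) for every n ∈ ℕ. -/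
open MeasureTheory

open Filter Topology in
/-- Binomial expansion used throughout. -/
lemma tm_expand {R : Type*} [CommRing R] (x : R) (k n : ℕ) :
    x ^ n * (1 - x) ^ k =
      ∑ j ∈ Finset.range (k + 1), ((-1) ^ j * (k.choose j) : R) * x ^ (n + j) := by
  rw [sub_eq_neg_add, add_pow, Finset.mul_sum]
  refine Finset.sum_congr rfl fun j _ => ?_
  rw [neg_pow, pow_add]
  simp
  ring

/-- The moment functional. -/
noncomputable def tmL (s : ℕ → ℝ) : Polynomial ℝ →ₗ[ℝ] ℝ :=
  (Polynomial.basisMonomials ℝ).constr ℝ s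

lemma tmL_X (s : ℕ → ℝ) (n : ℕ) : tmL s (Polynomial.X ^ n) = s n := by
  have := (Polynomial.basisMonomials ℝ).constr_basis ℝ s n
  rw [Polynomial.coe_basisMonomials] at this
  rw [← Polynomial.monomial_one_right_eq_X_pow]
  exact this

lemma tmL_prod (s : ℕ → ℝ) (k n : ℕ) :
    tmL s (Polynomial.X ^ n * (1 - Polynomial.X) ^ k) =
      ∑ j ∈ Finset.range (k + 1), (-1 : ℝ) ^ j * (k.choose j) * s (n + j) := by
  rw [tm_expand, map_sum]
  refine Finset.sum_congr rfl fun j _ => ?_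
  have : ((-1) ^ j * (k.choose j) : Polynomial ℝ) * Polynomial.X ^ (n + j)
      = ((-1 : ℝ) ^ j * (k.choose j)) • Polynomial.X ^ (n + j) := by
    rw [Polynomial.smul_eq_C_mul]
    simp
  rw [this, map_smul, tmL_X, smul_eq_mul]

/-- The weights of the approximating measures. -/
noncomputable def tmW (s : ℕ → ℝ) (N m : ℕ) : ℝ := tmL s (bernsteinPolynomial ℝ N m)

lemma tmW_nonneg (s : ℕ → ℝ) (h : ∀ k n : ℕ,
      0 ≤ ∑ j ∈ Finset.range (k + 1), (-1 : ℝ) ^ j * (k.choose j) * s (n + j)) (N m : ℕ) :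
    0 ≤ tmW s N m := by
  have : bernsteinPolynomial ℝ N m =
      (N.choose m : ℝ) • (Polynomial.X ^ m * (1 - Polynomial.X) ^ (N - m)) := by
    rw [Polynomial.smul_eq_C_mul, bernsteinPolynomial]
    simp [mul_assoc]
  rw [tmW, this, map_smul, tmL_prod, smul_eq_mul]
  exact mul_nonneg (by positivity) (h _ _)

lemma tm_poly (M n : ℕ) :
    ∑ m ∈ Finset.range (n + M + 1),
      ((m.choose n : ℝ) / ((n + M).choose n)) • bernsteinPolynomial ℝ (n + M) m
      = Polynomial.X ^ n := by
  rw [add_assoc, Finset.sum_range_add, Finset.sum_eq_zero, zero_add]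
  · have h1 : ∀ i ∈ Finset.range (M + 1),
        (((n + i).choose n : ℝ) / ((n + M).choose n)) • bernsteinPolynomial ℝ (n + M) (n + i)
        = Polynomial.X ^ n * bernsteinPolynomial ℝ M i := by
      intro i hi
      have hc := Nat.choose_mul (n := n + M) (k := n + i) (s := n) (by omega)
      simp only [Nat.add_sub_cancel_left] at hc
      have hc' : ((n + M).choose (n + i) : ℝ) * ((n + i).choose n)
        = (n + M).choose n * M.choose i := by exact_mod_cast hc
      have hp : ((n + M).choose n : ℝ) ≠ 0 := by
        have := Nat.choose_pos (n := n + M) (k := n) (by omega)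
        positivity
      have hd : ((n + i).choose n : ℝ) / ((n + M).choose n) * ((n + M).choose (n + i))
        = M.choose i := by
        field_simp
        linarith
      simp only [bernsteinPolynomial, Nat.add_sub_add_left]
      rw [Polynomial.smul_eq_C_mul, ← Polynomial.C_eq_natCast, ← Polynomial.C_eq_natCast, ← hd,
        Polynomial.C_mul, pow_add]
      simp only [Polynomial.C_eq_natCast, map_natCast]
      ring
    rw [Finset.sum_congr rfl h1, ← Finset.mul_sum, bernsteinPolynomial.sum, mul_one]
  · intro m hm
    rw [Nat.choose_eq_zero_of_lt (Finset.mem_range.1 hm)]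
    simp

lemma tmW_moment (s : ℕ → ℝ) (N n : ℕ) (hn : n ≤ N) :
    ∑ m ∈ Finset.range (N + 1), tmW s N m * ((m.choose n : ℝ) / (N.choose n)) = s n := by
  obtain ⟨M, rfl⟩ := Nat.exists_eq_add_of_le hn
  rw [← tmL_X s n, ← tm_poly M n, map_sum]
  refine Finset.sum_congr rfl fun m _ => ?_
  rw [map_smul, smul_eq_mul, mul_comm, tmW]

lemma tmW_sum (s : ℕ → ℝ) (N : ℕ) : ∑ m ∈ Finset.range (N + 1), tmW s N m = s 0 := by
  simpa using tmW_moment s N 0 (by omega)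

lemma tm_ratio (N m n : ℕ) (hm : m ≤ N) (hn : n < N) :
    (m.choose (n + 1) : ℝ) / (N.choose (n + 1)) =
      (m.choose n : ℝ) / (N.choose n) * (((m : ℝ) - n) / ((N : ℝ) - n)) := by
  have key : ∀ a : ℕ, (a.choose (n + 1) : ℝ) * (n + 1) = a.choose n * ((a : ℝ) - n) := by
    intro a
    rcases lt_or_ge a n with h | h
    · rw [Nat.choose_eq_zero_of_lt h, Nat.choose_eq_zero_of_lt (by omega)]
      simp
    · have := Nat.choose_succ_right_eq a n
      rw [← Nat.cast_sub h]
      exact_mod_cast this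
  have h1 := key m
  have h2 := key N
  have hN : (0 : ℝ) < (N : ℝ) - n := by
    have : (n : ℝ) < N := by exact_mod_cast hn
    linarith
  have p1 : (0 : ℝ) < N.choose n := by exact_mod_cast Nat.choose_pos hn.le
  have p2 : (0 : ℝ) < N.choose (n + 1) := by exact_mod_cast Nat.choose_pos hn
  have p3 : (0 : ℝ) < (n : ℝ) + 1 := by positivity
  rw [div_mul_div_comm, ← h1, ← h2]
  field_simp

lemma tm_err (N m : ℕ) (hm : m ≤ N) (n : ℕ) (hn : n < N) :
    |(m.choose n : ℝ) / (N.choose n) - ((m : ℝ) / N) ^ n| ≤ n * (n / ((N : ℝ) - n)) := by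
  induction n with
  | zero => simp
  | succ n ih =>
    have ih := ih (by omega)
    have hmN : (m : ℝ) ≤ N := by exact_mod_cast hm
    have hnN : (n : ℝ) + 1 < N := by exact_mod_cast hn
    have hn0 : (0 : ℝ) ≤ n := by positivity
    have hm0 : (0 : ℝ) ≤ m := by positivity
    have hN0 : (0 : ℝ) < N := by linarith
    rw [tm_ratio N m n hm (by omega)]
    set a := (m.choose n : ℝ) / (N.choose n) with ha
    set x := (m : ℝ) / N with hx
    set y := ((m : ℝ) - n) / ((N : ℝ) - n) with hy
    have ha0 : 0 ≤ a := by positivity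
    have ha1 : a ≤ 1 := div_le_one_of_le₀ (by exact_mod_cast Nat.choose_le_choose n hm)
      (by positivity)
    have hx0 : 0 ≤ x := by positivity
    have hx1 : x ≤ 1 := div_le_one_of_le₀ hmN hN0.le
    have hyx : |y - x| ≤ n / ((N : ℝ) - n) := by
      have hd : (0 : ℝ) < (N : ℝ) - n := by linarith
      have : y - x = - (n / ((N : ℝ) - n) * (1 - x)) := by
        rw [hy, hx]
        field_simp
        ring
      rw [this, abs_neg, abs_of_nonneg (by
        have : 0 ≤ 1 - x := by linarith
        positivity)]
      have : 0 ≤ n / ((N : ℝ) - n) := by positivity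
      nlinarith
    have e : a * y - x ^ (n + 1) = a * (y - x) + x * (a - x ^ n) := by ring
    rw [e]
    have b : (n : ℝ) / ((N : ℝ) - n) ≤ ((n + 1 : ℕ) : ℝ) / ((N : ℝ) - (n + 1 : ℕ)) := by
      push_cast
      apply div_le_div₀ <;> linarith
    calc |a * (y - x) + x * (a - x ^ n)| ≤ |a * (y - x)| + |x * (a - x ^ n)| := abs_add_le _ _
      _ = a * |y - x| + x * |a - x ^ n| := by
        rw [abs_mul, abs_mul, abs_of_nonneg ha0, abs_of_nonneg hx0]
      _ ≤ 1 * |y - x| + 1 * |a - x ^ n| := by gcongr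
      _ ≤ n / ((N : ℝ) - n) + n * (n / ((N : ℝ) - n)) := by linarith
      _ = (n + 1 : ℕ) * (n / ((N : ℝ) - n)) := by push_cast; ring
      _ ≤ _ := by gcongr

open Filter Topology in
lemma tm_tendsto (s : ℕ → ℝ) (hw : ∀ N m, 0 ≤ tmW s N m) (n : ℕ) :
    Tendsto (fun N : ℕ => ∑ m ∈ Finset.range (N + 1), tmW s N m * ((m : ℝ) / N) ^ n) atTop
      (𝓝 (s n)) := by
  rw [tendsto_iff_norm_sub_tendsto_zero]
  have hz : Tendsto (fun N : ℕ => s 0 * (n * (n / ((N : ℝ) - n)))) atTop (𝓝 0) := by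
    have h1 : Tendsto (fun N : ℕ => (N : ℝ) - n) atTop atTop :=
      tendsto_atTop_add_const_right _ _ tendsto_natCast_atTop_atTop
    have := ((h1.const_div_atTop (n : ℝ)).const_mul (n : ℝ)).const_mul (s 0)
    simpa using this
  refine squeeze_zero' (Eventually.of_forall fun _ => norm_nonneg _) ?_ hz
  filter_upwards [eventually_gt_atTop n] with N hN
  rw [← tmW_moment s N n hN.le, ← Finset.sum_sub_distrib, ← tmW_sum s N, Finset.sum_mul]
  refine (norm_sum_le _ _).trans (Finset.sum_le_sum fun m hm => ?_)
  rw [← mul_sub, norm_mul, Real.norm_of_nonneg (hw N m), Real.norm_eq_abs, abs_sub_comm]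
  exact mul_le_mul_of_nonneg_left
    (tm_err N m (Nat.lt_succ_iff.1 (Finset.mem_range.1 hm)) n hN) (hw N m)

/-- The approximating discrete measures. -/
noncomputable def tmM (s : ℕ → ℝ) (N : ℕ) : Measure ℝ :=
  ∑ m ∈ Finset.range (N + 1), ENNReal.ofReal (tmW s N m) • Measure.dirac ((m : ℝ) / N)

lemma tmM_apply (s : ℕ → ℝ) (N : ℕ) (A : Set ℝ) : tmM s N A =
    ∑ m ∈ Finset.range (N + 1),
      ENNReal.ofReal (tmW s N m) * Measure.dirac ((m : ℝ) / N) A := by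
  simp [tmM, Measure.finsetSum_apply]

lemma tmM_univ (s : ℕ → ℝ) (hw : ∀ N m, 0 ≤ tmW s N m) (N : ℕ) :
    tmM s N Set.univ = ENNReal.ofReal (s 0) := by
  rw [tmM_apply, ← tmW_sum s N, ENNReal.ofReal_sum_of_nonneg fun m _ => hw N m]
  simp

lemma tmM_compl (s : ℕ → ℝ) (N : ℕ) : tmM s N (Set.Icc 0 1)ᶜ = 0 := by
  rw [tmM_apply]
  refine Finset.sum_eq_zero fun m hm => ?_
  have hm' : (m : ℝ) ≤ N := by exact_mod_cast Nat.lt_succ_iff.1 (Finset.mem_range.1 hm)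
  have : (m : ℝ) / N ∈ Set.Icc (0 : ℝ) 1 :=
    ⟨by positivity, div_le_one_of_le₀ hm' (by positivity)⟩
  rw [Measure.dirac_apply' _ measurableSet_Icc.compl, Set.indicator_of_notMem (by simpa using this),
    mul_zero]

lemma tmM_integral (s : ℕ → ℝ) (hw : ∀ N m, 0 ≤ tmW s N m) (N : ℕ) (f : ℝ → ℝ) :
    ∫ x, f x ∂(tmM s N) = ∑ m ∈ Finset.range (N + 1), tmW s N m * f ((m : ℝ) / N) := by
  rw [tmM, integral_finsetSum_measure]
  · refine Finset.sum_congr rfl fun m _ => ?_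
    rw [integral_smul_measure, integral_dirac, ENNReal.toReal_ofReal (hw N m), smul_eq_mul]
  · intro m _
    exact (integrable_dirac (by simp)).smul_measure ENNReal.ofReal_ne_top

/-- Bounded continuous version of `x ^ n`. -/
noncomputable def tmF (n : ℕ) : BoundedContinuousFunction ℝ ℝ :=
  BoundedContinuousFunction.ofNormedAddCommGroup (fun x => (max 0 (min 1 x)) ^ n)
    (by fun_prop) 1 (by
      intro x
      rw [norm_pow, Real.norm_of_nonneg (le_max_left _ _)]
      exact pow_le_one₀ (le_max_left _ _) (max_le (by norm_num) (min_le_left _ _)))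

lemma tmF_apply (n : ℕ) {x : ℝ} (hx : x ∈ Set.Icc (0 : ℝ) 1) : tmF n x = x ^ n := by
  change (max 0 (min 1 x)) ^ n = x ^ n
  rw [min_eq_right hx.2, max_eq_right hx.1]

lemma tmF_integral (n : ℕ) (μ : Measure ℝ) (h : μ (Set.Icc 0 1)ᶜ = 0) :
    ∫ x, tmF n x ∂μ = ∫ x, x ^ n ∂μ := by
  refine integral_congr_ae ?_
  have : ∀ᵐ x ∂μ, x ∈ Set.Icc (0 : ℝ) 1 := h
  filter_upwards [this] with x hx using tmF_apply n hx

lemma tm_integrable (n : ℕ) (μ : Measure ℝ) [IsFiniteMeasure μ] (h : μ (Set.Icc 0 1)ᶜ = 0) :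
    Integrable (fun x : ℝ => x ^ n) μ := by
  refine ((tmF n).integrable μ).congr ?_
  have : ∀ᵐ x ∂μ, x ∈ Set.Icc (0 : ℝ) 1 := h
  filter_upwards [this] with x hx using tmF_apply n hx

open Filter Topology in
lemma tm_forward (s : ℕ → ℝ) (h : ∀ k n : ℕ,
      0 ≤ ∑ j ∈ Finset.range (k + 1), (-1 : ℝ) ^ j * (k.choose j) * s (n + j)) :
    ∃ μ : Measure ℝ, IsFiniteMeasure μ ∧ μ (Set.univ \ Set.Icc 0 1) = 0 ∧
      ∀ n : ℕ, s n = ∫ x, x ^ n ∂μ := by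
  have hw := tmW_nonneg s h
  let M : ℕ → FiniteMeasure ℝ := fun N => ⟨tmM s N, ⟨by rw [tmM_univ s hw]; simp⟩⟩
  have hK := isCompact_setOfPred_finiteMeasure_le_of_isCompact (E := ℝ) (s 0).toNNReal
    (isCompact_Icc (a := (0 : ℝ)) (b := 1))
  have hM : ∀ N, M N ∈ {μ : FiniteMeasure ℝ |
      μ.mass ≤ (s 0).toNNReal ∧ μ (Set.Icc 0 1)ᶜ = 0} := by
    intro N
    refine ⟨?_, ?_⟩
    · change (tmM s N Set.univ).toNNReal ≤ _
      rw [tmM_univ s hw]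
      rfl
    · rw [FiniteMeasure.null_iff_toMeasure_null]
      exact tmM_compl s N
  let U : Ultrafilter ℕ := Ultrafilter.of atTop
  have hU : (U : Filter ℕ) ≤ atTop := Ultrafilter.of_le atTop
  obtain ⟨μ, hμ, hlim⟩ := hK.ultrafilter_le_nhds (U.map M) (by
    rw [le_principal_iff, Ultrafilter.coe_map, mem_map]
    exact univ_mem' hM)
  have hlim : Tendsto M U (𝓝 μ) := hlim
  have hμ0 : (μ : Measure ℝ) (Set.Icc 0 1)ᶜ = 0 :=
    (FiniteMeasure.null_iff_toMeasure_null _ _).1 hμ.2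
  refine ⟨μ, inferInstance, ?_, fun n => ?_⟩
  · rwa [← Set.compl_eq_univ_sdiff]
  · rw [← tmF_integral n _ hμ0]
    have h1 := FiniteMeasure.tendsto_iff_forall_integral_tendsto.1 hlim (tmF n)
    refine tendsto_nhds_unique ((tm_tendsto s hw n).mono_left hU) (h1.congr fun N => ?_)
    change ∫ x, tmF n x ∂(tmM s N) = _
    rw [tmF_integral n _ (tmM_compl s N), tmM_integral s hw]

lemma tm_backward (s : ℕ → ℝ) (μ : Measure ℝ) [IsFiniteMeasure μ]
    (h0 : μ (Set.Icc 0 1)ᶜ = 0) (hs : ∀ n : ℕ, s n = ∫ x, x ^ n ∂μ) (k n : ℕ) :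
    0 ≤ ∑ j ∈ Finset.range (k + 1), (-1 : ℝ) ^ j * (k.choose j) * s (n + j) := by
  have : ∑ j ∈ Finset.range (k + 1), (-1 : ℝ) ^ j * (k.choose j) * s (n + j)
      = ∫ x, x ^ n * (1 - x) ^ k ∂μ := by
    simp_rw [tm_expand]
    rw [integral_finsetSum _ fun j _ => (tm_integrable (n + j) μ h0).const_mul _]
    refine Finset.sum_congr rfl fun j _ => ?_
    rw [integral_const_mul, hs]
  rw [this]
  refine integral_nonneg_of_ae ?_
  have : ∀ᵐ x ∂μ, x ∈ Set.Icc (0 : ℝ) 1 := h0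
  filter_upwards [this] with x hx
  exact mul_nonneg (pow_nonneg hx.1 _) (pow_nonneg (by linarith [hx.2]) _)

/-- **Integral-representation characterization of totally monotonic sequences**
(Hausdorff moment problem): a real sequence `s` satisfies
`(−1)^k Δ^k s(n) ≥ 0` for all `k, n` iff there is a finite Borel measure `μ`
supported in `[0,1]` such that `s(n) = ∫ xⁿ dμ(x)` for every `n`. -/
theorem totally_monotonic_iff_moment_representation (s : ℕ → ℝ) :
    (∀ k n : ℕ,
      0 ≤ ∑ j ∈ Finset.range (k + 1), (-1 : ℝ) ^ j * (k.choose j) * s (n + j)) ↔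
    ∃ μ : Measure ℝ, IsFiniteMeasure μ ∧ μ (Set.univ \ Set.Icc 0 1) = 0 ∧
      ∀ n : ℕ, s n = ∫ x, x ^ n ∂μ := by
  refine ⟨tm_forward s, ?_⟩
  rintro ⟨μ, hfin, h0, hs⟩
  rw [← Set.compl_eq_univ_sdiff] at h0
  exact tm_backward s μ h0 hs
end

section
/- Let a : ℕ → ℝ with a(k) > 0 for all k, suppose ∑ a(k) converges, and suppose the ratio of successive terms converges: a(n+1)/a(n) → ρ as n → ∞. Then the ratio of successive remainders converges to the same limit: writing r(n) = −∑_{k=n+1}^∞ a(k) for the remainder of the partial sum s_n = ∑_{k=0}^n a(k), one has r(n+1)/r(n) → ρ as n → ∞. -/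
/-- (Clark–Gray–Adams) For a convergent series of positive terms whose term
ratios `a(n+1)/a(n)` converge to `ρ`, the remainder ratios `r(n+1)/r(n)` (where
`r(n) = −∑_{k=n+1}^∞ a(k)`) converge to the same limit `ρ`. -/
theorem remainder_ratio_limit_eq_term_ratio_limit
    (a : ℕ → ℝ) (ρ : ℝ)
    (hpos : ∀ k, 0 < a k)
    (hsum : Summable a)
    (hratio : Filter.Tendsto (fun n => a (n + 1) / a n) Filter.atTop (nhds ρ)) :
    Filter.Tendsto
      (fun n => (-(∑' k : ℕ, a (n + 1 + 1 + k))) / (-(∑' k : ℕ, a (n + 1 + k))))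
      Filter.atTop (nhds ρ) := by
  rw [Metric.tendsto_atTop] at hratio ⊢
  intro ε hε
  obtain ⟨N, hN⟩ := hratio (ε / 2) (by positivity)
  refine ⟨N, fun n hn => ?_⟩
  have hS : ∀ m, Summable (fun k => a (m + k)) := fun m =>
    hsum.comp_injective (add_right_injective m)
  have h1 := hS (n + 1)
  have h2 := hS (n + 1 + 1)
  have hR : 0 < ∑' k : ℕ, a (n + 1 + k) :=
    h1.tsum_pos (fun k => (hpos _).le) 0 (hpos _)
  have key : ∀ k, (ρ - ε / 2) * a (n + 1 + k) ≤ a (n + 1 + 1 + k) ∧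
      a (n + 1 + 1 + k) ≤ (ρ + ε / 2) * a (n + 1 + k) := by
    intro k
    have h := hN (n + 1 + k) (by omega)
    rw [Real.dist_eq, abs_lt] at h
    have hp := hpos (n + 1 + k)
    have e : n + 1 + 1 + k = n + 1 + k + 1 := by omega
    rw [e]
    constructor
    · rw [← le_div_iff₀ hp]; linarith [h.1]
    · rw [← div_le_iff₀ hp]; linarith [h.2]
  have lo := (h1.mul_left (ρ - ε / 2)).tsum_le_tsum (fun k => (key k).1) h2
  have hi := h2.tsum_le_tsum (fun k => (key k).2) (h1.mul_left (ρ + ε / 2))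
  rw [tsum_mul_left] at lo hi
  rw [neg_div_neg_eq, Real.dist_eq, abs_lt]
  rw [← le_div_iff₀ hR] at lo
  rw [← div_le_iff₀ hR] at hi
  constructor <;> linarith
end

section
/- Let s, s' : ℕ → ℝ and σ, ρ, ρ', L ∈ ℝ. Write r(n) = s(n) − σ and r'(n) = s'(n) − σ, and assume r(n) ≠ 0 and r'(n) ≠ 0 for all n. Assume r(n+1)/r(n) → ρ with ρ ≠ 1, r'(n+1)/r'(n) → ρ', and r'(n)/r(n) → L as n → ∞. Then the ratio of forward differences converges: (s'(n+1) − s'(n)) / (s(n+1) − s(n)) → L·(ρ' − 1)/(ρ − 1) as n → ∞. In particular, if additionally ρ' ≠ 1, then r'(n)/r(n) → 0 holds if and only if (s'(n+1) − s'(n))/(s(n+1) − s(n)) → 0. -/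
/-- Relation between remainder ratios and forward-difference ratios: if
`r(n+1)/r(n) → ρ ≠ 1`, `r'(n+1)/r'(n) → ρ'` and `r'(n)/r(n) → L`, then
`Δs'(n)/Δs(n) → L·(ρ'−1)/(ρ−1)`; in particular, when also `ρ' ≠ 1`,
accelerated convergence in the remainder sense is equivalent to accelerated
convergence in the difference sense. -/
theorem diff_ratio_vs_remainder_ratio
    (s s' : ℕ → ℝ) (σ ρ ρ' L : ℝ)
    (hr : ∀ n, s n - σ ≠ 0) (hr' : ∀ n, s' n - σ ≠ 0)
    (hρ : Filter.Tendsto (fun n => (s (n + 1) - σ) / (s n - σ)) Filter.atTop (nhds ρ))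
    (hρ1 : ρ ≠ 1)
    (hρ' : Filter.Tendsto (fun n => (s' (n + 1) - σ) / (s' n - σ)) Filter.atTop (nhds ρ'))
    (hL : Filter.Tendsto (fun n => (s' n - σ) / (s n - σ)) Filter.atTop (nhds L)) :
    Filter.Tendsto (fun n => (s' (n + 1) - s' n) / (s (n + 1) - s n)) Filter.atTop
      (nhds (L * (ρ' - 1) / (ρ - 1))) ∧
    (ρ' ≠ 1 →
      (Filter.Tendsto (fun n => (s' n - σ) / (s n - σ)) Filter.atTop (nhds 0) ↔
        Filter.Tendsto (fun n => (s' (n + 1) - s' n) / (s (n + 1) - s n))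
          Filter.atTop (nhds 0))) := by
  have key : Filter.Tendsto (fun n => (s' (n + 1) - s' n) / (s (n + 1) - s n)) Filter.atTop
      (nhds (L * (ρ' - 1) / (ρ - 1))) := by
    have h := (hL.mul (hρ'.sub_const 1)).div (hρ.sub_const 1) (sub_ne_zero.mpr hρ1)
    refine h.congr (fun n => ?_)
    have h1 := hr n
    have h2 := hr' n
    have e1 : (s (n + 1) - σ) / (s n - σ) - 1 = (s (n + 1) - s n) / (s n - σ) := by
      field_simp
      ring
    have e2 : (s' (n + 1) - σ) / (s' n - σ) - 1 = (s' (n + 1) - s' n) / (s' n - σ) := by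
      field_simp
      ring
    simp only [Pi.div_apply]
    rw [e1, e2, mul_comm, div_mul_div_cancel₀ h2, div_div_div_cancel_right₀ h1]
  refine ⟨key, fun hρ'1 => ⟨fun h0 => ?_, fun h0 => ?_⟩⟩
  · have hL0 : L = 0 := tendsto_nhds_unique hL h0
    simpa [hL0] using key
  · have h := tendsto_nhds_unique key h0
    have hL0 : L = 0 := by
      rcases div_eq_zero_iff.mp h with h | h
      · exact (mul_eq_zero.mp h).resolve_right (sub_ne_zero.mpr hρ'1)
      · exact absurd h (sub_ne_zero.mpr hρ1)
    simpa [hL0] using hL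
end

section
/- (Asymptotics of the remainder of the alternating series for π²/12.) Consider the partial sums s_n = ∑_{k=0}^n (−1)^k/(k+1)², which converge to π²/12, with remainder r_n = −∑_{k=n+1}^∞ (−1)^k/(k+1)². Then there exists a constant C > 0 such that for every n ≥ 1, | r_n − ((−1)^n/2)·(1/n² − 3/n³) | ≤ C/n⁴. In particular r_{n+1}/r_n → −1, i.e. the series is alternating marginally convergent. -/
open Filter Topology in
lemma azr_alt : HasSum (fun k : ℕ => (-1 : ℝ) ^ k / ((k : ℝ) + 1) ^ 2) (Real.pi ^ 2 / 12) := by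
  have h := hasSum_zeta_two
  have he : HasSum (fun k : ℕ => (1 : ℝ) / ((2 * k : ℕ) : ℝ) ^ 2) (Real.pi ^ 2 / 6 / 4) := by
    have := h.div_const 4
    refine this.congr_fun ?_ 
    intro k
    push_cast
    rw [mul_pow, div_div, mul_comm]; norm_num
  have hos : Summable (fun k : ℕ => (1 : ℝ) / ((2 * k + 1 : ℕ) : ℝ) ^ 2) :=
    h.summable.comp_injective (i := fun k : ℕ => 2 * k + 1) (fun a b hab => by simpa using hab)
  obtain ⟨o, ho⟩ := hos
  have hS : Real.pi ^ 2 / 6 = Real.pi ^ 2 / 6 / 4 + o :=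
    h.unique (HasSum.even_add_odd (f := fun n : ℕ => (1 : ℝ) / (n : ℝ) ^ 2) he ho)
  have hf : HasSum (fun n : ℕ => (-1 : ℝ) ^ n / (n : ℝ) ^ 2) (Real.pi ^ 2 / 6 / 4 + -o) := by
    refine HasSum.even_add_odd ?_ ?_
    · simpa [pow_mul] using he
    · simpa [pow_mul, pow_succ, neg_div] using ho.neg
  have h2 := ((hasSum_nat_add_iff' 1).2 hf).neg
  have e : Real.pi ^ 2 / 12 = -(Real.pi ^ 2 / 6 / 4 + -o - ∑ i ∈ Finset.range 1, (-1 : ℝ) ^ i / (i : ℝ) ^ 2) := by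
    simp; linarith
  rw [e]
  refine h2.congr_fun ?_
  intro k
  push_cast
  rw [pow_succ]; ring

noncomputable def azrT (n : ℕ) : ℝ := ∑' j : ℕ, (-1 : ℝ) ^ j / ((n : ℝ) + 2 + (j : ℝ)) ^ 2

lemma azr_summ (n : ℕ) : Summable (fun j : ℕ => (-1 : ℝ) ^ j / ((n : ℝ) + 2 + (j : ℝ)) ^ 2) := by
  have h := (summable_nat_add_iff (n + 1)).2 azr_alt.summable
  have h2 := h.mul_left ((-1 : ℝ) ^ (n + 1))
  refine h2.congr ?_
  intro j
  have : ((-1 : ℝ) ^ (n + 1)) * (-1) ^ (n + 1) = 1 := by rw [← mul_pow]; simp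
  push_cast
  rw [pow_add (-1 : ℝ) j, ← mul_div_assoc, mul_left_comm, this, mul_one]
  congr 2; ring

lemma azr_eq (n : ℕ) : -(∑' j : ℕ, (-1 : ℝ) ^ (n + 1 + j) / ((n : ℝ) + 2 + (j : ℝ)) ^ 2)
    = (-1) ^ n * azrT n := by
  rw [azrT, ← tsum_mul_left, ← tsum_neg]
  congr 1; ext j
  rw [pow_add, pow_succ]; ring

lemma azr_rec (n : ℕ) : azrT n + azrT (n + 1) = 1 / ((n : ℝ) + 2) ^ 2 := by
  have h := (azr_summ n).tsum_eq_zero_add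
  rw [azrT, h, azrT]
  have : ∑' b : ℕ, (-1 : ℝ) ^ (b + 1) / ((n : ℝ) + 2 + ((b + 1 : ℕ) : ℝ)) ^ 2
      = - ∑' j : ℕ, (-1 : ℝ) ^ j / (((n + 1 : ℕ) : ℝ) + 2 + (j : ℝ)) ^ 2 := by
    rw [← tsum_neg]; congr 1; ext j; push_cast; rw [pow_succ]; ring
  rw [this]; simp

open Filter Topology in
lemma azr_lim : Tendsto azrT atTop (𝓝 0) := by
  have h := tendsto_sum_nat_add (fun k : ℕ => (-1 : ℝ) ^ k / ((k : ℝ) + 1) ^ 2)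
  have h1 := (h.comp (tendsto_add_atTop_nat 1)).abs
  rw [abs_zero] at h1
  refine (tendsto_zero_iff_abs_tendsto_zero _).2 (h1.congr ?_)
  intro n
  have e := azr_eq n
  have : |azrT n| = |(-1) ^ n * azrT n| := by rw [abs_mul]; simp
  simp only [Function.comp]
  rw [this, ← e, abs_neg]
  congr 2; ext j; push_cast
  rw [add_comm j (n+1)]; congr 2; ring

noncomputable def azrG (n : ℕ) : ℝ := 1 / (2 * ((n : ℝ) + 2) ^ 2) + 1 / (2 * ((n : ℝ) + 2) ^ 3)

open Filter Topology in
lemma azr_invlim (k : ℕ) (hk : k ≠ 0) : Tendsto (fun n : ℕ => 1 / ((n : ℝ) + 2) ^ k) atTop (𝓝 0) := by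
  have h : Tendsto (fun n : ℕ => ((n : ℝ) + 2)) atTop atTop :=
    tendsto_atTop_add_const_right _ _ tendsto_natCast_atTop_atTop
  refine ((tendsto_pow_atTop hk).comp h).inv_tendsto_atTop.congr ?_
  intro n
  simp

open Filter Topology in
lemma azr_bound (n : ℕ) : |azrT n - azrG n| ≤ 1 / ((n : ℝ) + 2) ^ 4 := by
  have hG : Tendsto azrG atTop (𝓝 0) := by
    have := ((azr_invlim 2 (by simp)).const_mul (1/2)).add ((azr_invlim 3 (by simp)).const_mul (1/2))
    simp only [mul_zero, add_zero] at this
    refine this.congr ?_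
    intro n; unfold azrG; field_simp
  have hD := (azr_lim.sub hG).abs.sub (azr_invlim 4 (by simp))
  simp only [sub_zero, abs_zero] at hD
  have hm : Monotone (fun n : ℕ => |azrT n - azrG n| - 1 / ((n : ℝ) + 2) ^ 4) := by
    refine monotone_nat_of_le_succ ?_
    intro n
    have hr := azr_rec n
    have hx : (0 : ℝ) < (n : ℝ) + 2 := by positivity
    have hd : azrT n - azrG n = -(azrT (n + 1) - azrG (n + 1))
        + -((2 * ((n : ℝ) + 2) + 1) / (2 * ((n : ℝ) + 2) ^ 3 * ((n : ℝ) + 3) ^ 3)) := by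
      have : azrT n = 1 / ((n : ℝ) + 2) ^ 2 - azrT (n + 1) := by linarith
      rw [this]; unfold azrG; push_cast
      have h3 : (n : ℝ) + 1 + 2 = n + 3 := by ring
      rw [h3]; field_simp; ring
    have ha : |azrT n - azrG n| ≤ |azrT (n + 1) - azrG (n + 1)|
        + (2 * ((n : ℝ) + 2) + 1) / (2 * ((n : ℝ) + 2) ^ 3 * ((n : ℝ) + 3) ^ 3) := by
      rw [hd]
      refine (abs_add_le _ _).trans ?_
      rw [abs_neg, abs_neg]
      refine add_le_add le_rfl (le_of_eq (abs_of_nonneg (by positivity)))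
    have hc : (2 * ((n : ℝ) + 2) + 1) / (2 * ((n : ℝ) + 2) ^ 3 * ((n : ℝ) + 3) ^ 3)
        ≤ 1 / ((n : ℝ) + 2) ^ 4 - 1 / ((n : ℝ) + 3) ^ 4 := by
      have : 1 / ((n : ℝ) + 2) ^ 4 - 1 / ((n : ℝ) + 3) ^ 4 -
        (2 * ((n : ℝ) + 2) + 1) / (2 * ((n : ℝ) + 2) ^ 3 * ((n : ℝ) + 3) ^ 3)
        = (2 * ((n : ℝ) + 2) + 1) * (3 * ((n : ℝ) + 2) * (n + 3) + 2) / (2 * ((n : ℝ) + 2) ^ 4 * ((n : ℝ) + 3) ^ 4) := by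
        field_simp; ring
      have h0 : 0 ≤ (2 * ((n : ℝ) + 2) + 1) * (3 * ((n : ℝ) + 2) * (n + 3) + 2) / (2 * ((n : ℝ) + 2) ^ 4 * ((n : ℝ) + 3) ^ 4) := by positivity
      linarith
    have h3 : ((n + 1 : ℕ) : ℝ) + 2 = n + 3 := by push_cast; ring
    show _ - _ ≤ _ - 1 / (((n + 1 : ℕ) : ℝ) + 2) ^ 4
    rw [h3]
    linarith
  have := hm.ge_of_tendsto hD n
  simpa using this

lemma azr_main (n : ℕ) (hn : 1 ≤ n) :
    |azrT n - 1 / 2 * (1 / (n : ℝ) ^ 2 - 3 / (n : ℝ) ^ 3)| ≤ 4 / (n : ℝ) ^ 4 := by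
  have hx : (0 : ℝ) < n := by exact_mod_cast hn
  have hb := azr_bound n
  have h1 : 1 / ((n : ℝ) + 2) ^ 4 ≤ 1 / (n : ℝ) ^ 4 := by gcongr; linarith
  have h2 : azrG n - 1 / 2 * (1 / (n : ℝ) ^ 2 - 3 / (n : ℝ) ^ 3)
      = (3 * (n : ℝ) ^ 2 + 14 * n + 12) / ((n : ℝ) ^ 3 * (n + 2) ^ 3) := by
    unfold azrG; field_simp; ring
  have h3 : (3 * (n : ℝ) ^ 2 + 14 * n + 12) / ((n : ℝ) ^ 3 * (n + 2) ^ 3) ≤ 3 / (n : ℝ) ^ 4 := by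
    rw [div_le_div_iff₀ (by positivity) (by positivity)]
    have : 0 ≤ (n : ℝ) ^ 3 * (4 * n ^ 2 + 24 * n + 24) := by positivity
    nlinarith
  have h4 : 0 ≤ (3 * (n : ℝ) ^ 2 + 14 * n + 12) / ((n : ℝ) ^ 3 * (n + 2) ^ 3) := by positivity
  have h5 : 4 / (n : ℝ) ^ 4 = 1 / (n : ℝ) ^ 4 + 3 / (n : ℝ) ^ 4 := by ring
  rw [abs_le] at hb ⊢
  constructor <;> linarith [hb.1, hb.2]

open Filter Topology in
lemma azr_scaled : Tendsto (fun n : ℕ => azrT n * ((n : ℝ) + 2) ^ 2) atTop (𝓝 (1 / 2)) := by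
  have h1 : Tendsto (fun n : ℕ => (azrT n - azrG n) * ((n : ℝ) + 2) ^ 2) atTop (𝓝 0) := by
    refine squeeze_zero_norm ?_ (azr_invlim 2 (by simp))
    intro n
    rw [Real.norm_eq_abs, abs_mul, abs_of_nonneg (a := ((n : ℝ) + 2) ^ 2) (by positivity)]
    calc _ ≤ 1 / ((n : ℝ) + 2) ^ 4 * ((n : ℝ) + 2) ^ 2 := by gcongr; exact azr_bound n
      _ = _ := by field_simp
  have h2 : Tendsto (fun n : ℕ => 1 / 2 + 1 / 2 * (1 / ((n : ℝ) + 2) ^ 1)) atTop (𝓝 (1 / 2)) := by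
    have h := ((azr_invlim 1 (by simp)).const_mul (1 / 2)).const_add (1 / 2)
    rw [mul_zero, add_zero] at h
    exact h
  have h3 := h1.add h2
  rw [zero_add] at h3
  refine h3.congr ?_
  intro n
  unfold azrG; field_simp; ring

open Filter Topology in
lemma azr_ratio : Tendsto (fun n : ℕ => ((-1) ^ (n + 1) * azrT (n + 1)) / ((-1) ^ n * azrT n))
    atTop (𝓝 (-1)) := by
  have h := (azr_scaled.inv₀ (by norm_num)).const_sub 1
  have e : (1 : ℝ) - (1 / 2)⁻¹ = -1 := by norm_num
  rw [e] at h
  refine h.congr' ?_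
  filter_upwards [azr_scaled.eventually_ne (by norm_num : (1 / 2 : ℝ) ≠ 0)] with n hn
  have hT : azrT n ≠ 0 := left_ne_zero_of_mul hn
  have hr : azrT (n + 1) = 1 / ((n : ℝ) + 2) ^ 2 - azrT n := by linarith [azr_rec n]
  have hp : ((-1 : ℝ)) ^ n ≠ 0 := by simp
  have hx : (n : ℝ) + 2 ≠ 0 := by positivity
  rw [hr, pow_succ]
  field_simp
  ring

/-- **Asymptotics of the remainder of the alternating series for π²/12**: the
partial sums `∑_{k=0}^n (−1)^k/(k+1)²` converge to `π²/12`; the remainder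
`r_n = −∑_{k=n+1}^∞ (−1)^k/(k+1)²` equals `((−1)^n/2)(1/n² − 3/n³)` up to an
error `O(1/n⁴)`; and `r_{n+1}/r_n → −1`, i.e. the series is alternating
marginally convergent. -/
theorem alternating_zeta_remainder_asymptotics :
    Filter.Tendsto
      (fun n : ℕ => ∑ k ∈ Finset.range (n + 1), (-1 : ℝ) ^ k / ((k : ℝ) + 1) ^ 2)
      Filter.atTop (nhds (Real.pi ^ 2 / 12)) ∧
    ∃ C : ℝ, 0 < C ∧
      (∀ n : ℕ, 1 ≤ n →
        |(-(∑' j : ℕ, (-1 : ℝ) ^ (n + 1 + j) / ((n : ℝ) + 2 + (j : ℝ)) ^ 2)) -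
            ((-1 : ℝ) ^ n / 2) * (1 / (n : ℝ) ^ 2 - 3 / (n : ℝ) ^ 3)|
          ≤ C / (n : ℝ) ^ 4) ∧
      Filter.Tendsto
        (fun n : ℕ =>
          (-(∑' j : ℕ, (-1 : ℝ) ^ (n + 1 + 1 + j) / ((n : ℝ) + 1 + 2 + (j : ℝ)) ^ 2)) /
          (-(∑' j : ℕ, (-1 : ℝ) ^ (n + 1 + j) / ((n : ℝ) + 2 + (j : ℝ)) ^ 2)))
        Filter.atTop (nhds (-1)) := by
  refine ⟨(azr_alt.tendsto_sum_nat).comp (Filter.tendsto_add_atTop_nat 1), 4, by norm_num, ?_, ?_⟩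
  · intro n hn
    have h := azr_main n hn
    rw [azr_eq]
    have e : (-1 : ℝ) ^ n * azrT n - ((-1 : ℝ) ^ n / 2) * (1 / (n : ℝ) ^ 2 - 3 / (n : ℝ) ^ 3)
        = (-1) ^ n * (azrT n - 1 / 2 * (1 / (n : ℝ) ^ 2 - 3 / (n : ℝ) ^ 3)) := by ring
    rw [e, abs_mul]
    simpa using h
  · refine azr_ratio.congr ?_
    intro n
    rw [azr_eq, ← azr_eq (n + 1)]
    push_cast
    rfl
end
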